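/- arXiv:1407.4934 — 5 statements merged into one kernel-verified Lean document; each statement's English description precedes it below -/
import Mathlib

section
/- Let f be holomorphic on the rectangle P = (-a,a) × (-b,b) ⊂ ℂ, and let M : (-b,b) → [e,∞) be measurable with ∫_{-b}^{b} log⁺ log⁺ M(y) dy < ∞, such that |f(x+iy)| ≤ M(y) for all x+iy ∈ P. Then for every compact K ⊂ P there is a constant C = C(M, d(K,∂P)) with sup_K |f| ≤ C. -/
open MeasureTheory

/-- `log⁺ x = max (log x) 0`. -/
noncomputable def logPlus (x : ℝ) : ℝ := max (Real.log x) 0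

/-- The open rectangle `(-a,a) × (-b,b)` viewed as a subset of `ℂ`. -/
def Rect (a b : ℝ) : Set ℂ := {z | |z.re| < a ∧ |z.im| < b}

lemma aux_piece (s E : Set ℝ) (hs : MeasurableSet s) (y R κ : ℝ) (hR : 0 < R) (_hκ : 0 < κ)
    (hinj : Set.InjOn Real.sin s) (hcos : ∀ θ ∈ s, κ ≤ |Real.cos θ|)
    (hE : ∀ θ ∈ s, y + R * Real.sin θ ∈ E) :
    ENNReal.ofReal (R * κ) * volume s ≤ volume E := by
  have hd : ∀ x ∈ s, HasDerivWithinAt (fun θ => y + R * Real.sin θ) (R * Real.cos x) s x :=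
    fun x _ => (((Real.hasDerivAt_sin x).const_mul R).const_add y).hasDerivWithinAt
  have hi : Set.InjOn (fun θ => y + R * Real.sin θ) s := by
    intro u hu v hv h
    apply hinj hu hv
    have h' : y + R * Real.sin u = y + R * Real.sin v := h
    exact mul_left_cancel₀ hR.ne' (add_left_cancel h')
  have h := lintegral_image_eq_lintegral_abs_deriv_mul hs hd hi (fun _ => 1)
  simp only [lintegral_const, Measure.restrict_apply, MeasurableSet.univ, Set.univ_inter,
    mul_one, one_mul] at h
  calc ENNReal.ofReal (R * κ) * volume s = ∫⁻ _ in s, ENNReal.ofReal (R * κ) := by simp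
    _ ≤ ∫⁻ x in s, ENNReal.ofReal |R * Real.cos x| := by
      apply setLIntegral_mono' hs
      intro x hx
      apply ENNReal.ofReal_le_ofReal
      rw [abs_mul, abs_of_pos hR]
      exact mul_le_mul_of_nonneg_left (hcos x hx) hR.le
    _ = volume ((fun θ => y + R * Real.sin θ) '' s) := h.symm
    _ ≤ volume E := by
      apply measure_mono
      rintro _ ⟨x, hx, rfl⟩
      exact hE x hx

lemma aux_piece2 (E : Set ℝ) (hEm : MeasurableSet E) (y R p ε : ℝ) (hR : 0 < R) (hε : ε ≠ 0)
    (hsin : ∀ x, Real.sin x = ε * Real.sin (x - p))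
    (hcos : ∀ x, |Real.cos x| = |Real.cos (x - p)|)
    (hER : volume E ≤ ENNReal.ofReal (R * Real.sin (1/4) / 6)) :
    volume {θ | |θ - p| ≤ Real.pi / 2 - 1/4 ∧ y + R * Real.sin θ ∈ E} ≤ ENNReal.ofReal (1/6) := by
  have hpi := Real.pi_gt_three
  have hs4 : 0 < Real.sin (1/4) := Real.sin_pos_of_pos_of_lt_pi (by norm_num) (by linarith)
  set s := {θ | |θ - p| ≤ Real.pi / 2 - 1/4 ∧ y + R * Real.sin θ ∈ E} with hsdef
  have hsm : MeasurableSet s := by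
    apply MeasurableSet.inter
    · exact measurableSet_le (f := fun θ : ℝ => |θ - p|) (g := fun _ => Real.pi / 2 - 1/4) (by fun_prop) (by fun_prop)
    · exact hEm.preimage (f := fun θ => y + R * Real.sin θ) (by fun_prop)
  have h := aux_piece s E hsm y R (Real.sin (1/4)) hR hs4 ?_ ?_ (fun θ hθ => hθ.2)
  · have h2 := h.trans hER
    have hpos : 0 < R * Real.sin (1/4) := by positivity
    have : ENNReal.ofReal (R * Real.sin (1/4) / 6)
        = ENNReal.ofReal (R * Real.sin (1/4)) * ENNReal.ofReal (1/6) := by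
      rw [← ENNReal.ofReal_mul hpos.le]; congr 1; ring
    rw [this] at h2
    exact (ENNReal.mul_le_mul_iff_right (by simpa using hpos) ENNReal.ofReal_ne_top).1 h2
  · intro u hu v hv huv
    rw [hsin u, hsin v] at huv
    have h1 := mul_left_cancel₀ hε huv
    have hu1 := abs_le.1 hu.1
    have hv1 := abs_le.1 hv.1
    have := Real.injOn_sin (x₁ := u - p) (x₂ := v - p) ⟨by linarith, by linarith⟩ ⟨by linarith, by linarith⟩ h1
    linarith
  · intro θ hθ
    rw [hcos]
    refine le_trans ?_ (le_abs_self _)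
    rw [← Real.cos_abs, ← Real.cos_pi_div_two_sub]
    exact Real.cos_le_cos_of_nonneg_of_le_pi (abs_nonneg _) (by linarith) hθ.1

lemma aux_angle (E : Set ℝ) (hEm : MeasurableSet E) (y R : ℝ) (hR : 0 < R)
    (hER : volume E ≤ ENNReal.ofReal (R * Real.sin (1/4) / 6)) :
    volume {θ | θ ∈ Set.Ioc 0 (2 * Real.pi) ∧ y + R * Real.sin θ ∈ E}
      ≤ ENNReal.ofReal (3/2) := by
  have h0 := aux_piece2 E hEm y R 0 1 hR (by norm_num) (by simp) (by simp) hER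
  have h1 := aux_piece2 E hEm y R Real.pi (-1) hR (by norm_num) (by simp [Real.sin_sub_pi])
    (by simp [Real.cos_sub_pi]) hER
  have h2 := aux_piece2 E hEm y R (2 * Real.pi) 1 hR (by norm_num) (by simp [Real.sin_sub_two_pi])
    (by simp [Real.cos_sub_two_pi]) hER
  have hsub : {θ | θ ∈ Set.Ioc 0 (2 * Real.pi) ∧ y + R * Real.sin θ ∈ E} ⊆
      {θ | |θ - 0| ≤ Real.pi / 2 - 1/4 ∧ y + R * Real.sin θ ∈ E} ∪
      {θ | |θ - Real.pi| ≤ Real.pi / 2 - 1/4 ∧ y + R * Real.sin θ ∈ E} ∪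
      {θ | |θ - 2 * Real.pi| ≤ Real.pi / 2 - 1/4 ∧ y + R * Real.sin θ ∈ E} ∪
      Set.Icc (Real.pi/2 - 1/4) (Real.pi/2 + 1/4) ∪
      Set.Icc (3 * Real.pi/2 - 1/4) (3 * Real.pi/2 + 1/4) := by
    rintro θ ⟨⟨ha, hb⟩, hE⟩
    simp only [Set.mem_union, Set.mem_ofPred_eq, Set.mem_Icc, hE, and_true, abs_le]
    by_cases c1 : θ ≤ Real.pi/2 - 1/4
    · left; left; left; left; constructor <;> linarith
    by_cases c2 : θ ≤ Real.pi/2 + 1/4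
    · left; right; constructor <;> linarith
    by_cases c3 : θ ≤ 3 * Real.pi/2 - 1/4
    · left; left; left; right; constructor <;> linarith
    by_cases c4 : θ ≤ 3 * Real.pi/2 + 1/4
    · right; constructor <;> linarith
    · left; left; right; constructor <;> linarith
  refine (measure_mono hsub).trans ?_
  refine (measure_union_le _ _).trans ?_
  refine (add_le_add_left (measure_union_le _ _) _).trans ?_
  refine (add_le_add_left (add_le_add_left (measure_union_le _ _) _) _).trans ?_
  refine (add_le_add_left (add_le_add_left (add_le_add_left (measure_union_le _ _) _) _) _).trans ?_
  rw [Real.volume_Icc, Real.volume_Icc]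
  refine (add_le_add_left (add_le_add_left (add_le_add (add_le_add h0 h1) h2) _) _).trans ?_
  have e1 : Real.pi/2 + 1/4 - (Real.pi/2 - 1/4) = 1/2 := by ring
  have e2 : 3*Real.pi/2 + 1/4 - (3*Real.pi/2 - 1/4) = 1/2 := by ring
  rw [e1, e2, ← ENNReal.ofReal_add, ← ENNReal.ofReal_add, ← ENNReal.ofReal_add,
    ← ENNReal.ofReal_add]
  · norm_num
  all_goals norm_num

lemma aux_jensen (f : ℂ → ℂ) (c : ℂ) (R : ℝ) (hR : 0 < R)
    (hf : AnalyticOnNhd ℂ f (Metric.closedBall c R)) (hc : f c ≠ 0) :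
    Real.log ‖f c‖ ≤ Real.circleAverage (fun z => Real.log ‖f z‖) c R := by
  have hRa : |R| = R := abs_of_pos hR
  have h := MeromorphicOn.circleAverage_log_norm (c := c) (f := f) hR.ne'
    (by rw [hRa]; exact hf.meromorphicOn)
  rw [h, hRa]
  have hcm : c ∈ Metric.closedBall c R := Metric.mem_closedBall_self hR.le
  have htr : meromorphicTrailingCoeffAt f c = f c :=
    (hf c hcm).meromorphicTrailingCoeffAt_of_ne_zero hc
  have hdiv : MeromorphicOn.divisor f (Metric.closedBall c R) c = 0 := by
    rw [MeromorphicOn.divisor_apply hf.meromorphicOn hcm]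
    rw [(hf c hcm).meromorphicOrderAt_eq, (hf c hcm).analyticOrderAt_eq_zero.2 hc]
    simp
  rw [htr, hdiv]
  have hn : 0 ≤ ∑ᶠ u, (MeromorphicOn.divisor f (Metric.closedBall c R) u : ℝ)
      * Real.log (R * ‖c - u‖⁻¹) := by
    apply finsum_nonneg
    intro u
    by_cases hu : u ∈ Metric.closedBall c R
    · apply mul_nonneg
      · have := (MeromorphicOn.AnalyticOnNhd.divisor_nonneg hf) u
        exact_mod_cast this
      · by_cases huc : u = c
        · simp [huc]
        · apply Real.log_nonneg
          have hp : 0 < ‖c - u‖ := norm_pos_iff.2 (sub_ne_zero.2 (Ne.symm huc))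
          rw [← div_eq_mul_inv, one_le_div hp]
          rw [Metric.mem_closedBall, dist_comm, dist_eq_norm] at hu
          exact hu
    · rw [Function.locallyFinsuppWithin.apply_eq_zero_of_notMem _ hu]
      simp
  simp only [Int.cast_zero, zero_mul, add_zero]
  linarith

lemma aux_step (f : ℂ → ℂ) (c : ℂ) (R t : ℝ) (hR : 0 < R) (ht : 0 < t)
    (hf : AnalyticOnNhd ℂ f (Metric.closedBall c R))
    (E : Set ℝ) (hEm : MeasurableSet E)
    (hER : volume E ≤ ENNReal.ofReal (R * Real.sin (1/4) / 6))
    (hgood : ∀ z ∈ Metric.closedBall c R, z.im ∉ E → Real.log ‖f z‖ ≤ t / 2)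
    (hall : ∀ z ∈ Metric.closedBall c R, Real.log ‖f z‖ ≤ 2 * t) :
    Real.log ‖f c‖ < t := by
  by_cases hc : f c = 0
  · simpa [hc] using ht
  have hj := aux_jensen f c R hR hf hc
  have hRa : |R| = R := abs_of_pos hR
  have hci : CircleIntegrable (fun z => Real.log ‖f z‖) c R := by
    apply MeromorphicOn.circleIntegrable_log_norm
    rw [hRa]
    exact fun z hz => hf.meromorphicOn z (Metric.sphere_subset_closedBall hz)
  set B : Set ℝ := {θ | c.im + R * Real.sin θ ∈ E} with hB
  have hBm : MeasurableSet B := hEm.preimage (f := fun θ => c.im + R * Real.sin θ) (by fun_prop)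
  have hpi := Real.pi_gt_three
  have hBI := aux_angle E hEm c.im R hR hER
  have hgi : IntervalIntegrable (fun θ => t / 2 + B.indicator (fun _ => 3 * t / 2) θ) volume 0 (2 * Real.pi) := by
    apply IntervalIntegrable.add
    · exact intervalIntegrable_const
    · rw [intervalIntegrable_iff_integrableOn_Ioc_of_le (by positivity)]
      apply Integrable.indicator _ hBm
      exact integrable_const _
  have hle : ∫ θ in (0:ℝ)..(2 * Real.pi), Real.log ‖f (circleMap c R θ)‖ ≤
      ∫ θ in (0:ℝ)..(2 * Real.pi), (t / 2 + B.indicator (fun _ => 3 * t / 2) θ) := by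
    apply intervalIntegral.integral_mono_on (by positivity) hci hgi
    intro θ _
    have hm : circleMap c R θ ∈ Metric.closedBall c R := circleMap_mem_closedBall c hR.le θ
    have him : (circleMap c R θ).im = c.im + R * Real.sin θ := by
      simp [circleMap, Complex.exp_im]
    by_cases hθ : θ ∈ B
    · rw [Set.indicator_of_mem hθ]
      have := hall _ hm
      linarith
    · rw [Set.indicator_of_notMem hθ]
      have := hgood _ hm (by rw [him]; exact hθ)
      linarith
  have hval : ∫ θ in (0:ℝ)..(2 * Real.pi), (t / 2 + B.indicator (fun _ => 3 * t / 2) θ)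
      ≤ 2 * Real.pi * (t / 2) + 3 / 2 * (3 * t / 2) := by
    rw [intervalIntegral.integral_add intervalIntegrable_const]
    · rw [intervalIntegral.integral_const, intervalIntegral.integral_of_le (by positivity),
        integral_indicator hBm, setIntegral_const, measureReal_def, Measure.restrict_apply hBm]
      have : (volume (B ∩ Set.Ioc 0 (2 * Real.pi))).toReal ≤ 3 / 2 := by
        apply ENNReal.toReal_le_of_le_ofReal (by norm_num)
        refine le_trans (measure_mono ?_) hBI
        exact fun θ h => ⟨h.2, h.1⟩
      simp only [smul_eq_mul, sub_zero]
      have := mul_le_mul_of_nonneg_right this (by positivity : 0 ≤ 3 * t / 2)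
      linarith
    · rw [intervalIntegrable_iff_integrableOn_Ioc_of_le (by positivity)]
      apply Integrable.indicator _ hBm
      exact integrable_const _
  have hca : Real.circleAverage (fun z => Real.log ‖f z‖) c R * (2 * Real.pi) ≤
      2 * Real.pi * (t / 2) + 3 / 2 * (3 * t / 2) := by
    rw [Real.circleAverage_def, smul_eq_mul]
    refine le_trans (le_of_eq ?_) (hle.trans hval)
    field_simp
  by_contra hcon
  push Not at hcon
  have : t * (2 * Real.pi) ≤ 2 * Real.pi * (t / 2) + 3 / 2 * (3 * t / 2) :=
    le_trans (mul_le_mul_of_nonneg_right (hcon.trans hj) (by positivity)) hca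
  nlinarith

lemma aux_summable (b : ℝ) (M : ℝ → ℝ) (hMmeas : Measurable M)
    (hMint : IntegrableOn (fun y => logPlus (logPlus (M y))) (Set.Ioo (-b) b)) :
    Summable (fun n : ℕ => volume.real {y | y ∈ Set.Ioo (-b) b ∧ (2:ℝ) ^ n < Real.log (M y)}) := by
  set S : ℕ → Set ℝ := fun n => {y | (2:ℝ) ^ n < Real.log (M y)} with hS
  have hSm : ∀ n, MeasurableSet (S n) := fun n =>
    measurableSet_lt measurable_const (Real.measurable_log.comp hMmeas)
  have hl2 : 0 < Real.log 2 := Real.log_pos (by norm_num)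
  have hlam : ∀ n, volume.real {y | y ∈ Set.Ioo (-b) b ∧ (2:ℝ) ^ n < Real.log (M y)}
      = ∫ y in Set.Ioo (-b) b, (S n).indicator (fun _ => (1:ℝ)) y := by
    intro n
    rw [integral_indicator (hSm n), setIntegral_const, smul_eq_mul, mul_one, measureReal_def,
      measureReal_def, Measure.restrict_apply (hSm n)]
    congr 2
    ext y
    exact and_comm
  have hbd : ∀ y n, ∑ i ∈ Finset.range n, (S i).indicator (fun _ => (1:ℝ)) y
      ≤ logPlus (logPlus (M y)) / Real.log 2 + 1 := by
    intro y n
    have hh0 : 0 ≤ logPlus (logPlus (M y)) := le_max_right _ _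
    set h := logPlus (logPlus (M y)) with hh
    have hx : 0 ≤ h / Real.log 2 := by positivity
    have key : ∀ i, y ∈ S i → (i:ℝ) < h / Real.log 2 := by
      intro i hi
      rw [lt_div_iff₀ hl2, ← Real.log_pow]
      have h1 : (2:ℝ) ^ i < logPlus (M y) := lt_of_lt_of_le hi (le_max_left _ _)
      exact lt_of_lt_of_le (Real.log_lt_log (by positivity) h1) (le_max_left _ _)
    calc ∑ i ∈ Finset.range n, (S i).indicator (fun _ => (1:ℝ)) y
        ≤ ∑ i ∈ Finset.range n, if i < ⌈h / Real.log 2⌉₊ then (1:ℝ) else 0 := by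
          apply Finset.sum_le_sum
          intro i _
          by_cases hi : y ∈ S i
          · rw [Set.indicator_of_mem hi, if_pos (Nat.lt_ceil.2 (key i hi))]
          · rw [Set.indicator_of_notMem hi]; positivity
      _ ≤ (⌈h / Real.log 2⌉₊ : ℝ) := by
          rw [← Finset.sum_filter, Finset.sum_const, nsmul_eq_mul, mul_one]
          norm_cast
          calc _ ≤ (Finset.range ⌈h / Real.log 2⌉₊).card := by
                apply Finset.card_le_card
                intro i hi
                simp at hi ⊢
                exact hi.2
            _ = _ := by simp
      _ ≤ h / Real.log 2 + 1 := (Nat.ceil_lt_add_one hx).le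
  have hint : ∀ n, IntegrableOn ((S n).indicator (fun _ => (1:ℝ))) (Set.Ioo (-b) b) := fun n =>
    Integrable.indicator (integrable_const _) (hSm n)
  apply summable_of_sum_range_le
    (c := ∫ y in Set.Ioo (-b) b, (logPlus (logPlus (M y)) / Real.log 2 + 1))
  · intro n; positivity
  · intro n
    simp_rw [hlam]
    rw [← integral_finsetSum _ (fun i _ => hint i)]
    apply integral_mono
    · exact integrable_finsetSum _ (fun i _ => hint i)
    · exact (hMint.div_const _).add (integrable_const _)
    · intro y; exact hbd y n

/-- Levinson's log log theorem: a holomorphic function on the rectangle `(-a,a) × (-b,b)`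
dominated by `M(y) ≥ e` with `∫ log⁺ log⁺ M < ∞` is bounded on each compact `K` by a
constant depending only on `M` (with its domain `(-b,b)`) and `d(K, ∂P)`. -/
theorem stmt1 (b : ℝ) (hb : 0 < b) (M : ℝ → ℝ) (hMmeas : Measurable M)
    (hMe : ∀ y ∈ Set.Ioo (-b) b, Real.exp 1 ≤ M y)
    (hMint : IntegrableOn (fun y => logPlus (logPlus (M y))) (Set.Ioo (-b) b))
    (δ : ℝ) (hδ : 0 < δ) :
    ∃ C : ℝ, ∀ (a : ℝ), 0 < a → ∀ f : ℂ → ℂ, DifferentiableOn ℂ f (Rect a b) →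
      (∀ z ∈ Rect a b, ‖f z‖ ≤ M z.im) →
      ∀ K : Set ℂ, IsCompact K → K ⊆ Rect a b →
        (∀ z ∈ K, δ ≤ Metric.infDist z (Rect a b)ᶜ) →
        ∀ z ∈ K, ‖f z‖ ≤ C := by
  have hpi := Real.pi_gt_three
  have hs4 : 0 < Real.sin (1/4) := Real.sin_pos_of_pos_of_lt_pi (by norm_num) (by linarith)
  set E : ℕ → Set ℝ := fun n => {y | y ∈ Set.Ioo (-b) b ∧ (2:ℝ) ^ n < Real.log (M y)} with hE
  have hEm : ∀ n, MeasurableSet (E n) := fun n =>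
    measurableSet_Ioo.inter (measurableSet_lt measurable_const (Real.measurable_log.comp hMmeas))
  have hEfin : ∀ n, volume (E n) ≠ ⊤ := fun n =>
    ne_top_of_le_ne_top (by simp) (measure_mono (fun y hy => hy.1 : E n ⊆ Set.Ioo (-b) b))
  set r : ℕ → ℝ := fun n => 6 / Real.sin (1/4) * volume.real (E n) + (1/2:ℝ) ^ n with hr
  have hrpos : ∀ n, 0 < r n := fun n => by positivity
  have hrs : Summable r :=
    ((aux_summable b M hMmeas hMint).mul_left _).add summable_geometric_two
  have hEr : ∀ n, volume (E n) ≤ ENNReal.ofReal (r n * Real.sin (1/4) / 6) := by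
    intro n
    rw [← ENNReal.ofReal_toReal (hEfin n)]
    apply ENNReal.ofReal_le_ofReal
    change volume.real (E n) ≤ _
    have : r n * Real.sin (1/4) / 6 = volume.real (E n) + (1/2:ℝ)^n * Real.sin (1/4) / 6 := by
      simp only [hr]; field_simp
    rw [this]
    have : 0 ≤ (1/2:ℝ)^n * Real.sin (1/4) / 6 := by positivity
    linarith
  obtain ⟨N, hN⟩ : ∃ N, ∑' k, r (k + N) < δ :=
    ((tendsto_sum_nat_add r).eventually (gt_mem_nhds hδ)).exists
  set T := ∑' k, r (k + N) with hT
  have hrsN : Summable (fun k => r (k + N)) := (summable_nat_add_iff N).2 hrs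
  have hpart : ∀ n, ∑ k ∈ Finset.range n, r (k + N) ≤ T := fun n =>
    hrsN.sum_le_tsum _ (fun i _ => (hrpos _).le)
  refine ⟨Real.exp (2 ^ (N + 1)), ?_⟩
  intro a ha f hf hfM K _ hKR hKδ z₀ hz₀
  by_contra hcon
  push Not at hcon
  have hball : Metric.closedBall z₀ T ⊆ Rect a b := by
    intro w hw
    by_contra hwn
    have h1 := Metric.infDist_le_dist_of_mem (x := z₀) (s := (Rect a b)ᶜ) hwn
    have h2 := hKδ z₀ hz₀
    rw [Metric.mem_closedBall, dist_comm] at hw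
    linarith
  have hopen : IsOpen (Rect a b) := by
    apply IsOpen.inter
    · exact isOpen_lt (continuous_abs.comp Complex.continuous_re) continuous_const
    · exact isOpen_lt (continuous_abs.comp Complex.continuous_im) continuous_const
  have han : AnalyticOnNhd ℂ f (Rect a b) := hf.analyticOnNhd hopen
  have hstep : ∀ n : ℕ, ∃ z, dist z z₀ ≤ ∑ k ∈ Finset.range n, r (k + N) ∧
      (2:ℝ) ^ (N + 1 + n) ≤ Real.log ‖f z‖ := by
    intro n
    induction n with
    | zero =>
      refine ⟨z₀, by simp, ?_⟩
      rw [add_zero, Real.le_log_iff_exp_le (lt_trans (Real.exp_pos _) hcon)]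
      exact hcon.le
    | succ n ih =>
      obtain ⟨z, hz, hfz⟩ := ih
      by_contra hno
      push Not at hno
      have hsub : ∀ w ∈ Metric.closedBall z (r (n + N)),
          dist w z₀ ≤ ∑ k ∈ Finset.range (n + 1), r (k + N) := by
        intro w hw
        rw [Finset.sum_range_succ]
        have := dist_triangle w z z₀
        rw [Metric.mem_closedBall] at hw
        linarith
      have hsubR : Metric.closedBall z (r (n + N)) ⊆ Rect a b := fun w hw =>
        hball ((hsub w hw).trans (hpart _))
      have := aux_step f z (r (n + N)) (2 ^ (N + 1 + n)) (hrpos _) (by positivity)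
        (han.mono hsubR) (E (n + N)) (hEm _) (hEr _) ?_ ?_
      · linarith
      · intro w hw hwE
        have hwR := hsubR hw
        have him : w.im ∈ Set.Ioo (-b) b := abs_lt.1 hwR.2
        have h1 : Real.log (M w.im) ≤ 2 ^ (n + N) := by
          by_contra h
          exact hwE ⟨him, not_le.1 h⟩
        have h2 : (2:ℝ) ^ (N + 1 + n) / 2 = 2 ^ (n + N) := by ring
        rw [h2]
        by_cases hw0 : f w = 0
        · simp [hw0]
        · exact (Real.log_le_log (norm_pos_iff.2 hw0) (hfM w hwR)).trans h1
      · intro w hw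
        have h1 := hno w (hsub w hw)
        have h2 : (2:ℝ) ^ (N + 1 + (n + 1)) = 2 * 2 ^ (N + 1 + n) := by ring
        linarith
  obtain ⟨B, hB⟩ := (isCompact_closedBall z₀ T).exists_bound_of_continuousOn
    (hf.continuousOn.mono hball)
  obtain ⟨n, hn⟩ := pow_unbounded_of_one_lt B (by norm_num : (1:ℝ) < 2)
  obtain ⟨z, hz, hfz⟩ := hstep n
  have h1 := hB z (hz.trans (hpart n))
  have h2 : (2:ℝ) ^ n ≤ 2 ^ (N + 1 + n) := pow_le_pow_right₀ (by norm_num) (by omega)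
  have h3 := Real.log_le_self (norm_nonneg (f z))
  linarith
end

section
/- Let u be a harmonic function on an open set U ⊂ ℝ³ containing a line segment L, such that u is harmonic on U \ L, bounded on U, and continuous on U. Then u is harmonic on all of U. -/
/-- Harmonicity on a subset of `ℝⁿ` (Euclidean space): `C²` and vanishing Laplacian. -/
def HarmonicOnE {n : ℕ} (u : EuclideanSpace ℝ (Fin n) → ℝ)
    (s : Set (EuclideanSpace ℝ (Fin n))) : Prop :=
  ContDiffOn ℝ 2 u s ∧ ∀ x ∈ s,
    (∑ i : Fin n, fderiv ℝ (fun y => fderiv ℝ u y (EuclideanSpace.single i 1)) x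
      (EuclideanSpace.single i 1)) = 0

open MeasureTheory Set Filter Topology
open scoped ContDiff

namespace Rem

abbrev E3 := EuclideanSpace ℝ (Fin 3)

/-- Partial derivative. -/
noncomputable def pd (i : Fin 3) (f : E3 → ℝ) : E3 → ℝ :=
  fun y => fderiv ℝ f y (EuclideanSpace.single i 1)

/-- Laplacian. -/
noncomputable def lap (f : E3 → ℝ) (x : E3) : ℝ := ∑ i : Fin 3, pd i (pd i f) x

lemma pd_contDiffAt {n m : WithTop ℕ∞} {f : E3 → ℝ} {x : E3} (i : Fin 3) (hf : ContDiffAt ℝ n f x)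
    (h : m + 1 ≤ n) : ContDiffAt ℝ m (pd i f) x :=
  (hf.fderiv_right h).clm_apply contDiffAt_const

lemma pd_contDiff {f : E3 → ℝ} (i : Fin 3) (hf : ContDiff ℝ ∞ f) : ContDiff ℝ ∞ (pd i f) :=
  (hf.fderiv_right (by simp)).clm_apply contDiff_const

lemma lap_contDiff {f : E3 → ℝ} (hf : ContDiff ℝ ∞ f) : ContDiff ℝ ∞ (lap f) := by
  unfold lap
  exact ContDiff.sum fun i _ => pd_contDiff i (pd_contDiff i hf)

lemma tsupport_pd (i : Fin 3) (f : E3 → ℝ) : tsupport (pd i f) ⊆ tsupport f := by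
  refine closure_minimal (fun x hx => ?_) (isClosed_tsupport f)
  refine support_fderiv_subset ℝ (f := f) ?_
  intro h
  apply hx
  simp [pd, h]

lemma tsupport_lap (f : E3 → ℝ) : tsupport (lap f) ⊆ tsupport f := by
  refine closure_minimal (fun x hx => ?_) (isClosed_tsupport f)
  by_contra hn
  apply hx
  refine Finset.sum_eq_zero fun i _ => ?_
  by_contra h
  exact hn (tsupport_pd i f (tsupport_pd i _ (subset_closure h)))

lemma pd_mul {f g : E3 → ℝ} {x : E3} (i : Fin 3) (hf : DifferentiableAt ℝ f x)
    (hg : DifferentiableAt ℝ g x) :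
    pd i (fun y => f y * g y) x = f x * pd i g x + g x * pd i f x := by
  simp only [pd]
  rw [fderiv_fun_mul hf hg]
  simp

lemma pd_add {f g : E3 → ℝ} {x : E3} (i : Fin 3) (hf : DifferentiableAt ℝ f x)
    (hg : DifferentiableAt ℝ g x) :
    pd i (fun y => f y + g y) x = pd i f x + pd i g x := by
  simp only [pd]
  rw [fderiv_fun_add hf hg]
  simp

lemma smooth_diff {F : Type*} [NormedAddCommGroup F] [NormedSpace ℝ F] {f : F → ℝ}
    (hf : ContDiff ℝ ∞ f) : Differentiable ℝ f := hf.differentiable (by simp)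

lemma lap_mul {f g : E3 → ℝ} (hf : ContDiff ℝ ∞ f) (hg : ContDiff ℝ ∞ g) (x : E3) :
    lap (fun y => f y * g y) x
      = f x * lap g x + 2 * ∑ i, pd i f x * pd i g x + g x * lap f x := by
  have key : ∀ i, pd i (pd i (fun y => f y * g y)) x =
      f x * pd i (pd i g) x + 2 * (pd i f x * pd i g x) + g x * pd i (pd i f) x := by
    intro i
    have h1 : pd i (fun y => f y * g y) = fun y => f y * pd i g y + g y * pd i f y := by
      funext y
      exact pd_mul i (smooth_diff hf y) (smooth_diff hg y)
    have hf' := smooth_diff (pd_contDiff i hf)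
    have hg' := smooth_diff (pd_contDiff i hg)
    have hf0 := smooth_diff hf
    have hg0 := smooth_diff hg
    rw [h1, pd_add i ((hf0 x).fun_mul (hg' x)) ((hg0 x).fun_mul (hf' x)), pd_mul i (hf0 x) (hg' x),
      pd_mul i (hg0 x) (hf' x)]
    ring
  simp only [lap, key, Finset.sum_add_distrib, Finset.mul_sum]

lemma pd_comp {h : ℝ → ℝ} {q : E3 → ℝ} {x : E3} (i : Fin 3) (hh : DifferentiableAt ℝ h (q x))
    (hq : DifferentiableAt ℝ q x) :
    pd i (fun y => h (q y)) x = deriv h (q x) * pd i q x := by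
  simp only [pd]
  have := (hh.hasDerivAt.comp_hasFDerivAt x hq.hasFDerivAt).fderiv
  rw [show (fun y => h (q y)) = h ∘ q from rfl, this]
  simp

lemma deriv_smooth {h : ℝ → ℝ} (hh : ContDiff ℝ ∞ h) : ContDiff ℝ ∞ (deriv h) := by
  exact (contDiff_infty_iff_deriv.1 hh).2

lemma lap_comp {h : ℝ → ℝ} {q : E3 → ℝ} (hh : ContDiff ℝ ∞ h) (hq : ContDiff ℝ ∞ q) (x : E3) :
    lap (fun y => h (q y)) x
      = deriv (deriv h) (q x) * ∑ i, (pd i q x) ^ 2 + deriv h (q x) * lap q x := by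
  have key : ∀ i, pd i (pd i (fun y => h (q y))) x =
      deriv (deriv h) (q x) * (pd i q x) ^ 2 + deriv h (q x) * pd i (pd i q) x := by
    intro i
    have h1 : pd i (fun y => h (q y)) = fun y => deriv h (q y) * pd i q y := by
      funext y
      exact pd_comp i (smooth_diff hh _) (smooth_diff hq y)
    have hq' := smooth_diff (pd_contDiff i hq)
    have hq0 := smooth_diff hq
    have hd := smooth_diff (deriv_smooth hh)
    rw [h1, pd_mul i ((hd (q x)).fun_comp' x (hq0 x)) (hq' x), pd_comp i (hd _) (hq0 x)]
    ring
  simp only [lap, key, Finset.sum_add_distrib, Finset.mul_sum]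

lemma integrable_mul {V : Set E3} (hV : IsOpen V) {a g : E3 → ℝ} (ha : ContinuousOn a V)
    (hg : Continuous g) (hc : HasCompactSupport g) (hs : tsupport g ⊆ V) :
    Continuous (fun x => a x * g x) ∧ Integrable (fun x => a x * g x) := by
  have h1 : Continuous (fun x => a x * g x) := by
    refine (ha.mul hg.continuousOn).continuous_of_tsupport_subset hV ?_
    exact (tsupport_mul_subset_right (f := a) (g := g)).trans hs
  exact ⟨h1, h1.integrable_of_hasCompactSupport hc.mul_left⟩

/-- Green's formula against test functions. -/
lemma green {V : Set E3} (hV : IsOpen V) {u ψ : E3 → ℝ} (hu : ContDiffOn ℝ 2 u V)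
    (hl : ∀ x ∈ V, lap u x = 0) (hψ : ContDiff ℝ ∞ ψ) (hc : HasCompactSupport ψ)
    (hs : tsupport ψ ⊆ V) : ∫ x, u x * lap ψ x = 0 := by
  have hua : ∀ x ∈ V, ContDiffAt ℝ 2 u x := fun x hx => hu.contDiffAt (hV.mem_nhds hx)
  have hu1 : ∀ i, ∀ x ∈ V, ContDiffAt ℝ 1 (pd i u) x := fun i x hx =>
    pd_contDiffAt i (hua x hx) (by norm_num)
  have hu2 : ∀ i, ∀ x ∈ V, ContDiffAt ℝ 0 (pd i (pd i u)) x := fun i x hx =>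
    pd_contDiffAt i (hu1 i x hx) (by norm_num)
  have c0 : ContinuousOn u V := hu.continuousOn
  have c1 : ∀ i, ContinuousOn (pd i u) V := fun i x hx =>
    (hu1 i x hx).continuousAt.continuousWithinAt
  have c2 : ∀ i, ContinuousOn (pd i (pd i u)) V := fun i x hx =>
    (hu2 i x hx).continuousAt.continuousWithinAt
  have s1 : ∀ i, tsupport (pd i ψ) ⊆ V := fun i => (tsupport_pd i ψ).trans hs
  have s2 : ∀ i, tsupport (pd i (pd i ψ)) ⊆ V := fun i => (tsupport_pd i _).trans (s1 i)
  have k1 : ∀ i, HasCompactSupport (pd i ψ) := fun i =>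
    hc.of_isClosed_subset (isClosed_tsupport _) (tsupport_pd i ψ)
  have k2 : ∀ i, HasCompactSupport (pd i (pd i ψ)) := fun i =>
    (k1 i).of_isClosed_subset (isClosed_tsupport _) (tsupport_pd i _)
  have d1 : ∀ i, ContDiff ℝ ∞ (pd i ψ) := fun i => pd_contDiff i hψ
  have d2 : ∀ i, ContDiff ℝ ∞ (pd i (pd i ψ)) := fun i => pd_contDiff i (d1 i)
  have I0 : ∀ i, Integrable (fun x => u x * pd i (pd i ψ) x) := fun i =>
    (integrable_mul hV c0 (d2 i).continuous (k2 i) (s2 i)).2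
  have I1 : ∀ i, Integrable (fun x => pd i (pd i u) x * ψ x) := fun i =>
    (integrable_mul hV (c2 i) hψ.continuous hc hs).2
  have key : ∀ i, ∫ x, u x * pd i (pd i ψ) x = ∫ x, pd i (pd i u) x * ψ x := by
    intro i
    have e1 := integral_mul_fderiv_eq_neg_fderiv_mul_of_integrable (μ := (volume : Measure E3))
      (f := u) (g := pd i ψ) (v := EuclideanSpace.single i 1)
      (integrable_mul hV (c1 i) (d1 i).continuous (k1 i) (s1 i)).2
      (I0 i)
      (integrable_mul hV c0 (d1 i).continuous (k1 i) (s1 i)).2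
      (fun x hx => (hua x (s1 i hx)).differentiableAt (by norm_num))
      (fun x _ => smooth_diff (d1 i) x)
    have e2 := integral_mul_fderiv_eq_neg_fderiv_mul_of_integrable (μ := (volume : Measure E3))
      (f := pd i u) (g := ψ) (v := EuclideanSpace.single i 1)
      (I1 i)
      (integrable_mul hV (c1 i) (d1 i).continuous (k1 i) (s1 i)).2
      (integrable_mul hV (c1 i) hψ.continuous hc hs).2
      (fun x hx => (hu1 i x (hs hx)).differentiableAt (by norm_num))
      (fun x _ => smooth_diff hψ x)
    have e2' : ∫ x, pd i u x * pd i ψ x = -∫ x, pd i (pd i u) x * ψ x := e2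
    have e1' : ∫ x, u x * pd i (pd i ψ) x = -∫ x, pd i u x * pd i ψ x := e1
    rw [e1', e2', neg_neg]
  have : ∫ x, u x * lap ψ x = ∫ x, lap u x * ψ x := by
    simp only [lap, Finset.mul_sum, Finset.sum_mul]
    rw [integral_finsetSum _ (fun i _ => I0 i), integral_finsetSum _ (fun i _ => I1 i)]
    exact Finset.sum_congr rfl fun i _ => key i
  rw [this]
  have : ∀ x, lap u x * ψ x = 0 := by
    intro x
    by_cases hx : x ∈ tsupport ψ
    · rw [hl x (hs hx), zero_mul]
    · rw [image_eq_zero_of_notMem_tsupport hx, mul_zero]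
  simp [this]

/-- An affine functional. -/
noncomputable def aff (a x : E3) : E3 → ℝ := fun z => inner ℝ a (z - x)

lemma aff_contDiff (a x : E3) : ContDiff ℝ ∞ (aff a x) :=
  contDiff_const.inner ℝ (contDiff_id.sub contDiff_const)

lemma pd_aff (a x z : E3) (i : Fin 3) : pd i (aff a x) z = a i := by
  have : HasFDerivAt (aff a x) (innerSL ℝ a) z := by
    have := (innerSL ℝ a).hasFDerivAt.comp z ((hasFDerivAt_id z).sub_const x)
    rw [ContinuousLinearMap.comp_id] at this
    exact this
  simp only [pd, this.fderiv]
  simp [EuclideanSpace.inner_single_right]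

lemma pd_sum_sq {f g : E3 → ℝ} (hf : ContDiff ℝ ∞ f) (hg : ContDiff ℝ ∞ g) (i : Fin 3) (z : E3) :
    pd i (fun z => f z ^ 2 + g z ^ 2) z = 2 * (f z * pd i f z) + 2 * (g z * pd i g z) := by
  simp only [pow_two]
  have hf := smooth_diff hf
  have hg := smooth_diff hg
  rw [pd_add i ((hf z).fun_mul (hf z)) ((hg z).fun_mul (hg z)), pd_mul i (hf z) (hf z),
    pd_mul i (hg z) (hg z)]
  ring

/-- Squared distance to the axis `x + ℝ a⊥`. -/
noncomputable def qf (a b x : E3) : E3 → ℝ := fun z => aff a x z ^ 2 + aff b x z ^ 2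

lemma qf_contDiff (a b x : E3) : ContDiff ℝ ∞ (qf a b x) :=
  ((aff_contDiff a x).pow 2).add ((aff_contDiff b x).pow 2)

lemma qf_nonneg (a b x z : E3) : 0 ≤ qf a b x z := by unfold qf; positivity

lemma pd_qf (a b x z : E3) (i : Fin 3) :
    pd i (qf a b x) z = 2 * a i * aff a x z + 2 * b i * aff b x z := by
  unfold qf
  rw [pd_sum_sq (aff_contDiff a x) (aff_contDiff b x), pd_aff, pd_aff]
  ring

lemma lap_qf (a b x z : E3) (ha : ‖a‖ = 1) (hb : ‖b‖ = 1) : lap (qf a b x) z = 4 := by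
  have key : ∀ i, pd i (pd i (qf a b x)) z = 2 * (a i) ^ 2 + 2 * (b i) ^ 2 := by
    intro i
    have : pd i (qf a b x) = fun z => (2 * a i) * aff a x z + (2 * b i) * aff b x z := by
      funext z; rw [pd_qf]
    have h1 := smooth_diff (aff_contDiff a x)
    have h2 := smooth_diff (aff_contDiff b x)
    rw [this, pd_add i ((h1 z).const_mul _) ((h2 z).const_mul _),
      pd_mul i (differentiableAt_const _) (h1 z), pd_mul i (differentiableAt_const _) (h2 z),
      pd_aff, pd_aff]
    simp [pd]
    ring
  have na := EuclideanSpace.real_norm_sq_eq a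
  have nb := EuclideanSpace.real_norm_sq_eq b
  simp only [lap, key, Finset.sum_add_distrib, ← Finset.mul_sum, ← na, ← nb, ha, hb]
  norm_num

lemma grad_qf (a b x z : E3) (ha : ‖a‖ = 1) (hb : ‖b‖ = 1) (hab : inner ℝ a b = 0) :
    ∑ i, (pd i (qf a b x) z) ^ 2 = 4 * qf a b x z := by
  have na := EuclideanSpace.real_norm_sq_eq a
  have nb := EuclideanSpace.real_norm_sq_eq b
  simp only [pd_qf]
  rw [ha] at na
  rw [hb] at nb
  have hab' : ∑ i, a i * b i = 0 := by
    rw [← hab, PiLp.inner_apply]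
    simp [mul_comm]
  simp only [qf, Fin.sum_univ_three] at *
  linear_combination (-4 * (aff a x z)^2) * na - 4 * (aff b x z)^2 * nb
    + 8 * aff a x z * aff b x z * hab'

/-- Squared norm. -/
noncomputable def nsq (x : E3) : E3 → ℝ := fun z => ‖z - x‖ ^ 2

lemma nsq_contDiff (x : E3) : ContDiff ℝ ∞ (nsq x) :=
  (contDiff_id.sub contDiff_const).norm_sq ℝ

lemma pd_nsq (x z : E3) (i : Fin 3) : pd i (nsq x) z = 2 * (z i - x i) := by
  have : HasFDerivAt (nsq x) (2 • innerSL ℝ (z - x)) z := by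
    have := ((hasFDerivAt_id z).sub_const x).norm_sq
    rw [ContinuousLinearMap.comp_id] at this
    exact this
  simp only [pd, this.fderiv]
  simp [EuclideanSpace.inner_single_right]

lemma grad_nsq (x z : E3) : ∑ i, (pd i (nsq x) z) ^ 2 = 4 * nsq x z := by
  simp only [pd_nsq, nsq, EuclideanSpace.real_norm_sq_eq, Finset.mul_sum]
  refine Finset.sum_congr rfl fun i _ => ?_
  simp
  ring

lemma lap_nsq (x z : E3) : lap (nsq x) z = 6 := by
  have key : ∀ i, pd i (pd i (nsq x)) z = 2 := by
    intro i
    have : pd i (nsq x) = fun z => 2 * aff (EuclideanSpace.single i 1) x z := by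
      funext z; rw [pd_nsq]; simp [aff, EuclideanSpace.inner_single_left]
    rw [this, pd_mul i (differentiableAt_const _) (smooth_diff (aff_contDiff _ x) z), pd_aff]
    simp [pd]
  simp [lap, key]
  norm_num

/-- Volume of a tube around a line. -/
lemma tube (B : OrthonormalBasis (Fin 3) ℝ E3) (x : E3) {R s : ℝ} (hR : 0 ≤ R) (hs : 0 ≤ s) :
    volume {z | ‖z - x‖ ≤ R ∧ qf (B 1) (B 2) x z ≤ s} ≤ ENNReal.ofReal (8 * R * s) := by
  let T : E3 → (Fin 3 → ℝ) := fun z =>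
    (MeasurableEquiv.toLp 2 (Fin 3 → ℝ)).symm (B.repr (z - x))
  have hT : MeasurePreserving T volume volume :=
    (EuclideanSpace.volume_preserving_symm_measurableEquiv_toLp (Fin 3)).comp
      ((B.measurePreserving_repr).comp (measurePreserving_sub_right volume x))
  let c : Fin 3 → ℝ := ![R, √s, √s]
  have hsub : {z | ‖z - x‖ ≤ R ∧ qf (B 1) (B 2) x z ≤ s} ⊆ T ⁻¹' (Icc (-c) c) := by
    rintro z ⟨h1, h2⟩
    have hTi : ∀ i, T z i = inner ℝ (B i) (z - x) := fun i => by
      change B.repr (z - x) i = _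
      rw [B.repr_apply_apply]
    have h0 : |T z 0| ≤ R := by
      rw [hTi]
      refine (abs_real_inner_le_norm _ _).trans ?_
      simpa using h1
    have hq : qf (B 1) (B 2) x z = T z 1 ^ 2 + T z 2 ^ 2 := by
      rw [hTi, hTi]; rfl
    rw [hq] at h2
    have h3 : |T z 1| ≤ √s := Real.abs_le_sqrt (by nlinarith [sq_nonneg (T z 2)])
    have h4 : |T z 2| ≤ √s := Real.abs_le_sqrt (by nlinarith [sq_nonneg (T z 1)])
    rw [abs_le] at h0 h3 h4
    rw [mem_preimage, mem_Icc, Pi.le_def, Pi.le_def]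
    constructor
    · intro i; fin_cases i
      · exact h0.1
      · exact h3.1
      · exact h4.1
    · intro i; fin_cases i
      · exact h0.2
      · exact h3.2
      · exact h4.2
  refine (measure_mono hsub).trans ?_
  rw [hT.measure_preimage measurableSet_Icc.nullMeasurableSet, Real.volume_Icc_pi]
  rw [← ENNReal.ofReal_prod_of_nonneg]
  · apply ENNReal.ofReal_le_ofReal
    simp [Fin.prod_univ_three, c]
    have := Real.mul_self_sqrt hs
    apply le_of_eq
    linear_combination (8 * R) * this
  · intro i _
    have : 0 ≤ c i := by
      fin_cases i
      · exact hR
      · exact Real.sqrt_nonneg s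
      · exact Real.sqrt_nonneg s
    simp; linarith

/-- A basis adapted to a direction. -/
lemma exists_basis (v : E3) : ∃ B : OrthonormalBasis (Fin 3) ℝ E3,
    inner ℝ (B 1) v = 0 ∧ inner ℝ (B 2) v = 0 := by
  by_cases hv : v = 0
  · exact ⟨EuclideanSpace.basisFun (Fin 3) ℝ, by simp [hv], by simp [hv]⟩
  have hn : ‖v‖ ≠ 0 := norm_ne_zero_iff.2 hv
  obtain ⟨B, hB⟩ := Orthonormal.exists_orthonormalBasis_extension_of_card_eq (𝕜 := ℝ) (E := E3)
    (ι := Fin 3) (by simp) (v := fun _ => (‖v‖)⁻¹ • v) (s := {0}) (by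
      rw [orthonormal_iff_ite]
      rintro ⟨i, hi⟩ ⟨j, hj⟩
      simp only [mem_singleton_iff] at hi hj
      subst hi; subst hj
      simp only [Set.domRestrict, real_inner_self_eq_norm_sq, norm_smul, norm_inv, norm_norm]
      rw [inv_mul_cancel₀ hn]
      simp)
  have h0 : v = ‖v‖ • B 0 := by
    rw [hB 0 rfl, smul_smul, mul_inv_cancel₀ hn, one_smul]
  refine ⟨B, ?_, ?_⟩
  · rw [h0, inner_smul_right, B.inner_eq_ite]; simp
  · rw [h0, inner_smul_right, B.inner_eq_ite]; simp

lemma bound_of_compact {F : Type*} [TopologicalSpace F] {f : F → ℝ} (hf : Continuous f)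
    (hc : HasCompactSupport f) : ∃ C, 0 ≤ C ∧ ∀ x, |f x| ≤ C := by
  obtain ⟨C, hC⟩ := hc.exists_bound_of_continuous hf
  exact ⟨max C 0, le_max_right _ _, fun x => (hC x).trans (le_max_left _ _)⟩

lemma deriv_zero_of_loc {h : ℝ → ℝ} {c s : ℝ} (H : ∀ᶠ t in 𝓝 s, h t = c) :
    deriv h s = 0 ∧ deriv (deriv h) s = 0 := by
  have h1 : ∀ t, (∀ᶠ r in 𝓝 t, h r = c) → deriv h t = 0 := by
    intro t ht
    have : h =ᶠ[𝓝 t] fun _ => c := ht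
    rw [this.deriv_eq]; simp
  refine ⟨h1 s H, ?_⟩
  have : deriv h =ᶠ[𝓝 s] fun _ => 0 := H.eventually_nhds.mono h1
  rw [this.deriv_eq]; simp

/-- Logarithmic cutoffs. -/
lemma cutoff : ∃ C : ℝ, 0 ≤ C ∧ ∀ N : ℕ, 1 ≤ N → ∃ h : ℝ → ℝ, ContDiff ℝ ∞ h ∧
    (∀ s, 0 ≤ h s ∧ h s ≤ 1) ∧ (∀ s, s < Real.exp (-(2 * N : ℝ)) → h s = 0) ∧
    (∀ s, Real.exp (-(N : ℝ)) < s → h s = 1) ∧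
    ∀ s, 0 < s → |deriv h s| * s ≤ C / N ∧
      |s * deriv (deriv h) s + deriv h s| * s ≤ C / (N : ℝ) ^ 2 := by
  let χ := Real.smoothTransition
  have hχ : ContDiff ℝ ∞ χ := Real.smoothTransition.contDiff
  have hχ1 := deriv_smooth hχ
  have hχ2 := deriv_smooth hχ1
  have hz : ∀ s, s ∉ Icc (0 : ℝ) 1 → deriv χ s = 0 ∧ deriv (deriv χ) s = 0 := by
    intro s hs
    rw [mem_Icc, not_and_or, not_le, not_le] at hs
    rcases hs with hs | hs
    · apply deriv_zero_of_loc (c := 0)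
      filter_upwards [eventually_lt_nhds hs] with t ht
      exact Real.smoothTransition.zero_of_nonpos ht.le
    · apply deriv_zero_of_loc (c := 1)
      filter_upwards [eventually_gt_nhds hs] with t ht
      exact Real.smoothTransition.one_of_one_le ht.le
  obtain ⟨C1, hC10, hC1⟩ := bound_of_compact hχ1.continuous
    (HasCompactSupport.intro isCompact_Icc fun s hs => (hz s hs).1)
  obtain ⟨C2, hC20, hC2⟩ := bound_of_compact hχ2.continuous
    (HasCompactSupport.intro isCompact_Icc fun s hs => (hz s hs).2)
  refine ⟨C1 + C2, by positivity, fun N hN => ?_⟩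
  have hN0 : (0 : ℝ) < N := by exact_mod_cast hN
  let τ : ℝ → ℝ := fun s => 2 + Real.log s / N
  let h : ℝ → ℝ := fun s => if s ≤ 0 then 0 else χ (τ s)
  have hpos : ∀ s, 0 < s → h s = χ (τ s) := fun s hs => if_neg (not_le.2 hs)
  have hlow : ∀ s, s < Real.exp (-(2 * N : ℝ)) → h s = 0 := by
    intro s hs
    by_cases h0 : s ≤ 0
    · exact if_pos h0
    · rw [hpos s (not_le.1 h0)]
      apply Real.smoothTransition.zero_of_nonpos
      have : Real.log s < -(2 * N : ℝ) := (Real.log_lt_iff_lt_exp (not_le.1 h0)).2 hs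
      have : Real.log s / N ≤ -2 := by
        rw [div_le_iff₀ hN0]; linarith
      change 2 + Real.log s / N ≤ 0
      linarith
  have hhigh : ∀ s, Real.exp (-(N : ℝ)) < s → h s = 1 := by
    intro s hs
    have h0 : 0 < s := (Real.exp_pos _).trans hs
    rw [hpos s h0]
    apply Real.smoothTransition.one_of_one_le
    have : -(N : ℝ) < Real.log s := (Real.lt_log_iff_exp_lt h0).2 hs
    have : -1 ≤ Real.log s / N := by
      rw [le_div_iff₀ hN0]; linarith
    change 1 ≤ 2 + Real.log s / N
    linarith
  have hτ : ∀ s, 0 < s → HasDerivAt τ (1 / (N * s)) s := by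
    intro s hs
    have := ((Real.hasDerivAt_log hs.ne').div_const (N : ℝ)).const_add 2
    have e : (1 : ℝ) / (N * s) = s⁻¹ / N := by field_simp
    rw [e]
    exact this
  have hd : ∀ s, 0 < s → deriv h s = deriv χ (τ s) * (1 / (N * s)) := by
    intro s hs
    have e : h =ᶠ[𝓝 s] χ ∘ τ := by
      filter_upwards [eventually_gt_nhds hs] with t ht using hpos t ht
    rw [e.deriv_eq]
    exact ((smooth_diff hχ (τ s)).hasDerivAt.comp s (hτ s hs)).deriv
  have hdd : ∀ s, 0 < s → deriv (deriv h) s = deriv (deriv χ) (τ s) * (1 / (N * s)) * (1 / (N * s))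
      + deriv χ (τ s) * (-(1 / (N * s ^ 2))) := by
    intro s hs
    have e : deriv h =ᶠ[𝓝 s] fun s => deriv χ (τ s) * (1 / (N * s)) := by
      filter_upwards [eventually_gt_nhds hs] with t ht using hd t ht
    rw [e.deriv_eq]
    have a1 := (smooth_diff hχ1 (τ s)).hasDerivAt.comp s (hτ s hs)
    have a2 : HasDerivAt (fun s : ℝ => 1 / (N * s)) (-(1 / (N * s ^ 2))) s := by
      have := ((hasDerivAt_inv hs.ne').const_mul ((N : ℝ)⁻¹))
      have e1 : (fun s : ℝ => 1 / (N * s)) = fun y => (N : ℝ)⁻¹ * y⁻¹ := by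
        funext t; simp [mul_comm]
      have e2 : -(1 / (N * s ^ 2)) = (N : ℝ)⁻¹ * -(s ^ 2)⁻¹ := by field_simp
      rw [e1, e2]
      exact this
    exact (a1.mul a2).deriv
  refine ⟨h, ?_, ?_, hlow, hhigh, ?_⟩
  · rw [contDiff_iff_contDiffAt]
    intro s
    by_cases hs : s < Real.exp (-(2 * N : ℝ))
    · have e : h =ᶠ[𝓝 s] fun _ => 0 := by
        filter_upwards [eventually_lt_nhds hs] with t ht using hlow t ht
      exact contDiffAt_const.congr_of_eventuallyEq e
    · have hs0 : 0 < s := (Real.exp_pos _).trans_le (not_lt.1 hs)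
      have e : h =ᶠ[𝓝 s] fun t => χ (τ t) := by
        filter_upwards [eventually_gt_nhds hs0] with t ht using hpos t ht
      refine ContDiffAt.congr_of_eventuallyEq ?_ e
      refine hχ.contDiffAt.comp s ?_
      exact contDiffAt_const.add ((Real.contDiffAt_log.2 hs0.ne').div_const _)
  · intro s
    by_cases hs : s ≤ 0
    · have : h s = 0 := if_pos hs
      rw [this]; norm_num
    · rw [hpos s (not_le.1 hs)]
      exact ⟨Real.smoothTransition.nonneg _, Real.smoothTransition.le_one _⟩
  · intro s hs
    constructor
    · have : |deriv h s| * s = |deriv χ (τ s)| / N := by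
        rw [hd s hs, abs_mul, abs_of_pos (show 0 < 1 / (N * s) by positivity)]
        field_simp
      rw [this]
      gcongr
      linarith [hC1 (τ s)]
    · have : |s * deriv (deriv h) s + deriv h s| * s = |deriv (deriv χ) (τ s)| / (N : ℝ) ^ 2 := by
        have : s * deriv (deriv h) s + deriv h s = deriv (deriv χ) (τ s) * (1 / (N ^ 2 * s)) := by
          rw [hdd s hs, hd s hs]; field_simp; ring
        rw [this, abs_mul, abs_of_pos (show 0 < 1 / ((N : ℝ) ^ 2 * s) by positivity)]
        field_simp
      rw [this]
      gcongr
      linarith [hC2 (τ s)]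

/-- `u` is weakly harmonic across the axis. -/
lemma weak {U : Set E3} (hU : IsOpen U) {u : E3 → ℝ} (hu : ContinuousOn u U) {M : ℝ} (hM0 : 0 ≤ M)
    (hM : ∀ z ∈ U, |u z| ≤ M) (B : OrthonormalBasis (Fin 3) ℝ E3) (x : E3)
    (h2 : ContDiffOn ℝ 2 u {z | z ∈ U ∧ qf (B 1) (B 2) x z ≠ 0})
    (hl : ∀ z ∈ U, qf (B 1) (B 2) x z ≠ 0 → lap u z = 0)
    {φ : E3 → ℝ} (hφ : ContDiff ℝ ∞ φ) (hc : HasCompactSupport φ) (hs : tsupport φ ⊆ U) :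
    ∫ z, u z * lap φ z = 0 := by
  set q := qf (B 1) (B 2) x with hq
  have hqs : ContDiff ℝ ∞ q := qf_contDiff _ _ _
  have hq0 : ∀ z, 0 ≤ q z := qf_nonneg _ _ _
  have hn : ∀ i, ‖B i‖ = 1 := fun i => B.norm_eq_one i
  have hB12 : inner ℝ (B 1) (B 2) = 0 := by rw [B.inner_eq_ite]; simp
  have hVo : IsOpen {z | z ∈ U ∧ q z ≠ 0} :=
    hU.inter (isOpen_ne_fun hqs.continuous continuous_const)
  have klap : HasCompactSupport (lap φ) :=
    hc.of_isClosed_subset (isClosed_tsupport _) (tsupport_lap φ)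
  obtain ⟨M0, hM00, hM0b⟩ := bound_of_compact hφ.continuous hc
  obtain ⟨M1, hM10, hM1b⟩ := bound_of_compact (lap_contDiff hφ).continuous klap
  have hpd : ∃ M2, 0 ≤ M2 ∧ ∀ i z, |pd i φ z| ≤ M2 := by
    have : ∀ i, ∃ C, 0 ≤ C ∧ ∀ z, |pd i φ z| ≤ C := fun i =>
      bound_of_compact (pd_contDiff i hφ).continuous
        (hc.of_isClosed_subset (isClosed_tsupport _) (tsupport_pd i φ))
    choose C hC0 hC using this
    refine ⟨∑ i, C i, Finset.sum_nonneg fun i _ => hC0 i, fun i z => (hC i z).trans ?_⟩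
    exact Finset.single_le_sum (fun j _ => hC0 j) (Finset.mem_univ i)
  obtain ⟨M2, hM20, hM2b⟩ := hpd
  obtain ⟨R, hR0, hR⟩ : ∃ R, 0 ≤ R ∧ ∀ z ∈ tsupport φ, ‖z - x‖ ≤ R := by
    obtain ⟨R, hR⟩ := hc.isBounded.subset_closedBall x
    refine ⟨max R 0, le_max_right _ _, fun z hz => le_max_of_le_left ?_⟩
    have := hR hz
    rwa [mem_closedBall_iff_norm] at this
  obtain ⟨C, hC0, hC⟩ := cutoff
  let S : ℝ → Set E3 := fun s => {z | ‖z - x‖ ≤ R ∧ q z ≤ s}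
  have hSm : ∀ s, MeasurableSet (S s) := by
    intro s
    apply IsClosed.measurableSet
    exact (isClosed_le (f := fun z : E3 => ‖z - x‖) (by fun_prop) continuous_const).inter
      (isClosed_le hqs.continuous continuous_const)
  have hSv : ∀ s, 0 ≤ s → volume (S s) ≤ ENNReal.ofReal (8 * R * s) := fun s h => tube B x hR0 h
  have hSr : ∀ s, 0 ≤ s → volume.real (S s) ≤ 8 * R * s := fun s h =>
    ENNReal.toReal_le_of_le_ofReal (by positivity) (hSv s h)
  have hSi : ∀ s, 0 ≤ s → Integrable ((S s).indicator (fun _ => (1 : ℝ))) := by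
    intro s h
    refine (integrable_indicator_iff (hSm s)).2 (integrableOn_const ?_)
    exact ((hSv s h).trans_lt ENNReal.ofReal_lt_top).ne
  set K := M * M1 + M * (4 * C * M0 + 24 * C * M2) with hK
  have hK0 : 0 ≤ K := by positivity
  have main : ∀ N : ℕ, 1 ≤ N → |∫ z, u z * lap φ z| ≤
      K * (8 * R) * (Real.exp (-(N : ℝ)) + (2 * N + 1) * Real.exp 1 / (N : ℝ) ^ 2) := by
    intro N hN
    have hN0 : (0 : ℝ) < N := by exact_mod_cast hN
    obtain ⟨h, hh, h01, hlow, hhigh, hder⟩ := hC N hN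
    let η : E3 → ℝ := fun z => h (q z)
    have hη : ContDiff ℝ ∞ η := hh.comp hqs
    let ψ : E3 → ℝ := fun z => η z * φ z
    have hψ : ContDiff ℝ ∞ ψ := hη.mul hφ
    have hψc : HasCompactSupport ψ := hc.mul_left
    have hψφ : tsupport ψ ⊆ tsupport φ := tsupport_mul_subset_right (f := η) (g := φ)
    have hψs : tsupport ψ ⊆ {z | z ∈ U ∧ q z ≠ 0} := by
      intro z hz
      refine ⟨hs (hψφ hz), ?_⟩
      have : tsupport ψ ⊆ {z | Real.exp (-(2 * N : ℝ)) ≤ q z} := by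
        refine closure_minimal (fun w hw => ?_) (isClosed_le continuous_const hqs.continuous)
        by_contra hlt
        apply hw
        change h (q w) * φ w = 0
        rw [hlow _ (not_le.1 hlt), zero_mul]
      exact ((Real.exp_pos _).trans_le (this hz)).ne'
    have hInt0 := green hVo h2 (fun z hz => hl z hz.1 hz.2) hψ hψc hψs
    have i1 := (integrable_mul hU hu (lap_contDiff hφ).continuous klap
      ((tsupport_lap φ).trans hs)).2
    have i2 := (integrable_mul hU hu (lap_contDiff hψ).continuous
      (hψc.of_isClosed_subset (isClosed_tsupport _) (tsupport_lap ψ))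
      ((tsupport_lap ψ).trans (hψφ.trans hs))).2
    have e1 : ∫ z, u z * lap φ z = ∫ z, (u z * lap φ z - u z * lap ψ z) := by
      rw [integral_sub i1 i2, hInt0, sub_zero]
    let D : E3 → ℝ := fun z => K * ((S (Real.exp (-(N : ℝ)))).indicator (fun _ => (1 : ℝ)) z +
      ∑ k ∈ Finset.range (2 * N + 1), Real.exp ((k : ℝ) + 1) / (N : ℝ) ^ 2 *
        (S (Real.exp (-(k : ℝ)))).indicator (fun _ => (1 : ℝ)) z)
    have hind : ∀ s z, 0 ≤ (S s).indicator (fun _ => (1 : ℝ)) z := fun s z =>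
      indicator_nonneg (fun _ _ => zero_le_one) z
    have hDs : ∀ z, 0 ≤ ∑ k ∈ Finset.range (2 * N + 1), Real.exp ((k : ℝ) + 1) / (N : ℝ) ^ 2 *
        (S (Real.exp (-(k : ℝ)))).indicator (fun _ => (1 : ℝ)) z := fun z =>
      Finset.sum_nonneg fun k _ => mul_nonneg (by positivity) (hind _ _)
    have hD0 : ∀ z, 0 ≤ D z := fun z => mul_nonneg hK0 (add_nonneg (hind _ _) (hDs z))
    have hDi2 : Integrable (fun z => ∑ k ∈ Finset.range (2 * N + 1),
        Real.exp ((k : ℝ) + 1) / (N : ℝ) ^ 2 *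
        (S (Real.exp (-(k : ℝ)))).indicator (fun _ => (1 : ℝ)) z) :=
      integrable_finsetSum _ fun k _ => (hSi _ (Real.exp_pos _).le).const_mul _
    have hDi : Integrable D := ((hSi _ (Real.exp_pos _).le).add hDi2).const_mul K
    have hpt : ∀ z, ‖u z * lap φ z - u z * lap ψ z‖ ≤ D z := by
      intro z
      by_cases hz : z ∈ tsupport φ
      swap
      · have a1 : lap φ z = 0 :=
          image_eq_zero_of_notMem_tsupport fun hh => hz (tsupport_lap φ hh)
        have a2 : lap ψ z = 0 :=
          image_eq_zero_of_notMem_tsupport fun hh => hz (hψφ (tsupport_lap ψ hh))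
        rw [a1, a2]; simpa using hD0 z
      have huz := hM z (hs hz)
      have hRz := hR z hz
      have hlη : lap η z = 4 * (q z * deriv (deriv h) (q z) + deriv h (q z)) := by
        change lap (fun y => h (q y)) z = _
        rw [lap_comp hh hqs, hq, grad_qf _ _ _ _ (hn 1) (hn 2) hB12, lap_qf _ _ _ _ (hn 1) (hn 2)]
        ring
      have hpη : ∀ i, pd i η z = deriv h (q z) * pd i q z := fun i =>
        pd_comp i (smooth_diff hh _) (smooth_diff hqs z)
      have hψz : lap ψ z = η z * lap φ z + 2 * ∑ i, pd i η z * pd i φ z + φ z * lap η z :=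
        lap_mul hη hφ z
      by_cases hhi : Real.exp (-(N : ℝ)) < q z
      · have hd := deriv_zero_of_loc (h := h) (c := 1) (s := q z) (by
          filter_upwards [eventually_gt_nhds hhi] with t ht using hhigh t ht)
        have : lap ψ z = lap φ z := by
          rw [hψz, hlη]
          simp only [hpη, hd.1, hd.2]
          change h (q z) * _ + _ + _ = _
          rw [hhigh _ hhi]; simp
        rw [this]; simpa using hD0 z
      have hin : (S (Real.exp (-(N : ℝ)))).indicator (fun _ => (1 : ℝ)) z = 1 :=
        indicator_of_mem (show z ∈ S _ from ⟨hRz, not_lt.1 hhi⟩) _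
      by_cases hlo : q z < Real.exp (-(2 * N : ℝ))
      · have hd := deriv_zero_of_loc (h := h) (c := 0) (s := q z) (by
          filter_upwards [eventually_lt_nhds hlo] with t ht using hlow t ht)
        have : lap ψ z = 0 := by
          rw [hψz, hlη]
          simp only [hpη, hd.1, hd.2]
          change h (q z) * _ + _ + _ = _
          rw [hlow _ hlo]; simp
        rw [this, mul_zero, sub_zero, Real.norm_eq_abs, abs_mul]
        have : |u z| * |lap φ z| ≤ M * M1 := mul_le_mul huz (hM1b z) (abs_nonneg _) hM0
        refine this.trans ?_
        change _ ≤ K * (_ + _)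
        rw [hin]
        have hK1 : M * M1 ≤ K := by
          rw [hK]; have : 0 ≤ M * (4 * C * M0 + 24 * C * M2) := by positivity
          linarith
        nlinarith [hDs z]
      rw [not_lt] at hhi hlo
      have hqp : 0 < q z := (Real.exp_pos _).trans_le hlo
      obtain ⟨hd1, hd2⟩ := hder (q z) hqp
      -- the dyadic bound
      have hrec : 1 / q z / (N : ℝ) ^ 2 ≤ ∑ k ∈ Finset.range (2 * N + 1),
          Real.exp ((k : ℝ) + 1) / (N : ℝ) ^ 2 *
          (S (Real.exp (-(k : ℝ)))).indicator (fun _ => (1 : ℝ)) z := by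
        have hlog1 : -Real.log (q z) ≤ 2 * N := by
          have := (Real.le_log_iff_exp_le hqp).2 hlo
          linarith
        have hlog0 : 0 ≤ -Real.log (q z) := by
          have := (Real.log_le_iff_le_exp hqp).2 hhi
          linarith
        set k := ⌊-Real.log (q z)⌋₊ with hk
        have hk1 : (k : ℝ) ≤ -Real.log (q z) := Nat.floor_le hlog0
        have hk2 : -Real.log (q z) < k + 1 := Nat.lt_floor_add_one _
        have hkN : k ∈ Finset.range (2 * N + 1) := by
          rw [Finset.mem_range, Nat.lt_succ_iff]
          have : (k : ℝ) ≤ ((2 * N : ℕ) : ℝ) := by push_cast; linarith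
          exact_mod_cast this
        have hqk : q z ≤ Real.exp (-(k : ℝ)) := (Real.log_le_iff_le_exp hqp).1 (by linarith)
        have hmem : (S (Real.exp (-(k : ℝ)))).indicator (fun _ => (1 : ℝ)) z = 1 :=
          indicator_of_mem (show z ∈ S _ from ⟨hRz, hqk⟩) _
        have hle : 1 / q z ≤ Real.exp ((k : ℝ) + 1) := by
          rw [one_div, ← Real.exp_log (inv_pos.2 hqp), Real.log_inv]
          exact Real.exp_le_exp.2 hk2.le
        refine le_trans ?_ (Finset.single_le_sum (f := fun k : ℕ =>
          Real.exp ((k : ℝ) + 1) / (N : ℝ) ^ 2 *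
          (S (Real.exp (-(k : ℝ)))).indicator (fun _ => (1 : ℝ)) z)
          (fun j _ => mul_nonneg (by positivity) (hind _ _)) hkN)
        simp only [hmem, mul_one]
        gcongr
      set Q := 1 / q z / (N : ℝ) ^ 2 with hQ
      have hQ0 : 0 ≤ Q := by positivity
      have hb1 : |lap η z| ≤ 4 * C * Q := by
        rw [hlη, abs_mul, abs_of_pos (by norm_num : (0 : ℝ) < 4)]
        have : |q z * deriv (deriv h) (q z) + deriv h (q z)| ≤ C * Q := by
          rw [← le_div_iff₀ hqp] at hd2
          refine hd2.trans (le_of_eq ?_)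
          rw [hQ]; field_simp
        linarith
      have hsq : √(q z) ≤ 2 / N := by
        have h1 : √(q z) ≤ Real.exp (-(N / 2 : ℝ)) := by
          apply Real.sqrt_le_iff.2 ⟨(Real.exp_pos _).le, ?_⟩
          rw [← Real.exp_nat_mul]
          refine hhi.trans (le_of_eq ?_)
          congr 1; push_cast; ring
        refine h1.trans ?_
        rw [Real.exp_neg, inv_le_comm₀ (Real.exp_pos _) (by positivity), inv_div]
        linarith [Real.add_one_le_exp (N / 2 : ℝ)]
      have hb2 : ∀ i, |pd i η z| ≤ 4 * C * Q := by
        intro i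
        have hg : |pd i q z| ≤ 2 * √(q z) := by
          have hgr : ∑ i, (pd i q z) ^ 2 = 4 * q z := grad_qf _ _ _ _ (hn 1) (hn 2) hB12
          have h1 : (pd i q z) ^ 2 ≤ 4 * q z := by
            rw [← hgr]
            exact Finset.single_le_sum (f := fun i => (pd i q z) ^ 2)
              (fun j _ => sq_nonneg _) (Finset.mem_univ i)
          apply abs_le_of_sq_le_sq _ (by positivity)
          rw [mul_pow, Real.sq_sqrt hqp.le]
          linarith
        rw [hpη, abs_mul]
        rw [← le_div_iff₀ hqp] at hd1
        calc |deriv h (q z)| * |pd i q z| ≤ (C / N / q z) * (2 * (2 / N)) := by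
              gcongr
              exact hg.trans (by linarith)
          _ = 4 * C * Q := by rw [hQ]; field_simp; ring
      have hb3 : |∑ i, pd i η z * pd i φ z| ≤ 12 * C * M2 * Q := by
        refine (Finset.abs_sum_le_sum_abs _ _).trans ?_
        have : ∀ i ∈ (Finset.univ : Finset (Fin 3)), |pd i η z * pd i φ z| ≤ 4 * C * Q * M2 := by
          intro i _
          rw [abs_mul]
          exact mul_le_mul (hb2 i) (hM2b i z) (abs_nonneg _) (by positivity)
        refine (Finset.sum_le_sum this).trans (le_of_eq ?_)
        simp; ring
      have hη01 := h01 (q z)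
      have hb4 : |(1 - η z) * lap φ z| ≤ M1 := by
        rw [abs_mul]
        have : |1 - η z| ≤ 1 := by
          rw [abs_le]
          constructor
          · change -1 ≤ 1 - h (q z); linarith [hη01.2]
          · change 1 - h (q z) ≤ 1; linarith [hη01.1]
        calc _ ≤ 1 * M1 := mul_le_mul this (hM1b z) (abs_nonneg _) zero_le_one
          _ = M1 := one_mul _
      have hb5 : |φ z * lap η z| ≤ M0 * (4 * C * Q) := by
        rw [abs_mul]
        exact mul_le_mul (hM0b z) hb1 (abs_nonneg _) hM00
      have hfin : |lap φ z - lap ψ z| ≤ M1 + (4 * C * M0 + 24 * C * M2) * Q := by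
        rw [hψz]
        rw [abs_le] at hb3 hb4 hb5 ⊢
        constructor <;> linarith [hb3.1, hb3.2, hb4.1, hb4.2, hb5.1, hb5.2]
      rw [← mul_sub, Real.norm_eq_abs, abs_mul]
      calc |u z| * |lap φ z - lap ψ z| ≤ M * (M1 + (4 * C * M0 + 24 * C * M2) * Q) :=
            mul_le_mul huz hfin (abs_nonneg _) hM0
        _ ≤ K * (1 + Q) := by
            rw [hK]
            have t1 : 0 ≤ M * M1 := by positivity
            have t2 : 0 ≤ M * (4 * C * M0 + 24 * C * M2) := by positivity
            nlinarith [mul_nonneg t1 hQ0]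
        _ ≤ D z := by
            change _ ≤ K * (_ + _)
            rw [hin]
            gcongr
    rw [e1]
    have hle := norm_integral_le_of_norm_le hDi (Eventually.of_forall hpt)
    rw [Real.norm_eq_abs] at hle
    refine hle.trans ?_
    have hDint : ∫ z, D z = K * (volume.real (S (Real.exp (-(N : ℝ)))) +
        ∑ k ∈ Finset.range (2 * N + 1), Real.exp ((k : ℝ) + 1) / (N : ℝ) ^ 2 *
          volume.real (S (Real.exp (-(k : ℝ))))) := by
      have hi : ∀ s, ∫ z, (S s).indicator (fun _ => (1 : ℝ)) z = volume.real (S s) := by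
        intro s
        rw [integral_indicator (hSm s)]; simp
      change ∫ z, K * (_ + _) = _
      rw [integral_const_mul, integral_add (hSi _ (Real.exp_pos _).le) hDi2, hi,
        integral_finsetSum _ fun k _ => (hSi _ (Real.exp_pos _).le).const_mul _]
      simp only [integral_const_mul, hi]
    rw [hDint, mul_assoc]
    refine mul_le_mul_of_nonneg_left ?_ hK0
    have hk : ∀ k ∈ Finset.range (2 * N + 1), Real.exp ((k : ℝ) + 1) / (N : ℝ) ^ 2 *
          volume.real (S (Real.exp (-(k : ℝ)))) ≤ 8 * R * Real.exp 1 / (N : ℝ) ^ 2 := by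
      intro k _
      calc _ ≤ Real.exp ((k : ℝ) + 1) / (N : ℝ) ^ 2 * (8 * R * Real.exp (-(k : ℝ))) := by
            gcongr
            exact hSr _ (Real.exp_pos _).le
        _ = 8 * R * (Real.exp ((k : ℝ) + 1) * Real.exp (-(k : ℝ))) / (N : ℝ) ^ 2 := by ring
        _ = _ := by rw [← Real.exp_add]; congr 3; ring
    have := Finset.sum_le_sum hk
    simp only [Finset.sum_const, Finset.card_range, nsmul_eq_mul] at this
    have t := hSr _ (Real.exp_pos (-(N : ℝ))).le
    refine (add_le_add t this).trans (le_of_eq ?_)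
    push_cast
    ring
  have main2 : ∀ N : ℕ, 1 ≤ N → |∫ z, u z * lap φ z| ≤
      (K * (8 * R) * (1 + 3 * Real.exp 1)) / N := by
    intro N hN
    have hN0 : (0 : ℝ) < N := by exact_mod_cast hN
    have hN1 : (1 : ℝ) ≤ N := by exact_mod_cast hN
    refine (main N hN).trans ?_
    rw [mul_div_assoc (K * (8 * R))]
    have hKR : 0 ≤ K * (8 * R) := by positivity
    refine mul_le_mul_of_nonneg_left ?_ hKR
    have a1 : Real.exp (-(N : ℝ)) ≤ 1 / N := by
      rw [Real.exp_neg, one_div]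
      exact inv_anti₀ hN0 (by linarith [Real.add_one_le_exp (N : ℝ)])
    have a2 : (2 * N + 1) * Real.exp 1 / (N : ℝ) ^ 2 ≤ 3 * Real.exp 1 / N := by
      rw [div_le_div_iff₀ (by positivity) hN0]
      have := Real.exp_pos 1
      nlinarith [mul_nonneg (mul_nonneg this.le hN0.le) (sub_nonneg.2 hN1)]
    rw [add_div]
    exact add_le_add a1 a2
  have hlim := tendsto_const_div_atTop_nhds_zero_nat (K * (8 * R) * (1 + 3 * Real.exp 1))
  have : |∫ z, u z * lap φ z| ≤ 0 := by
    refine ge_of_tendsto hlim ?_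
    filter_upwards [eventually_ge_atTop 1] with N hN using main2 N hN
  exact abs_nonpos_iff.1 this

/-- The kernel: smooth compactly supported radial functions whose differences are Laplacians. -/
lemma kernel : ∃ k : ℝ → ℝ, ContDiff ℝ ∞ k ∧ (∀ s, 1 ≤ s → k s = 0) ∧
    (∫ y : E3, k (‖y‖ ^ 2)) ≠ 0 ∧
    ∀ (r t : ℝ) (x : E3), 0 < r → r ≤ t → ∃ φ : E3 → ℝ, ContDiff ℝ ∞ φ ∧
      tsupport φ ⊆ Metric.closedBall x t ∧
      ∀ z, lap φ z = t⁻¹ ^ 3 * k (‖z - x‖ ^ 2 / t ^ 2) - r⁻¹ ^ 3 * k (‖z - x‖ ^ 2 / r ^ 2) := by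
  let g : ℝ → ℝ := fun s => Real.smoothTransition (4 * s - 1) * (√s)⁻¹
  have glow : ∀ s, s < 1 / 4 → g s = 0 := fun s hs => by
    change Real.smoothTransition (4 * s - 1) * (√s)⁻¹ = 0
    rw [Real.smoothTransition.zero_of_nonpos (by linarith), zero_mul]
  have ghigh : ∀ s, 1 / 2 < s → g s = (√s)⁻¹ := fun s hs => by
    change Real.smoothTransition (4 * s - 1) * (√s)⁻¹ = (√s)⁻¹
    rw [Real.smoothTransition.one_of_one_le (by linarith), one_mul]
  have hg : ContDiff ℝ ∞ g := by
    rw [contDiff_iff_contDiffAt]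
    intro s
    by_cases hs : s < 1 / 4
    · have e : g =ᶠ[𝓝 s] fun _ => 0 := by
        filter_upwards [eventually_lt_nhds hs] with t ht using glow t ht
      exact contDiffAt_const.congr_of_eventuallyEq e
    · have hs0 : 0 < s := by linarith
      refine ContDiffAt.mul ?_ ?_
      · exact (Real.smoothTransition.contDiff.comp
          ((contDiff_const.mul contDiff_id).sub contDiff_const)).contDiffAt
      · exact (Real.contDiffAt_sqrt hs0.ne').inv (Real.sqrt_pos.2 hs0).ne'
  have hg1 := deriv_smooth hg
  have hg2 := deriv_smooth hg1
  have hinv : ∀ s, 0 < s → HasDerivAt (fun s : ℝ => (√s)⁻¹) (-(1 / 2) * (√s)⁻¹ ^ 3) s := by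
    intro s hs
    have h0 : √s ≠ 0 := (Real.sqrt_pos.2 hs).ne'
    have := (Real.hasDerivAt_sqrt hs.ne').inv h0
    have e : -(1 / 2) * (√s)⁻¹ ^ 3 = -(1 / (2 * √s)) / √s ^ 2 := by field_simp
    rw [e]; exact this
  have gd : ∀ s, 1 / 2 < s → deriv g s = -(1 / 2) * (√s)⁻¹ ^ 3 := by
    intro s hs
    have e : g =ᶠ[𝓝 s] fun s => (√s)⁻¹ := by
      filter_upwards [eventually_gt_nhds hs] with t ht using ghigh t ht
    rw [e.deriv_eq]
    exact (hinv s (by linarith)).deriv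
  have gdd : ∀ s, 1 / 2 < s → deriv (deriv g) s = 3 / 4 * (√s)⁻¹ ^ 5 := by
    intro s hs
    have e : deriv g =ᶠ[𝓝 s] fun s => -(1 / 2) * (√s)⁻¹ ^ 3 := by
      filter_upwards [eventually_gt_nhds hs] with t ht using gd t ht
    rw [e.deriv_eq]
    rw [(((hinv s (by linarith)).fun_pow 3).const_mul (-(1 / 2) : ℝ)).deriv]
    push_cast
    ring
  let k : ℝ → ℝ := fun s => 4 * s * deriv (deriv g) s + 6 * deriv g s
  have hk : ContDiff ℝ ∞ k :=
    ((contDiff_const.mul contDiff_id).mul hg2).add (contDiff_const.mul hg1)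
  have hk0 : ∀ s, 1 / 2 < s → k s = 0 := by
    intro s hs
    change 4 * s * deriv (deriv g) s + 6 * deriv g s = 0
    have h0 : 0 < √s := Real.sqrt_pos.2 (by linarith)
    have h1 : s = √s ^ 2 := (Real.sq_sqrt (by linarith)).symm
    rw [gd s hs, gdd s hs]
    set w := √s
    rw [h1]
    field_simp
    ring
  refine ⟨k, hk, fun s hs => hk0 s (by linarith), ?_, ?_⟩
  · rw [integral_fun_norm_addHaar (volume : Measure E3) (fun y => k (y ^ 2))]
    have hfin : Module.finrank ℝ E3 = 3 := by simp
    rw [hfin]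
    let F : ℝ → ℝ := fun y => 2 * y ^ 3 * deriv g (y ^ 2)
    have hF : ∀ y, HasDerivAt F (y ^ (3 - 1) • k (y ^ 2)) y := by
      intro y
      have a1 : HasDerivAt (fun y : ℝ => 2 * y ^ 3) (6 * y ^ 2) y := by
        have := (hasDerivAt_pow 3 y).const_mul (2 : ℝ)
        have e : (6 * y ^ 2 : ℝ) = 2 * (((3 : ℕ) : ℝ) * y ^ (3 - 1)) := by norm_num; ring
        rw [e]; exact this
      have a0 : HasDerivAt (fun y : ℝ => y ^ 2) (2 * y) y := by
        have := hasDerivAt_pow 2 y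
        have e : (2 * y : ℝ) = (((2 : ℕ) : ℝ) * y ^ (2 - 1)) := by norm_num
        rw [e]; exact this
      have a2 : HasDerivAt (fun y : ℝ => deriv g (y ^ 2)) (deriv (deriv g) (y ^ 2) * (2 * y)) y :=
        HasDerivAt.comp (h₂ := deriv g) (h := fun y : ℝ => y ^ 2) y
          (smooth_diff hg1 (y ^ 2)).hasDerivAt a0
      have e : y ^ (3 - 1) • k (y ^ 2) = 6 * y ^ 2 * deriv g (y ^ 2) +
          2 * y ^ 3 * (deriv (deriv g) (y ^ 2) * (2 * y)) := by
        change y ^ 2 * (4 * y ^ 2 * deriv (deriv g) (y ^ 2) + 6 * deriv g (y ^ 2)) = _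
        ring
      rw [e]
      exact a1.mul a2
    have hcont : Continuous (fun y : ℝ => y ^ (3 - 1) • k (y ^ 2)) :=
      (continuous_pow _).smul (hk.continuous.comp (continuous_pow 2))
    have hcs : HasCompactSupport (fun y : ℝ => y ^ (3 - 1) • k (y ^ 2)) := by
      refine HasCompactSupport.intro (isCompact_Icc (a := -1) (b := 1)) fun y hy => ?_
      have : 1 / 2 < y ^ 2 := by
        rw [mem_Icc, not_and_or, not_le, not_le] at hy
        rcases hy with hy | hy <;> nlinarith
      rw [hk0 _ this, smul_zero]
    have hlim : Tendsto F atTop (𝓝 (-1)) := by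
      refine tendsto_const_nhds.congr' ?_
      filter_upwards [eventually_ge_atTop 1] with y hy
      change -1 = 2 * y ^ 3 * deriv g (y ^ 2)
      rw [gd _ (by nlinarith), Real.sqrt_sq (by linarith)]
      have : y ≠ 0 := by linarith
      field_simp
    have hInt := integral_Ioi_of_hasDerivAt_of_tendsto' (a := 0) (fun y _ => hF y)
      (hcont.integrable_of_hasCompactSupport hcs).integrableOn hlim
    rw [hInt]
    have hF0 : F 0 = 0 := by simp [F]
    have hb : 0 < volume.real (Metric.ball (0 : E3) 1) :=
      ENNReal.toReal_pos (Metric.measure_ball_pos volume _ one_pos).ne' measure_ball_lt_top.ne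
    rw [hF0]
    simp only [smul_eq_mul, nsmul_eq_mul]
    have : (0 : ℝ) < (3 : ℕ) * volume.real (Metric.ball (0 : E3) 1) := by positivity
    intro h
    linarith
  · intro r t x hr hrt
    have ht : 0 < t := hr.trans_le hrt
    let h : ℝ → ℝ := fun s => t⁻¹ * g (s / t ^ 2) - r⁻¹ * g (s / r ^ 2)
    have hsc : ∀ a : ℝ, ContDiff ℝ ∞ (fun s : ℝ => s / a ^ 2) := fun a => contDiff_id.div_const _
    have hh : ContDiff ℝ ∞ h :=
      (contDiff_const.mul (hg.comp (hsc t))).sub (contDiff_const.mul (hg.comp (hsc r)))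
    have hch : ∀ {f : ℝ → ℝ} (a s : ℝ), Differentiable ℝ f →
        HasDerivAt (fun s => f (s / a ^ 2)) (deriv f (s / a ^ 2) * (1 / a ^ 2)) s := by
      intro f a s hf
      exact (hf (s / a ^ 2)).hasDerivAt.comp s ((hasDerivAt_id s).div_const (a ^ 2))
    have hd : deriv h = fun s => t⁻¹ * (deriv g (s / t ^ 2) * (1 / t ^ 2)) -
        r⁻¹ * (deriv g (s / r ^ 2) * (1 / r ^ 2)) := by
      funext s
      exact (((hch t s (smooth_diff hg)).const_mul t⁻¹).sub
        ((hch r s (smooth_diff hg)).const_mul r⁻¹)).deriv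
    have hdd : ∀ s, deriv (deriv h) s =
        t⁻¹ * (deriv (deriv g) (s / t ^ 2) * (1 / t ^ 2) * (1 / t ^ 2)) -
        r⁻¹ * (deriv (deriv g) (s / r ^ 2) * (1 / r ^ 2) * (1 / r ^ 2)) := by
      intro s
      rw [hd]
      exact ((((hch t s (smooth_diff hg1)).mul_const (1 / t ^ 2)).const_mul t⁻¹).sub
        (((hch r s (smooth_diff hg1)).mul_const (1 / r ^ 2)).const_mul r⁻¹)).deriv
    refine ⟨fun z => h (nsq x z), hh.comp (nsq_contDiff x), ?_, ?_⟩
    · refine closure_minimal (fun z hz => ?_) Metric.isClosed_closedBall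
      by_contra hn
      rw [mem_closedBall_iff_norm, not_le] at hn
      apply hz
      have hone : ∀ a, 0 < a → a ≤ t → a⁻¹ * g (nsq x z / a ^ 2) = ‖z - x‖⁻¹ := by
        intro a ha hat
        have h1 : nsq x z / a ^ 2 = (‖z - x‖ / a) ^ 2 := by simp [nsq, div_pow]
        have h2 : 1 < ‖z - x‖ / a := by rw [one_lt_div ha]; linarith
        rw [h1, ghigh _ (by nlinarith), Real.sqrt_sq (by linarith)]
        field_simp
      change t⁻¹ * g (nsq x z / t ^ 2) - r⁻¹ * g (nsq x z / r ^ 2) = 0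
      rw [hone t ht le_rfl, hone r hr hrt, sub_self]
    · intro z
      rw [lap_comp hh (nsq_contDiff x), grad_nsq, lap_nsq, hdd, hd]
      change _ = t⁻¹ ^ 3 * (4 * (nsq x z / t ^ 2) * deriv (deriv g) (nsq x z / t ^ 2)
          + 6 * deriv g (nsq x z / t ^ 2)) -
        r⁻¹ ^ 3 * (4 * (nsq x z / r ^ 2) * deriv (deriv g) (nsq x z / r ^ 2)
          + 6 * deriv g (nsq x z / r ^ 2))
      field_simp
      ring

lemma scale (f : E3 → ℝ) (x : E3) {r : ℝ} (hr : 0 < r) :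
    ∫ z, r⁻¹ ^ 3 * f (r⁻¹ • (z - x)) = ∫ y, f y := by
  rw [integral_const_mul, integral_sub_right_eq_self (fun z => f (r⁻¹ • z)) x,
    Measure.integral_comp_inv_smul]
  have hfin : Module.finrank ℝ E3 = 3 := by simp
  rw [hfin, abs_of_pos (by positivity), smul_eq_mul]
  field_simp

lemma scale_arg (x z : E3) {r : ℝ} (hr : 0 < r) :
    ‖z - x‖ ^ 2 / r ^ 2 = ‖r⁻¹ • (z - x)‖ ^ 2 := by
  rw [norm_smul, norm_inv, Real.norm_of_nonneg hr.le, mul_pow, inv_pow]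
  field_simp

/-- Weakly harmonic continuous functions are smooth (Weyl). -/
lemma weyl {U : Set E3} (hU : IsOpen U) {u : E3 → ℝ} (hu : ContinuousOn u U)
    (hw : ∀ φ : E3 → ℝ, ContDiff ℝ ∞ φ → HasCompactSupport φ → tsupport φ ⊆ U →
      ∫ z, u z * lap φ z = 0) {x₀ : E3} (hx₀ : x₀ ∈ U) : ContDiffAt ℝ ∞ u x₀ := by
  obtain ⟨k, hk, hk0, hkc, hker⟩ := kernel
  set c := ∫ y : E3, k (‖y‖ ^ 2) with hc
  let ρ : ℝ → E3 → ℝ := fun r y => r⁻¹ ^ 3 * k (‖y‖ ^ 2 / r ^ 2)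
  have hρs : ∀ r, ContDiff ℝ ∞ (ρ r) := fun r =>
    contDiff_const.mul (hk.comp ((contDiff_id.norm_sq ℝ).div_const _))
  have hρ0 : ∀ r, 0 < r → ∀ y, r ≤ ‖y‖ → ρ r y = 0 := by
    intro r hr y hy
    change r⁻¹ ^ 3 * k (‖y‖ ^ 2 / r ^ 2) = 0
    rw [hk0 _ ?_, mul_zero]
    rw [one_le_div (by positivity)]
    gcongr
  have hρts : ∀ r, 0 < r → ∀ x, tsupport (fun z => ρ r (z - x)) ⊆ Metric.closedBall x r := by
    intro r hr x
    refine closure_minimal (fun z hz => ?_) Metric.isClosed_closedBall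
    by_contra hn
    rw [mem_closedBall_iff_norm, not_le] at hn
    exact hz (hρ0 r hr _ hn.le)
  have hρc : ∀ r, 0 < r → ∀ x, HasCompactSupport (fun z => ρ r (z - x)) := fun r hr x =>
    (isCompact_closedBall x r).of_isClosed_subset (isClosed_tsupport _) (hρts r hr x)
  have hρcont : ∀ r x, Continuous (fun z => ρ r (z - x)) := fun r x =>
    (hρs r).continuous.comp (continuous_id.sub continuous_const)
  have hρint : ∀ r, 0 < r → ∀ x, ∫ z, ρ r (z - x) = c := by
    intro r hr x
    rw [hc, ← scale (fun y => k (‖y‖ ^ 2)) x hr]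
    refine integral_congr_ae (Eventually.of_forall fun z => ?_)
    change r⁻¹ ^ 3 * k (‖z - x‖ ^ 2 / r ^ 2) = _
    rw [scale_arg x z hr]
  have hρabs : ∀ r, 0 < r → ∀ x, ∫ z, |ρ r (z - x)| = ∫ y : E3, |k (‖y‖ ^ 2)| := by
    intro r hr x
    rw [← scale (fun y => |k (‖y‖ ^ 2)|) x hr]
    refine integral_congr_ae (Eventually.of_forall fun z => ?_)
    change |r⁻¹ ^ 3 * k (‖z - x‖ ^ 2 / r ^ 2)| = _
    rw [scale_arg x z hr, abs_mul, abs_of_pos (by positivity)]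
  -- the mean value property
  have mean : ∀ t x, 0 < t → Metric.closedBall x t ⊆ U → ∫ z, u z * ρ t (z - x) = c * u x := by
    intro t x ht hsub
    have hInt : ∀ r, 0 < r → r ≤ t → Integrable (fun z => u z * ρ r (z - x)) := fun r hr hrt =>
      (integrable_mul hU hu (hρcont r x) (hρc r hr x)
        ((hρts r hr x).trans ((Metric.closedBall_subset_closedBall hrt).trans hsub))).2
    have heq : ∀ r, 0 < r → r ≤ t → ∫ z, u z * ρ t (z - x) = ∫ z, u z * ρ r (z - x) := by
      intro r hr hrt
      obtain ⟨φ, hφ, hφs, hφl⟩ := hker r t x hr hrt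
      have := hw φ hφ ((isCompact_closedBall x t).of_isClosed_subset (isClosed_tsupport _) hφs)
        (hφs.trans hsub)
      rw [← sub_eq_zero, ← integral_sub (hInt t ht le_rfl) (hInt r hr hrt), ← this]
      refine integral_congr_ae (Eventually.of_forall fun z => ?_)
      change u z * ρ t (z - x) - u z * ρ r (z - x) = u z * lap φ z
      rw [hφl, mul_sub]
    set A := ∫ y : E3, |k (‖y‖ ^ 2)| with hA
    have hA0 : 0 ≤ A := integral_nonneg fun _ => abs_nonneg _
    have hxU : x ∈ U := hsub (Metric.mem_closedBall_self ht.le)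
    have hest : ∀ ε > 0, |(∫ z, u z * ρ t (z - x)) - c * u x| ≤ ε * A := by
      intro ε hε
      have hcx : ContinuousAt u x := hu.continuousAt (hU.mem_nhds hxU)
      obtain ⟨δ, hδ, hδu⟩ := Metric.continuousAt_iff.1 hcx ε hε
      set r := min (δ / 2) t with hr
      have hr0 : 0 < r := lt_min (by linarith) ht
      have hrδ : r < δ := (min_le_left _ _).trans_lt (by linarith)
      have hrt : r ≤ t := min_le_right _ _
      have hρi : Integrable (fun z => ρ r (z - x)) :=
        (hρcont r x).integrable_of_hasCompactSupport (hρc r hr0 x)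
      have e : (∫ z, u z * ρ t (z - x)) - c * u x = ∫ z, (u z * ρ r (z - x) - u x * ρ r (z - x)) := by
        rw [integral_sub (hInt r hr0 hrt) (hρi.const_mul _), integral_const_mul, hρint r hr0,
          heq r hr0 hrt, mul_comm c]
      rw [e, ← hρabs r hr0 x, ← integral_const_mul, ← Real.norm_eq_abs]
      refine norm_integral_le_of_norm_le (hρi.abs.const_mul ε) (Eventually.of_forall fun z => ?_)
      rw [← sub_mul, norm_mul, Real.norm_eq_abs, Real.norm_eq_abs]
      by_cases hz : ‖z - x‖ < r
      · refine mul_le_mul_of_nonneg_right ?_ (abs_nonneg _)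
        have := hδu (x := z) (by rw [dist_eq_norm]; linarith)
        rw [Real.dist_eq] at this
        exact this.le
      · rw [hρ0 r hr0 _ (not_lt.1 hz)]; simp
    have hz : |(∫ z, u z * ρ t (z - x)) - c * u x| ≤ 0 := by
      refine le_of_forall_pos_le_add fun ε hε => ?_
      have := hest (ε / (A + 1)) (by positivity)
      refine this.trans ?_
      rw [zero_add, div_mul_eq_mul_div, div_le_iff₀ (by positivity)]
      nlinarith
    exact sub_eq_zero.1 (abs_nonpos_iff.1 hz)
  -- smoothness
  obtain ⟨ε, hε, hεU⟩ := Metric.isOpen_iff.1 hU x₀ hx₀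
  set t := ε / 3 with ht
  have ht0 : 0 < t := by positivity
  have hsub : Metric.closedBall x₀ (2 * t) ⊆ U :=
    (Metric.closedBall_subset_ball (by rw [ht]; linarith)).trans hεU
  let w : E3 → ℝ := (Metric.closedBall x₀ (2 * t)).indicator u
  have hwi : Integrable w :=
    (integrable_indicator_iff Metric.isClosed_closedBall.measurableSet).2
      ((hu.mono hsub).integrableOn_compact (isCompact_closedBall _ _))
  have hρc0 : HasCompactSupport (ρ t) := by simpa using hρc t ht0 0
  have hconv : ContDiff ℝ ∞ (convolution w (ρ t) (ContinuousLinearMap.mul ℝ ℝ) volume) :=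
    hρc0.contDiff_convolution_right _ hwi.locallyIntegrable (hρs t)
  have he : u =ᶠ[𝓝 x₀] fun x => c⁻¹ * convolution w (ρ t) (ContinuousLinearMap.mul ℝ ℝ) volume x := by
    filter_upwards [Metric.ball_mem_nhds x₀ ht0] with x hx
    rw [Metric.mem_ball] at hx
    have hsx : Metric.closedBall x t ⊆ Metric.closedBall x₀ (2 * t) :=
      Metric.closedBall_subset_closedBall' (by linarith)
    have hm := mean t x ht0 (hsx.trans hsub)
    have hcv : convolution w (ρ t) (ContinuousLinearMap.mul ℝ ℝ) volume x = c * u x := by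
      rw [← hm, convolution_def]
      refine integral_congr_ae (Eventually.of_forall fun z => ?_)
      change w z * ρ t (x - z) = u z * ρ t (z - x)
      have hsym : ρ t (x - z) = ρ t (z - x) := by
        simp only [ρ, norm_sub_rev x z]
      rw [hsym]
      by_cases hz : z ∈ Metric.closedBall x t
      · rw [show w z = u z from indicator_of_mem (hsx hz) u]
      · rw [mem_closedBall_iff_norm, not_le] at hz
        rw [hρ0 t ht0 _ hz.le, mul_zero, mul_zero]
    rw [hcv]
    field_simp
  exact (contDiffAt_const.mul hconv.contDiffAt).congr_of_eventuallyEq he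

end Rem

open Rem in
/-- A line segment is a removable singularity set for bounded harmonic functions in `ℝ³`:
if `u` is continuous and bounded on an open set `U ⊆ ℝ³` and harmonic off a segment
`L ⊆ U`, then `u` is harmonic on all of `U`. -/
theorem stmt7 (U : Set (EuclideanSpace ℝ (Fin 3))) (hU : IsOpen U)
    (x y : EuclideanSpace ℝ (Fin 3)) (hL : segment ℝ x y ⊆ U)
    (u : EuclideanSpace ℝ (Fin 3) → ℝ)
    (hcont : ContinuousOn u U)
    (hbdd : ∃ B : ℝ, ∀ z ∈ U, |u z| ≤ B)
    (hharm : HarmonicOnE u (U \ segment ℝ x y)) :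
    HarmonicOnE u U := by
  obtain ⟨B, hB1, hB2⟩ := exists_basis (y - x)
  obtain ⟨M, hM⟩ := hbdd
  have hseg : ∀ z ∈ segment ℝ x y, qf (B 1) (B 2) x z = 0 := by
    intro z hz
    rw [segment_eq_image'] at hz
    obtain ⟨θ, _, rfl⟩ := hz
    simp [qf, aff, inner_smul_right, hB1, hB2]
  have hsub : {z | z ∈ U ∧ qf (B 1) (B 2) x z ≠ 0} ⊆ U \ segment ℝ x y :=
    fun z hz => ⟨hz.1, fun h => hz.2 (hseg z h)⟩
  have hl : ∀ z ∈ U, qf (B 1) (B 2) x z ≠ 0 → lap u z = 0 := fun z hz hq =>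
    hharm.2 z (hsub ⟨hz, hq⟩)
  have hsm : ∀ z ∈ U, ContDiffAt ℝ ∞ u z := fun z hz =>
    weyl hU hcont (fun φ h1 h2 h3 => weak hU hcont (le_max_right M 0)
      (fun z hz => (hM z hz).trans (le_max_left _ _)) B x (hharm.1.mono hsub) hl h1 h2 h3) hz
  refine ⟨fun z hz => ((hsm z hz).of_le (WithTop.coe_le_coe.2 (le_top : (2 : ℕ∞) ≤ ⊤))).contDiffWithinAt, ?_⟩
  intro z hz
  change lap u z = 0
  by_cases hq : qf (B 1) (B 2) x z = 0
  swap
  · exact hl z hz hq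
  have hlc : ContinuousAt (lap u) z := by
    have : ∀ i, ContDiffAt ℝ ∞ (pd i (pd i u)) z := fun i =>
      pd_contDiffAt i (pd_contDiffAt i (m := ∞) (hsm z hz) (by simp)) (by simp)
    have h2 : ContDiffAt ℝ ∞ (lap u) z := by
      unfold lap
      exact ContDiffAt.sum fun i _ => this i
    exact h2.continuousAt
  let γ : ℝ → E3 := fun t => z + t • B 1
  have hγ : Tendsto γ (𝓝[≠] 0) (𝓝 z) := by
    have : Continuous γ := by fun_prop
    have h0 := this.tendsto 0
    simp only [γ, zero_smul, add_zero] at h0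
    exact h0.mono_left nhdsWithin_le_nhds
  have h1 : Tendsto (fun t => lap u (γ t)) (𝓝[≠] 0) (𝓝 (lap u z)) := hlc.tendsto.comp hγ
  have h2 : (fun t => lap u (γ t)) =ᶠ[𝓝[≠] 0] fun _ => 0 := by
    filter_upwards [hγ.eventually (hU.mem_nhds hz), self_mem_nhdsWithin] with t ht ht0
    refine hl _ ht ?_
    have hz1 : aff (B 1) x z = 0 := by
      have h3 := sq_nonneg (aff (B 1) x z)
      have h4 := sq_nonneg (aff (B 2) x z)
      unfold qf at hq
      exact pow_eq_zero_iff (two_ne_zero) |>.1 (by linarith)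
    have hz2 : aff (B 1) x (γ t) = t := by
      have e : γ t - x = (z - x) + t • B 1 := by simp only [γ]; abel
      unfold aff at hz1 ⊢
      rw [e, inner_add_right, hz1, inner_smul_right]
      simp
    have : 0 < qf (B 1) (B 2) x (γ t) := by
      unfold qf
      rw [hz2]
      have : t ≠ 0 := ht0
      positivity
    exact this.ne'
  exact tendsto_nhds_unique (h1.congr' h2) tendsto_const_nhds
end

section
/- Let n ≥ 2, let Ω = {(x, y) : x ∈ ℝ^{n−1}, y ∈ ℝ, |x| < R, |y| < H}, and let M : (0, H) → [e, ∞) be decreasing with ∫₀^H log⁺ log⁺ M(y) dy < ∞. Then the family ℋ_M of all harmonic functions u on Ω satisfying |u(x, y)| ≤ M(|y|) for all (x, y) ∈ Ω is uniformly bounded on every compact subset of Ω. -/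
open MeasureTheory

/-- Harmonicity on a subset of `ℝ^m × ℝ ≅ ℝ^{m+1}`: `C²` and vanishing Laplacian. -/
def HarmonicOnP {m : ℕ} (u : EuclideanSpace ℝ (Fin m) × ℝ → ℝ)
    (s : Set (EuclideanSpace ℝ (Fin m) × ℝ)) : Prop :=
  ContDiffOn ℝ 2 u s ∧ ∀ p ∈ s,
    (∑ i : Fin m, fderiv ℝ (fun q => fderiv ℝ u q (EuclideanSpace.single i 1, 0)) p
        (EuclideanSpace.single i 1, 0))
      + fderiv ℝ (fun q => fderiv ℝ u q (0, 1)) p (0, 1) = 0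

/-- The truncated cylinder `{(x,y) : x ∈ ℝ^m, |x| < R, |y| < H}`. -/
def Cyl (m : ℕ) (R H : ℝ) : Set (EuclideanSpace ℝ (Fin m) × ℝ) :=
  {p | ‖p.1‖ < R ∧ |p.2| < H}


namespace Lev

abbrev EE (m : ℕ) := EuclideanSpace ℝ (Fin m) × ℝ

noncomputable def D2 {m : ℕ} (f : EE m → ℝ) (p e : EE m) : ℝ :=
  fderiv ℝ (fun q => fderiv ℝ f q e) p e

noncomputable def Lap {m : ℕ} (f : EE m → ℝ) (p : EE m) : ℝ :=
  (∑ i : Fin m, D2 f p (EuclideanSpace.single i 1, 0)) + D2 f p (0, 1)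

lemma harm_iff {m : ℕ} (u : EE m → ℝ) (s : Set (EE m)) :
    HarmonicOnP u s ↔ ContDiffOn ℝ 2 u s ∧ ∀ p ∈ s, Lap u p = 0 := Iff.rfl

lemma ev_diff {m : ℕ} {f : EE m → ℝ} {p : EE m} (hf : ContDiffAt ℝ 2 f p) :
    ∀ᶠ q in nhds p, DifferentiableAt ℝ f q := by
  filter_upwards [hf.eventually (by simp)] with q hq
  exact hq.differentiableAt (by simp)

lemma diff_fderiv {m : ℕ} {f : EE m → ℝ} {p : EE m} (hf : ContDiffAt ℝ 2 f p) (e : EE m) :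
    DifferentiableAt ℝ (fun q => fderiv ℝ f q e) p := by
  have h : ContDiffAt ℝ 1 (fderiv ℝ f) p := hf.fderiv_right (by norm_num)
  exact (h.differentiableAt (by simp)).clm_apply (differentiableAt_const e)

lemma D2_sub {m : ℕ} {f g : EE m → ℝ} {p : EE m} (hf : ContDiffAt ℝ 2 f p)
    (hg : ContDiffAt ℝ 2 g p) (e : EE m) :
    D2 (fun q => f q - g q) p e = D2 f p e - D2 g p e := by
  unfold D2
  have h : (fun q => fderiv ℝ (fun q => f q - g q) q e) =ᶠ[nhds p]
      fun q => fderiv ℝ f q e - fderiv ℝ g q e := by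
    filter_upwards [ev_diff hf, ev_diff hg] with q h1 h2
    rw [fderiv_fun_sub h1 h2]; rfl
  rw [h.fderiv_eq, fderiv_fun_sub (diff_fderiv hf e) (diff_fderiv hg e)]; rfl

lemma D2_neg {m : ℕ} (f : EE m → ℝ) (p e : EE m) :
    D2 (fun q => - f q) p e = - D2 f p e := by
  unfold D2
  simp

lemma D2_neg_dir {m : ℕ} (f : EE m → ℝ) (p e : EE m) :
    D2 f p (-e) = D2 f p e := by
  unfold D2
  simp

lemma D2_comp {m : ℕ} {f : EE m → ℝ} (l : EE m →L[ℝ] EE m) (c p : EE m)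
    (hf : ContDiffAt ℝ 2 f (c + l p)) (e : EE m) :
    D2 (fun q => f (c + l q)) p e = D2 f (c + l p) (l e) := by
  unfold D2
  have hA : ∀ q, HasFDerivAt (fun q => c + l q) l q := fun q => l.hasFDerivAt.const_add c
  have h : (fun q => fderiv ℝ (fun q => f (c + l q)) q e) =ᶠ[nhds p]
      fun q => (fun q' => fderiv ℝ f q' (l e)) (c + l q) := by
    have := (hA p).continuousAt.eventually (ev_diff hf)
    filter_upwards [this] with q hq
    have := (hq.hasFDerivAt.comp q (hA q)).fderiv
    change fderiv ℝ (f ∘ fun q => c + l q) q e = _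
    rw [this]; rfl
  rw [h.fderiv_eq]
  have := ((diff_fderiv hf (l e)).hasFDerivAt.comp p (hA p)).fderiv
  change fderiv ℝ ((fun q' => fderiv ℝ f q' (l e)) ∘ fun q => c + l q) p e = _
  rw [this]; rfl

lemma D2_line {m : ℕ} {f : EE m → ℝ} {p : EE m} (hf : ContDiffAt ℝ 2 f p) (e : EE m) :
    deriv (fun τ : ℝ => f (p + τ • e)) =ᶠ[nhds 0] (fun τ => fderiv ℝ f (p + τ • e) e) ∧
    deriv (deriv (fun τ : ℝ => f (p + τ • e))) 0 = D2 f p e := by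
  have hA : ∀ τ : ℝ, HasDerivAt (fun τ : ℝ => p + τ • e) e τ := fun τ => by
    simpa using ((hasDerivAt_id τ).smul_const e).const_add p
  have h : deriv (fun τ : ℝ => f (p + τ • e)) =ᶠ[nhds 0]
      (fun τ => fderiv ℝ f (p + τ • e) e) := by
    have h0 : ∀ᶠ q in nhds (p + (0:ℝ) • e), DifferentiableAt ℝ f q := by
      simpa using ev_diff hf
    filter_upwards [(hA 0).continuousAt.eventually h0] with τ hτ
    exact (hτ.hasFDerivAt.comp_hasDerivAt τ (hA τ)).deriv
  refine ⟨h, ?_⟩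
  rw [h.deriv_eq]
  have h1 : DifferentiableAt ℝ (fun q => fderiv ℝ f q e) (p + (0:ℝ) • e) := by
    simpa using diff_fderiv hf e
  have := (h1.hasFDerivAt.comp_hasDerivAt 0 (hA 0)).deriv
  change deriv ((fun q => fderiv ℝ f q e) ∘ fun τ : ℝ => p + τ • e) 0 = _
  rw [this]; simp [D2]

lemma D2_min {m : ℕ} {f : EE m → ℝ} {p : EE m} (hf : ContDiffAt ℝ 2 f p)
    (hmin : IsLocalMin f p) (e : EE m) : 0 ≤ D2 f p e := by
  by_contra hneg
  push Not at hneg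
  obtain ⟨-, h2⟩ := D2_line hf e
  set φ : ℝ → ℝ := fun τ : ℝ => f (p + τ • e) with hφ
  have hc : ContinuousAt (fun τ : ℝ => p + τ • e) 0 := by fun_prop
  have hc' : Filter.Tendsto (fun τ : ℝ => p + τ • e) (nhds 0) (nhds p) := by
    simpa [ContinuousAt] using hc
  have hφmin : IsLocalMin φ 0 := by
    have h3 := hc'.eventually hmin
    filter_upwards [h3] with τ hτ
    simpa [hφ] using hτ
  have hφc : ContinuousAt φ 0 := by
    have : ContinuousAt f (p + (0:ℝ) • e) := by simpa using hf.continuousAt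
    exact ContinuousAt.comp (f := fun τ : ℝ => p + τ • e) this hc
  have hmax : IsLocalMax φ 0 := isLocalMax_of_deriv_deriv_neg (by rw [h2]; exact hneg)
    hφmin.deriv_eq_zero hφc
  have hconst : φ =ᶠ[nhds 0] fun _ => φ 0 := by
    filter_upwards [hφmin, hmax] with τ a b
    exact le_antisymm b a
  have h4 : deriv φ =ᶠ[nhds 0] fun _ => 0 := by
    have := hconst.deriv
    simpa using this
  have h5 : deriv (deriv φ) 0 = 0 := by rw [h4.deriv_eq]; simp
  rw [h2] at h5
  exact absurd h5 hneg.ne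

lemma Lap_min {m : ℕ} {f : EE m → ℝ} {p : EE m} (hf : ContDiffAt ℝ 2 f p)
    (hmin : IsLocalMin f p) : 0 ≤ Lap f p :=
  add_nonneg (Finset.sum_nonneg fun _ _ => D2_min hf hmin _) (D2_min hf hmin _)

lemma Lap_sub {m : ℕ} {f g : EE m → ℝ} {p : EE m} (hf : ContDiffAt ℝ 2 f p)
    (hg : ContDiffAt ℝ 2 g p) :
    Lap (fun q => f q - g q) p = Lap f p - Lap g p := by
  unfold Lap
  simp only [D2_sub hf hg, Finset.sum_sub_distrib]
  ring

lemma Lap_neg {m : ℕ} (f : EE m → ℝ) (p : EE m) :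
    Lap (fun q => - f q) p = - Lap f p := by
  unfold Lap
  simp only [D2_neg, Finset.sum_neg_distrib]
  ring

lemma Lap_shift {m : ℕ} {f : EE m → ℝ} (c p : EE m) (hf : ContDiffAt ℝ 2 f (c + p)) :
    Lap (fun q => f (c + q)) p = Lap f (c + p) := by
  unfold Lap
  have := D2_comp (ContinuousLinearMap.id ℝ (EE m)) c p hf
  simp only [ContinuousLinearMap.id_apply] at this
  simp only [this]

/-- reflection in the last coordinate -/
noncomputable def Rf (m : ℕ) : EE m →L[ℝ] EE m :=
  (ContinuousLinearMap.fst ℝ _ _).prod (-(ContinuousLinearMap.snd ℝ _ _))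

lemma Rf_apply {m : ℕ} (q : EE m) : Rf m q = (q.1, -q.2) := by
  simp [Rf]

lemma Lap_refl {m : ℕ} {f : EE m → ℝ} (c p : EE m) (hf : ContDiffAt ℝ 2 f (c + Rf m p)) :
    Lap (fun q => f (c + Rf m q)) p = Lap f (c + Rf m p) := by
  unfold Lap
  simp only [D2_comp (Rf m) c p hf]
  have h1 : Rf m (0, 1) = -(0, 1) := by simp [Rf_apply]
  have h2 : ∀ i, Rf m (EuclideanSpace.single i 1, 0) = (EuclideanSpace.single i 1, 0) := by
    simp [Rf_apply]
  simp only [h1, h2, D2_neg_dir]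

/-- barrier -/
noncomputable def wb (m : ℕ) (a b c : ℝ) (q : EE m) : ℝ := a * ‖q.1‖ ^ 2 + b * q.2 - c * q.2 ^ 2

lemma wb_smooth (m : ℕ) (a b c : ℝ) : ContDiff ℝ 2 (wb m a b c) := by
  unfold wb
  have : ContDiff ℝ 2 (fun q : EE m => ‖q.1‖ ^ 2) := contDiff_fst.norm_sq ℝ
  have h2 : ContDiff ℝ 2 (fun q : EE m => q.2) := contDiff_snd
  exact ((contDiff_const.mul this).add (contDiff_const.mul h2)).sub
    (contDiff_const.mul (h2.pow 2))

lemma quad_dd (A B C : ℝ) (φ : ℝ → ℝ) (h : ∀ τ, φ τ = A + B * τ + C * τ ^ 2) :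
    deriv (deriv φ) 0 = 2 * C := by
  have h1 : deriv φ = fun τ => B + C * (2 * τ) := by
    funext τ
    have : φ = fun τ => A + B * τ + C * τ ^ 2 := funext h
    rw [this]
    have := (((hasDerivAt_id τ).const_mul B).const_add A).add
      (((hasDerivAt_id τ).pow 2).const_mul C)
    have h3 := this.deriv
    simp only [id] at h3
    refine Eq.trans ?_ (h3.trans ?_)
    · rfl
    · simp
  rw [h1]
  have := ((((hasDerivAt_id (0:ℝ)).const_mul 2).const_mul C).const_add B).deriv
  simp only [id] at this
  rw [this]; ring

lemma wb_D2 (m : ℕ) (a b c : ℝ) (p e : EE m) :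
    D2 (wb m a b c) p e = 2 * (a * ‖e.1‖ ^ 2 - c * e.2 ^ 2) := by
  rw [← (D2_line (wb_smooth m a b c).contDiffAt e).2]
  refine quad_dd (wb m a b c p) (a * (2 * inner ℝ p.1 e.1) + b * e.2 - c * (2 * p.2 * e.2)) _ _ ?_
  intro τ
  simp only [wb, Prod.fst_add, Prod.snd_add, Prod.smul_fst, Prod.smul_snd, smul_eq_mul,
    norm_add_sq_real, inner_smul_right, norm_smul, Real.norm_eq_abs, mul_pow, sq_abs]
  ring

lemma wb_Lap (m : ℕ) (a b c : ℝ) (p : EE m) :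
    Lap (wb m a b c) p = 2 * (m * a - c) := by
  unfold Lap
  simp only [wb_D2]
  simp
  ring


lemma half_le {m : ℕ} {u : EE m → ℝ} {U : Set (EE m)} (hU : IsOpen U) (hu : HarmonicOnP u U)
    (c : EE m) {ρ S s : ℝ} (hρ : 0 < ρ) (hS : 0 < S) (hs : 0 ≤ s) (hsρ : s ≤ ρ)
    (hball : Metric.closedBall c ρ ⊆ U) (hb : ∀ q ∈ Metric.closedBall c ρ, |u q| ≤ S) :
    u (c + (0, s)) - u (c + (0, -s)) ≤ 2 * S * (m + 2) * s / ρ := by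
  rw [harm_iff] at hu
  obtain ⟨huc, hul⟩ := hu
  set w : EE m → ℝ := wb m (2 * S / ρ ^ 2) (2 * S * (m + 2) / ρ) (2 * S * (m + 1) / ρ ^ 2) with hw
  set v1 : EE m → ℝ := fun q => u (c + q) with hv1
  set v2 : EE m → ℝ := fun q => u (c + Rf m q) with hv2
  set g : EE m → ℝ := fun q => (w q - v1 q) - (- v2 q) with hg
  set D : Set (EE m) := Metric.closedBall 0 ρ ×ˢ Set.Icc 0 ρ with hD
  have hDm : ∀ q ∈ D, c + q ∈ Metric.closedBall c ρ ∧ c + Rf m q ∈ Metric.closedBall c ρ := by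
    rintro ⟨x, y⟩ ⟨hx, hy⟩
    simp only [mem_closedBall_zero_iff, Set.mem_Icc] at hx hy
    simp only [Rf_apply, mem_closedBall_iff_norm, add_sub_cancel_left, Prod.norm_def, sup_le_iff,
      Real.norm_eq_abs, abs_neg, abs_of_nonneg hy.1]
    exact ⟨⟨hx, hy.2⟩, hx, hy.2⟩
  have huat : ∀ q ∈ U, ContDiffAt ℝ 2 u q := fun q hq => huc.contDiffAt (hU.mem_nhds hq)
  have hv1s : ∀ q ∈ D, ContDiffAt ℝ 2 v1 q := fun q hq => by
    have h1 : ContDiffAt ℝ 2 u (c + q) := huat _ (hball (hDm q hq).1)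
    have h2 : ContDiffAt ℝ 2 (fun q : EE m => c + q) q := contDiffAt_const.add contDiffAt_id
    exact ContDiffAt.comp (f := fun q : EE m => c + q) q h1 h2
  have hv2s : ∀ q ∈ D, ContDiffAt ℝ 2 v2 q := fun q hq => by
    have h1 : ContDiffAt ℝ 2 u (c + Rf m q) := huat _ (hball (hDm q hq).2)
    have h2 : ContDiffAt ℝ 2 (fun q : EE m => c + Rf m q) q :=
      contDiffAt_const.add (Rf m).contDiff.contDiffAt
    exact ContDiffAt.comp (f := fun q : EE m => c + Rf m q) q h1 h2
  have hws : ∀ q, ContDiffAt ℝ 2 w q := fun q => (wb_smooth _ _ _ _).contDiffAt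
  have hgs : ∀ q ∈ D, ContDiffAt ℝ 2 g q := fun q hq =>
    ((hws q).sub (hv1s q hq)).sub (hv2s q hq).neg
  have hDc : IsCompact D := (isCompact_closedBall _ _).prod isCompact_Icc
  have h0D : ((0 : EuclideanSpace ℝ (Fin m)), s) ∈ D :=
    ⟨by simp [hρ.le], hs, hsρ⟩
  obtain ⟨⟨x, y⟩, hqD, hqmin⟩ := hDc.exists_isMinOn ⟨_, h0D⟩
    (fun q hq => (hgs q hq).continuousAt.continuousWithinAt)
  have hlap : Lap g (x, y) < 0 := by
    have e1 : Lap g (x, y) = Lap w (x, y) - Lap v1 (x, y) + Lap v2 (x, y) := by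
      rw [hg, Lap_sub ((hws _).sub (hv1s _ hqD)) (hv2s _ hqD).neg, Lap_neg,
        Lap_sub (hws _) (hv1s _ hqD)]
      ring
    have m1 := hball (hDm _ hqD).1
    have m2 := hball (hDm _ hqD).2
    rw [e1, hv1, hv2, Lap_shift _ _ (huat _ m1), Lap_refl _ _ (huat _ m2), hul _ m1, hul _ m2, hw,
      wb_Lap]
    have : (0:ℝ) < 2 * S / ρ ^ 2 := by positivity
    have e2 : 2 * S * (m + 1) / ρ ^ 2 = 2 * S / ρ ^ 2 * (m + 1) := by ring
    rw [e2]
    nlinarith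
  have hgmin : 0 ≤ g (x, y) := by
    have hx : ‖x‖ ≤ ρ := by simpa using hqD.1
    have hy : 0 ≤ y ∧ y ≤ ρ := hqD.2
    have hb1 := abs_le.mp (hb _ (hDm _ hqD).1)
    have hb2 := abs_le.mp (hb _ (hDm _ hqD).2)
    have hwe : w (x, y) = 2 * S * ((‖x‖ / ρ) ^ 2 + (m + 2) * (y / ρ) - (m + 1) * (y / ρ) ^ 2) := by
      simp only [hw, wb]
      field_simp
    have hY0 : 0 ≤ y / ρ := div_nonneg hy.1 hρ.le
    have hY1 : y / ρ ≤ 1 := (div_le_one hρ).mpr hy.2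
    have hm0 : (0:ℝ) ≤ m := Nat.cast_nonneg m
    have hYY : (y / ρ) ^ 2 ≤ y / ρ := by nlinarith
    have hge : y / ρ ≤ (m + 2) * (y / ρ) - (m + 1) * (y / ρ) ^ 2 := by nlinarith
    have key : ∀ T : ℝ, 1 ≤ T → 2 * S * T - u (c + (x, y)) + u (c + Rf m (x, y)) ≥ 0 := by
      intro T hT
      nlinarith
    by_cases hx1 : ‖x‖ = ρ
    · have : (‖x‖ / ρ) = 1 := by rw [hx1]; field_simp
      have := key ((‖x‖ / ρ) ^ 2 + (m + 2) * (y / ρ) - (m + 1) * (y / ρ) ^ 2)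
        (by rw [this]; linarith)
      simp only [hg, hwe, hv1, hv2]; linarith
    by_cases hy1 : y = ρ
    · have : (y / ρ) = 1 := by rw [hy1]; field_simp
      have := key ((‖x‖ / ρ) ^ 2 + (m + 2) * (y / ρ) - (m + 1) * (y / ρ) ^ 2)
        (by have := sq_nonneg (‖x‖ / ρ); linarith)
      simp only [hg, hwe, hv1, hv2]; linarith
    by_cases hy0 : y = 0
    · subst hy0
      simp only [hg, hwe, hv1, hv2, Rf_apply]
      simp only [neg_zero, zero_div]
      have : 0 ≤ 2 * S * ((‖x‖ / ρ) ^ 2) := by positivity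
      linarith
    exfalso
    have hnh : D ∈ nhds (x, y) := by
      refine prod_mem_nhds ?_ (Icc_mem_nhds (lt_of_le_of_ne hy.1 (Ne.symm hy0))
        (lt_of_le_of_ne hy.2 hy1))
      exact Metric.closedBall_mem_nhds_of_mem (by simpa using lt_of_le_of_ne hx hx1)
    exact absurd (Lap_min (hgs _ hqD) (hqmin.isLocalMin hnh)) (not_le.mpr hlap)
  have h0 := hgmin.trans (hqmin h0D)
  simp only [hg, hv1, hv2, Rf_apply, hw, wb] at h0
  have h3 : 0 ≤ 2 * S * (m + 1) / ρ ^ 2 * s ^ 2 := by positivity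
  have e3 : 2 * S * (m + 2) / ρ * s = 2 * S * (m + 2) * s / ρ := by ring
  simp at h0
  linarith

lemma harm_neg {m : ℕ} {u : EE m → ℝ} {U : Set (EE m)} (hu : HarmonicOnP u U) :
    HarmonicOnP (fun q => - u q) U := by
  rw [harm_iff] at hu ⊢
  refine ⟨hu.1.neg, fun p hp => ?_⟩
  rw [Lap_neg, hu.2 p hp, neg_zero]

lemma half_abs {m : ℕ} {u : EE m → ℝ} {U : Set (EE m)} (hU : IsOpen U) (hu : HarmonicOnP u U)
    (c : EE m) {ρ S s : ℝ} (hρ : 0 < ρ) (hS : 0 < S) (hs : 0 ≤ s) (hsρ : s ≤ ρ)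
    (hball : Metric.closedBall c ρ ⊆ U) (hb : ∀ q ∈ Metric.closedBall c ρ, |u q| ≤ S) :
    |u (c + (0, s)) - u (c + (0, -s))| ≤ 2 * S * (m + 2) * s / ρ := by
  have h1 := half_le hU hu c hρ hS hs hsρ hball hb
  have h2 := half_le hU (harm_neg hu) c hρ hS hs hsρ hball (by simpa using hb)
  rw [abs_le]
  constructor <;> linarith

noncomputable def Dt {m : ℕ} (t : ℝ) (f : EE m → ℝ) (q : EE m) : ℝ := f ((0, t) + q) - f q

lemma cb_sub {m : ℕ} (q : EE m) (t r r' : ℝ) (h : |t| + r ≤ r') :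
    Metric.closedBall (q + (0, t)) r ⊆ Metric.closedBall q r' := by
  apply Metric.closedBall_subset_closedBall'
  have : dist (q + (0, t)) q = |t| := by
    rw [dist_eq_norm, add_sub_cancel_left, Prod.norm_def]
    simp
  rw [this]; linarith

lemma Dt_bound {m : ℕ} {u : EE m → ℝ} {U : Set (EE m)} (hU : IsOpen U) (hu : HarmonicOnP u U)
    (q : EE m) {ρ S t : ℝ} (hρ : 0 < ρ) (hS : 0 < S) (ht : 0 < t) (htρ : t ≤ ρ)
    (hball : Metric.closedBall q (2 * ρ) ⊆ U)
    (hb : ∀ q' ∈ Metric.closedBall q (2 * ρ), |u q'| ≤ S) :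
    |Dt t u q| ≤ (m + 2) * t / ρ * S := by
  have hsub : Metric.closedBall (q + (0, t / 2)) ρ ⊆ Metric.closedBall q (2 * ρ) :=
    cb_sub q _ _ _ (by rw [abs_of_pos (by linarith)]; linarith)
  have := half_abs hU hu (q + (0, t / 2)) hρ hS (s := t / 2) (by linarith) (by linarith)
    (hsub.trans hball) (fun q' h => hb q' (hsub h))
  have e1 : q + (0, t / 2) + (0, t / 2) = (0, t) + q := by
    ext <;> simp; ring
  have e2 : q + (0, t / 2) + (0, -(t / 2)) = q := by
    ext <;> simp
  rw [e1, e2] at this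
  refine this.trans (le_of_eq ?_)
  ring

lemma Dt_harm {m : ℕ} {u : EE m → ℝ} {U : Set (EE m)} (hU : IsOpen U) (hu : HarmonicOnP u U)
    (t : ℝ) : IsOpen (U ∩ (fun q : EE m => (0, t) + q) ⁻¹' U) ∧
      HarmonicOnP (Dt t u) (U ∩ (fun q : EE m => (0, t) + q) ⁻¹' U) := by
  rw [harm_iff] at hu ⊢
  obtain ⟨huc, hul⟩ := hu
  have hc : Continuous (fun q : EE m => ((0 : EuclideanSpace ℝ (Fin m)), t) + q) := by fun_prop
  have huat : ∀ q ∈ U, ContDiffAt ℝ 2 u q := fun q hq => huc.contDiffAt (hU.mem_nhds hq)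
  have hs : ∀ q, (0, t) + q ∈ U → ContDiffAt ℝ 2 (fun q => u ((0, t) + q)) q := fun q hq => by
    have h2 : ContDiffAt ℝ 2 (fun q : EE m => ((0 : EuclideanSpace ℝ (Fin m)), t) + q) q :=
      contDiffAt_const.add contDiffAt_id
    exact ContDiffAt.comp (f := fun q : EE m => ((0 : EuclideanSpace ℝ (Fin m)), t) + q) q
      (huat _ hq) h2
  refine ⟨hU.inter (hU.preimage hc), ?_, ?_⟩
  · rintro q ⟨h1, h2⟩
    exact ((hs q h2).sub (huat q h1)).contDiffWithinAt
  · rintro q ⟨h1, h2⟩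
    unfold Dt
    rw [Lap_sub (hs q h2) (huat q h1), Lap_shift _ _ (huat _ h2), hul _ h1, hul _ h2, sub_zero]

lemma iter_bound {m : ℕ} {ρ t : ℝ} (hρ : 0 < ρ) (ht : 0 < t) (htρ : t ≤ ρ) (q : EE m) (N : ℕ) :
    ∀ (u : EE m → ℝ) (U : Set (EE m)) (S : ℝ), IsOpen U → HarmonicOnP u U → 0 < S →
    Metric.closedBall q (2 * ρ * N) ⊆ U →
    (∀ q' ∈ Metric.closedBall q (2 * ρ * N), |u q'| ≤ S) →
    |(Dt t)^[N] u q| ≤ ((m + 2) * t / ρ) ^ N * S := by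
  induction N with
  | zero =>
    intro u U S _ _ _ _ hb
    simpa using hb q (by simp)
  | succ N ih =>
    intro u U S hU hu hS hball hb
    have hbig : ∀ q' ∈ Metric.closedBall q (2 * ρ * N),
        Metric.closedBall q' (2 * ρ) ⊆ Metric.closedBall q (2 * ρ * (N + 1 : ℕ)) := by
      intro q' hq'
      apply Metric.closedBall_subset_closedBall'
      rw [Metric.mem_closedBall] at hq'
      push_cast
      linarith
    obtain ⟨hU', hu'⟩ := Dt_harm hU hu t
    have hpos : 0 < (m + 2) * t / ρ * S := by positivity
    have := ih (Dt t u) _ _ hU' hu' hpos ?_ ?_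
    · rw [Function.iterate_succ_apply]
      refine this.trans (le_of_eq ?_)
      ring
    · intro q' hq'
      refine ⟨hball (hbig q' hq' (Metric.mem_closedBall_self (by linarith))), ?_⟩
      have := hball.trans' ((cb_sub q' t 0 (2 * ρ) (by rw [abs_of_pos ht]; linarith)).trans
        (hbig q' hq')) (Metric.mem_closedBall_self le_rfl)
      rw [add_comm] at this
      exact this
    · intro q' hq'
      exact Dt_bound hU hu q' hρ hS ht htρ ((hbig q' hq').trans hball)
        (fun z hz => hb z (hbig q' hq' hz))

lemma table (a : ℕ → ℕ → ℝ) (ha : ∀ j n, a j (n + 1) = a (j + 1) n - a j n) (N : ℕ) (δ η : ℝ)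
    (hδ : 0 ≤ δ) (hη : 0 ≤ η)
    (h1 : ∀ j, N ≤ j → j ≤ 2 * N → |a j 0| ≤ δ) (h2 : ∀ j ≤ N, |a j N| ≤ η) :
    |a 0 0| ≤ 4 ^ N * (2 ^ N * δ + η) := by
  have s1 : ∀ n j, N ≤ j → j + n ≤ 2 * N → |a j n| ≤ 2 ^ n * δ := by
    intro n
    induction n with
    | zero => intro j hj hj2; simpa using h1 j hj (by omega)
    | succ n ih =>
      intro j hj hj2
      rw [ha, pow_succ]
      have := abs_sub (a (j + 1) n) (a j n)
      have := ih (j + 1) (by omega) (by omega)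
      have := ih j (by omega) (by omega)
      linarith
  set X := 2 ^ N * δ + η with hX
  have hX0 : 0 ≤ X := by positivity
  have s2 : ∀ d j n, j ≤ N → n ≤ N → (N - j) + (N - n) = d → |a j n| ≤ 2 ^ d * X := by
    intro d
    induction d with
    | zero =>
      intro j n hj hn h
      have : n = N := by omega
      subst this
      have := h2 j hj
      have : 0 ≤ 2 ^ n * δ := by positivity
      simp; linarith
    | succ d ih =>
      intro j n hj hn h
      have hXd : X ≤ 2 ^ (d + 1) * X := le_mul_of_one_le_left hX0 (one_le_pow₀ (by norm_num))
      by_cases hn' : n = N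
      · subst hn'
        have := h2 j hj
        have : 0 ≤ 2 ^ n * δ := by positivity
        linarith
      by_cases hj' : j = N
      · subst hj'
        have h3 := s1 n j le_rfl (by omega)
        have h4 : (2:ℝ) ^ n * δ ≤ 2 ^ j * δ :=
          mul_le_mul_of_nonneg_right (pow_le_pow_right₀ (by norm_num) hn) hδ
        linarith
      have e : a j n = a (j + 1) n - a j (n + 1) := by rw [ha]; ring
      have := abs_sub (a (j + 1) n) (a j (n + 1))
      have := ih (j + 1) n (by omega) hn (by omega)
      have := ih j (n + 1) hj (by omega) (by omega)
      rw [e, pow_succ]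
      linarith
  have := s2 (2 * N) 0 0 (by omega) (by omega) (by omega)
  rw [pow_mul] at this
  norm_num at this
  exact this

/-- The constant. -/
noncomputable def LL (m : ℕ) : ℝ := (m + 2) * 2 ^ 15

lemma key {m : ℕ} {u : EE m → ℝ} {U : Set (EE m)} (hU : IsOpen U) (hu : HarmonicOnP u U)
    (p : EE m) {h B : ℝ} (hh : 0 < h) (hp : |p.2| ≤ h) (hB : 2 ^ 11 ≤ B)
    (hball : Metric.closedBall p ((2 * LL m + 2) * h) ⊆ U)
    (hout : ∀ q ∈ U, h ≤ |q.2| → |u q| ≤ B)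
    (hin : ∀ q ∈ Metric.closedBall p ((2 * LL m + 2) * h), |u q| ≤ B ^ 4) :
    |u p| < B ^ 2 := by
  have hm0 : (0:ℝ) ≤ m := Nat.cast_nonneg m
  have hL1 : 1 ≤ LL m := by unfold LL; nlinarith
  have hLpos : 0 < LL m := by linarith
  obtain ⟨N, hN1, hN2⟩ := exists_nat_pow_near (x := B / 4) (y := (8:ℝ)) (by linarith) (by norm_num)
  have hN : N ≠ 0 := by
    rintro rfl
    norm_num at hN2
    linarith
  have hNpos : (0:ℝ) < N := by exact_mod_cast Nat.pos_of_ne_zero hN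
  set t := 2 * h / N with ht
  set ρ := LL m * h / N with hρ
  have htpos : 0 < t := by positivity
  have hρpos : 0 < ρ := by positivity
  have hL2 : 2 ≤ LL m := by unfold LL; nlinarith
  have htρ : t ≤ ρ := by
    rw [ht, hρ]
    gcongr
  have hNt : N * t = 2 * h := by rw [ht]; field_simp
  have hNρ : 2 * ρ * N = 2 * LL m * h := by rw [hρ]; field_simp
  have hB0 : 0 < B := by linarith
  have hq : (m + 2) * t / ρ = (2:ℝ)⁻¹ ^ 14 := by
    rw [ht, hρ]
    unfold LL
    field_simp
  set a : ℕ → ℕ → ℝ := fun j n => (Dt t)^[n] u (p + (0, j * t)) with ha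
  have htab := table a ?_ N B (((2:ℝ)⁻¹ ^ 14) ^ N * B ^ 4) hB0.le (by positivity) ?_ ?_
  · have e0 : a 0 0 = u p := by
      have : p + ((0 : EuclideanSpace ℝ (Fin m)), ((0:ℕ):ℝ) * t) = p := by
        ext <;> simp
      simp only [ha, this, Function.iterate_zero, id]
    rw [e0] at htab
    refine htab.trans_lt ?_
    have e1 : (4:ℝ) ^ N * (2 ^ N * B + (2⁻¹ ^ 14) ^ N * B ^ 4) =
        8 ^ N * B + (2⁻¹ ^ 12) ^ N * B ^ 4 := by
      rw [mul_add, ← mul_assoc, ← mul_assoc, ← mul_pow, ← mul_pow]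
      norm_num
    rw [e1]
    have hB1 : B < 32 * 8 ^ N := by
      rw [pow_succ] at hN2
      linarith
    have hB4 : B ^ 4 ≤ (32 * 8 ^ N) ^ 4 := pow_le_pow_left₀ hB0.le hB1.le 4
    have e2 : ((2:ℝ)⁻¹ ^ 12) ^ N * (32 * 8 ^ N) ^ 4 = 2 ^ 20 := by
      rw [mul_pow, pow_right_comm (8:ℝ) N 4, mul_left_comm, ← mul_pow]
      norm_num
    have h5 : ((2:ℝ)⁻¹ ^ 12) ^ N * B ^ 4 ≤ 2 ^ 20 := by
      rw [← e2]
      gcongr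
    have h6 : 8 ^ N * B ≤ B / 4 * B := by gcongr
    nlinarith
  · intro j n
    simp only [ha, Function.iterate_succ_apply']
    unfold Dt
    have : ((0 : EuclideanSpace ℝ (Fin m)), t) + (p + (0, (j:ℝ) * t)) =
        p + (0, ((j + 1 : ℕ) : ℝ) * t) := by
      ext <;> simp
      ring
    rw [this]
  · intro j hj hj2
    have hj' : (N:ℝ) ≤ j := by exact_mod_cast hj
    have hj2' : (j:ℝ) ≤ 2 * N := by exact_mod_cast hj2
    have hjt : 2 * h ≤ j * t := by
      rw [← hNt]; gcongr
    have hjt2 : j * t ≤ 4 * h := by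
      have : j * t ≤ 2 * N * t := by gcongr
      linarith
    have hmem : p + (0, j * t) ∈ U := by
      refine hball (cb_sub p (j * t) 0 _ ?_ (Metric.mem_closedBall_self le_rfl))
      rw [abs_of_nonneg (by positivity)]
      nlinarith
    refine hout _ hmem ?_
    have := (abs_le.mp hp).1
    simp only [Prod.snd_add]
    exact le_trans (by linarith) (le_abs_self _)
  · intro j hj
    have hj' : (j:ℝ) ≤ N := by exact_mod_cast hj
    have hjt2 : j * t ≤ 2 * h := by
      rw [← hNt]; gcongr
    have hsub : Metric.closedBall (p + (0, j * t)) (2 * ρ * N) ⊆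
        Metric.closedBall p ((2 * LL m + 2) * h) := by
      refine cb_sub p _ _ _ ?_
      rw [abs_of_nonneg (by positivity), hNρ]
      linarith
    have := iter_bound hρpos htpos htρ (p + (0, j * t)) N u U (B ^ 4) hU hu (by positivity)
      (hsub.trans hball) (fun q' hq' => hin q' (hsub hq'))
    rw [hq] at this
    exact this

lemma count_le (x : ℝ) (hx : 0 ≤ x) (n : ℕ) :
    ∑ k ∈ Finset.range n, (if ((k:ℝ) + 1) ≤ x then (1:ℝ) else 0) ≤ min (n:ℝ) x := by
  induction n with
  | zero => simp [hx]
  | succ n ih =>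
    rw [Finset.sum_range_succ]
    push_cast
    obtain ⟨i1, i2⟩ := le_min_iff.mp ih
    split_ifs with h
    · exact le_min (by linarith) (by linarith)
    · exact le_min (by linarith) (by linarith)

lemma widths {H : ℝ} (g : ℝ → ℝ) (hg0 : ∀ y, 0 ≤ g y)
    (hdec : AntitoneOn g (Set.Ioo 0 H)) (hint : IntegrableOn g (Set.Ioo 0 H)) {l : ℝ}
    (hl : 0 < l) :
    ∃ w : ℕ → ℝ, Summable w ∧ (∀ k, 0 ≤ w k) ∧
      ∀ k : ℕ, ∀ y ∈ Set.Ioo 0 H, (k:ℝ) * l ≤ g y → y ≤ w k := by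
  set μ := (volume : Measure ℝ).restrict (Set.Ioo 0 H) with hμ
  have hint' : Integrable g μ := hint
  set s : ℕ → Set ℝ := fun k => {y | k * l ≤ g y} with hs
  have hsm : ∀ k, NullMeasurableSet (s k) μ := fun k =>
    nullMeasurableSet_le aemeasurable_const hint'.aemeasurable
  have hfin : ∀ k, μ (s k) ≠ ⊤ := fun k => measure_ne_top _ _
  refine ⟨fun k => (μ (s k)).toReal, ?_, fun k => ENNReal.toReal_nonneg, ?_⟩
  · rw [← summable_nat_add_iff 1]
    refine summable_of_sum_range_le (c := ∫ y, g y / l ∂μ) (fun k => ENNReal.toReal_nonneg) ?_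
    intro n
    have e1 : ∀ k, (μ (s (k + 1))).toReal = ∫ y, (s (k + 1)).indicator (fun _ => (1:ℝ)) y ∂μ := by
      intro k
      rw [integral_indicator₀ (hsm _)]
      simp [Measure.real]
    have hi : ∀ k, Integrable ((s k).indicator (fun _ => (1:ℝ))) μ := fun k =>
      (integrable_const (1:ℝ)).indicator₀ (hsm k)
    simp only [e1]
    rw [← integral_finsetSum _ (fun k _ => hi (k + 1))]
    refine integral_mono (integrable_finsetSum _ (fun k _ => hi (k + 1))) (hint'.div_const l) ?_
    intro y
    have := (count_le (g y / l) (div_nonneg (hg0 y) hl.le) n).trans (min_le_right _ _)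
    refine le_trans (le_of_eq ?_) this
    refine Finset.sum_congr rfl fun k _ => ?_
    simp only [Set.indicator_apply, hs, Set.mem_setOf_eq, le_div_iff₀ hl]
    push_cast
    rfl
  · intro k y hy hk
    have hsub : Set.Ioo 0 y ⊆ s k ∩ Set.Ioo 0 H := by
      intro z hz
      have hzH : z ∈ Set.Ioo 0 H := ⟨hz.1, hz.2.trans hy.2⟩
      exact ⟨hk.trans (hdec hzH hy hz.2.le), hzH⟩
    have h1 : volume (Set.Ioo 0 y) ≤ μ (s k) := by
      rw [hμ, Measure.restrict_apply₀' measurableSet_Ioo.nullMeasurableSet]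
      exact measure_mono hsub
    have := ENNReal.toReal_mono (hfin k) h1
    rw [Real.volume_Ioo, sub_zero, ENNReal.toReal_ofReal hy.1.le] at this
    exact this

lemma cyl_open (m : ℕ) (R H : ℝ) : IsOpen (Cyl m R H) := by
  have h1 : IsOpen {p : EE m | ‖p.1‖ < R} := isOpen_lt (by fun_prop) continuous_const
  have h2 : IsOpen {p : EE m | |p.2| < H} := isOpen_lt (by fun_prop) continuous_const
  exact h1.inter h2

lemma loglog_eq {x : ℝ} (hx : Real.exp 1 ≤ x) :
    1 ≤ Real.log x ∧ logPlus (logPlus x) = Real.log (Real.log x) := by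
  have h1 : 1 ≤ Real.log x := (Real.le_log_iff_exp_le ((Real.exp_pos 1).trans_le hx)).mpr hx
  refine ⟨h1, ?_⟩
  unfold logPlus
  rw [max_eq_left (by linarith : 0 ≤ Real.log x), max_eq_left (Real.log_nonneg h1)]

lemma bb_succ (k : ℕ) : Real.exp (2 ^ (k + 1)) = Real.exp (2 ^ k) ^ 2 := by
  rw [← Real.exp_nat_mul]
  congr 1
  rw [pow_succ]; push_cast; ring

end Lev

/-- Higher-dimensional harmonic Levinson log log theorem (`n = m + 1 ≥ 2`): if
`M : (0,H) → [e,∞)` is decreasing with `∫₀^H log⁺ log⁺ M < ∞`, then the family of all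
harmonic functions `u` on `Ω = {|x| < R, |y| < H}` with `|u(x,y)| ≤ M(|y|)` is uniformly
bounded on every compact subset of `Ω`. -/
theorem stmt8 (m : ℕ) (hm : 1 ≤ m) (R H : ℝ) (hR : 0 < R) (hH : 0 < H)
    (M : ℝ → ℝ) (hdec : AntitoneOn M (Set.Ioo 0 H))
    (hMe : ∀ y ∈ Set.Ioo 0 H, Real.exp 1 ≤ M y)
    (hMint : IntegrableOn (fun y => logPlus (logPlus (M y))) (Set.Ioo 0 H)) :
    ∀ K : Set (EuclideanSpace ℝ (Fin m) × ℝ), IsCompact K → K ⊆ Cyl m R H →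
      ∃ C : ℝ, ∀ u : EuclideanSpace ℝ (Fin m) × ℝ → ℝ,
        HarmonicOnP u (Cyl m R H) →
        (∀ p ∈ Cyl m R H, p.2 ≠ 0 → |u p| ≤ M |p.2|) →
        ∀ p ∈ K, |u p| ≤ C := by

  intro K hK hKs
  set Ω := Cyl m R H with hΩ
  have hΩo : IsOpen Ω := Lev.cyl_open m R H
  obtain ⟨d, hd, hdK⟩ := hK.exists_cthickening_subset_open hΩo hKs
  have hanti : AntitoneOn (fun y => logPlus (logPlus (M y))) (Set.Ioo 0 H) := by
    intro a ha b hb hab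
    obtain ⟨h1, e1⟩ := Lev.loglog_eq (hMe a ha)
    obtain ⟨h2, e2⟩ := Lev.loglog_eq (hMe b hb)
    simp only [e1, e2]
    have hpos : 0 < M b := (Real.exp_pos 1).trans_le (hMe b hb)
    exact Real.log_le_log (by linarith) (Real.log_le_log hpos (hdec ha hb hab))
  obtain ⟨w, hws, hw0, hw⟩ := Lev.widths (fun y => logPlus (logPlus (M y)))
    (fun y => le_max_right _ _) hanti hMint (Real.log_pos (by norm_num : (1:ℝ) < 2))
  set hh : ℕ → ℝ := fun k => w k + (1 / 2 : ℝ) ^ k with hhh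
  have hhs : Summable hh := hws.add summable_geometric_two
  have hhpos : ∀ k, 0 < hh k := fun k => add_pos_of_nonneg_of_pos (hw0 k) (by positivity)
  have hwk : ∀ k, w k < hh k := fun k => lt_add_of_pos_right _ (by positivity)
  -- smallness of M away from the axis
  have hM : ∀ k : ℕ, ∀ y ∈ Set.Ioo 0 H, hh k ≤ y → M y ≤ Real.exp (2 ^ k) := by
    intro k y hy hky
    by_contra hlt
    push Not at hlt
    have h1 : (2:ℝ) ^ k < Real.log (M y) :=
      (Real.lt_log_iff_exp_lt ((Real.exp_pos _).trans hlt)).mpr hlt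
    have h2 : Real.log ((2:ℝ) ^ k) ≤ Real.log (Real.log (M y)) :=
      Real.log_le_log (by positivity) h1.le
    rw [Real.log_pow, ← (Lev.loglog_eq (hMe y hy)).2] at h2
    have h3 := hw k y hy h2
    linarith [hwk k]
  set L : ℝ := 2 * Lev.LL m + 2 with hL
  have hLpos : 0 < L := by
    have : 0 < Lev.LL m := by unfold Lev.LL; positivity
    linarith
  have hpow : Filter.Tendsto (fun k : ℕ => Real.exp (2 ^ k)) Filter.atTop Filter.atTop :=
    Real.tendsto_exp_atTop.comp (tendsto_pow_atTop_atTop_of_one_lt (by norm_num))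
  have htail := (tendsto_sum_nat_add hh).eventually_lt_const (div_pos hd hLpos)
  obtain ⟨k0, hk1, hk2⟩ := (htail.and (hpow.eventually_ge_atTop (2 ^ 11))).exists
  have hsum : ∀ n, L * ∑ j ∈ Finset.range n, hh (j + k0) ≤ d := by
    intro n
    have h1 : ∑ j ∈ Finset.range n, hh (j + k0) ≤ ∑' j, hh (j + k0) :=
      ((summable_nat_add_iff k0).mpr hhs).sum_le_tsum _ (fun j _ => (hhpos _).le)
    have h2 := h1.trans hk1.le
    rw [le_div_iff₀ hLpos] at h2
    linarith
  refine ⟨Real.exp (2 ^ (k0 + 1)), fun u hu hub p hp => ?_⟩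
  by_contra hlt
  push Not at hlt
  have hpd : Metric.closedBall p d ⊆ Ω :=
    (Metric.closedBall_subset_cthickening hp d).trans hdK
  have hmono : ∀ a b : ℕ, a ≤ b → Real.exp (2 ^ a) ≤ Real.exp (2 ^ b) := fun a b hab =>
    Real.exp_le_exp.mpr (pow_le_pow_right₀ (by norm_num) hab)
  have hiter : ∀ n : ℕ, ∃ q, dist q p ≤ L * ∑ j ∈ Finset.range n, hh (j + k0) ∧
      Real.exp (2 ^ (n + k0 + 1)) ≤ |u q| := by
    intro n
    induction n with
    | zero => exact ⟨p, by simp, by simpa using hlt.le⟩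
    | succ n ih =>
      obtain ⟨q, hq1, hq2⟩ := ih
      have hsub : Metric.closedBall q (L * hh (n + k0)) ⊆
          Metric.closedBall p (L * ∑ j ∈ Finset.range (n + 1), hh (j + k0)) := by
        apply Metric.closedBall_subset_closedBall'
        rw [Finset.sum_range_succ, mul_add]
        linarith
      have hsubΩ : Metric.closedBall q (L * hh (n + k0)) ⊆ Ω :=
        hsub.trans ((Metric.closedBall_subset_closedBall (hsum _)).trans hpd)
      have hqΩ : q ∈ Ω := hsubΩ (Metric.mem_closedBall_self (by have := hhpos (n + k0); positivity))
      have hout : ∀ z ∈ Ω, hh (n + k0) ≤ |z.2| → |u z| ≤ Real.exp (2 ^ (n + k0)) := by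
        intro z hz hzh
        have hz0 : 0 < |z.2| := (hhpos _).trans_le hzh
        exact (hub z hz (abs_pos.mp hz0)).trans (hM _ _ ⟨hz0, hz.2⟩ hzh)
      have hBbig : (2:ℝ) ^ 11 ≤ Real.exp (2 ^ (n + k0)) := hk2.trans (hmono _ _ (by omega))
      rw [Lev.bb_succ] at hq2
      have hqh : |q.2| ≤ hh (n + k0) := by
        by_contra hc
        push Not at hc
        have := hout q hqΩ hc.le
        nlinarith
      by_contra hno
      push Not at hno
      have hlast := Lev.key hΩo hu q (hhpos (n + k0)) hqh hBbig hsubΩ hout (by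
        intro z hz
        have hz1 := hno z (by simpa using hsub hz)
        have e : n + 1 + k0 + 1 = (n + k0 + 1) + 1 := by ring
        rw [e, Lev.bb_succ, Lev.bb_succ, ← pow_mul] at hz1
        exact hz1.le)
      linarith
  have hcont : ContinuousOn u (Metric.closedBall p d) := hu.1.continuousOn.mono hpd
  obtain ⟨C, hC⟩ := (isCompact_closedBall p d).exists_bound_of_continuousOn hcont
  obtain ⟨n, hn⟩ := (hpow.eventually_gt_atTop C).exists
  obtain ⟨q, hq1, hq2⟩ := hiter n
  have h1 := hC q (hq1.trans (hsum n))
  rw [Real.norm_eq_abs] at h1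
  have h2 := hmono n (n + k0 + 1) (by omega)
  linarith
end

section
/- Let w = w(ρ, h) be an axially-symmetric harmonic function on the truncated cylinder P_ε = {(x, y) : x ∈ ℝ³, y ∈ ℝ, |x| < ε, |y| < H} ⊂ ℝ⁴ with |w(x, y)| ≤ M(|y|), where M : (0,H) → [e,∞) is decreasing and satisfies ∫₀^H log⁺ log⁺ M(y) dy < ∞. Then there is a constant C = C(M, H, ε) such that |w(0, y)| ≤ C for all y ∈ (−H + ε, H − ε). -/
open MeasureTheory

/-- The truncated cylinder `{(x,y) : x ∈ ℝ³, |x| < ε, |y| < H} ⊆ ℝ⁴`. -/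
def Cyl4 (ε H : ℝ) : Set (EuclideanSpace ℝ (Fin 3) × ℝ) :=
  {p | ‖p.1‖ < ε ∧ |p.2| < H}


lemma isOpen_Cyl4 (ε H : ℝ) : IsOpen (Cyl4 ε H) := by
  exact (isOpen_lt continuous_fst.norm continuous_const).inter
    (isOpen_lt continuous_snd.abs continuous_const)

/-- Rotation invariance, infinitesimally. -/
lemma rot_deriv {ε H : ℝ} {w : EuclideanSpace ℝ (Fin 3) × ℝ → ℝ} {W : ℝ → ℝ → ℝ}
    (hw : ContDiffOn ℝ 2 w (Cyl4 ε H)) (hW : ∀ p ∈ Cyl4 ε H, w p = W ‖p.1‖ p.2)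
    {i j : Fin 3} (hij : i ≠ j)
    {p : EuclideanSpace ℝ (Fin 3) × ℝ} (hp : p ∈ Cyl4 ε H) :
    p.1 i * fderiv ℝ w p (EuclideanSpace.single j 1, 0)
      - p.1 j * fderiv ℝ w p (EuclideanSpace.single i 1, 0) = 0 := by
  set ei : EuclideanSpace ℝ (Fin 3) := EuclideanSpace.single i 1
  set ej : EuclideanSpace ℝ (Fin 3) := EuclideanSpace.single j 1
  set u := p.1 i • ei + p.1 j • ej with hu
  set u' := p.1 i • ej - p.1 j • ei with hu'
  set γ : ℝ → EuclideanSpace ℝ (Fin 3) × ℝ :=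
    fun t => (p.1 + (Real.cos t - 1) • u + Real.sin t • u', p.2) with hγ
  have hnorm : ∀ t, ‖(γ t).1‖ = ‖p.1‖ := by
    intro t
    rw [EuclideanSpace.norm_eq, EuclideanSpace.norm_eq]
    congr 1
    have hsc := Real.sin_sq_add_cos_sq t
    fin_cases i <;> fin_cases j <;>
      first
      | exact absurd rfl hij
      | (simp [Fin.sum_univ_three, hγ, hu, hu', ei, ej]
         first
         | linear_combination (p.1 0 ^ 2 + p.1 1 ^ 2) * hsc
         | linear_combination (p.1 0 ^ 2 + p.1 2 ^ 2) * hsc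
         | linear_combination (p.1 1 ^ 2 + p.1 2 ^ 2) * hsc)
  have hγ0 : γ 0 = p := by simp [hγ]
  have hmem : ∀ t, γ t ∈ Cyl4 ε H := fun t => ⟨by rw [hnorm]; exact hp.1, hp.2⟩
  have hconst : ∀ t, w (γ t) = w p := by
    intro t
    rw [hW _ (hmem t), hW _ hp, hnorm]
  have hd : HasDerivAt γ (u', 0) 0 := by
    have h1 : HasDerivAt (fun t : ℝ => p.1 + (Real.cos t - 1) • u + Real.sin t • u')
        ((-Real.sin 0) • u + Real.cos 0 • u') 0 :=
      ((((Real.hasDerivAt_cos 0).sub_const 1).smul_const u).const_add p.1).add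
        ((Real.hasDerivAt_sin 0).smul_const u')
    have h2 := h1.prodMk (hasDerivAt_const (0 : ℝ) p.2)
    simpa using h2
  have hwd : HasFDerivAt w (fderiv ℝ w p) (γ 0) := by
    rw [hγ0]
    exact ((hw.contDiffAt ((isOpen_Cyl4 ε H).mem_nhds hp)).differentiableAt two_ne_zero).hasFDerivAt
  have h3 := hwd.comp_hasDerivAt 0 hd
  have h4 : HasDerivAt (w ∘ γ) 0 0 := by
    have : w ∘ γ = fun _ => w p := funext hconst
    rw [this]; exact hasDerivAt_const _ _
  have h5 := h3.unique h4
  have h6 : ((u', 0) : EuclideanSpace ℝ (Fin 3) × ℝ) = p.1 i • (ej, 0) - p.1 j • (ei, 0) := by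
    simp [hu']
  rw [h6, map_sub, map_smul, map_smul] at h5
  simpa using h5

/-- Second-order consequence on the axis spanned by `e₀`. -/
lemma rot_deriv2 {ε H : ℝ} {w : EuclideanSpace ℝ (Fin 3) × ℝ → ℝ} {W : ℝ → ℝ → ℝ}
    (hw : ContDiffOn ℝ 2 w (Cyl4 ε H)) (hW : ∀ p ∈ Cyl4 ε H, w p = W ‖p.1‖ p.2)
    {j : Fin 3} (hj : 0 ≠ j)
    {p : EuclideanSpace ℝ (Fin 3) × ℝ} (hp : p ∈ Cyl4 ε H) (hpj : p.1 j = 0) :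
    p.1 0 * fderiv ℝ (fun q => fderiv ℝ w q (EuclideanSpace.single j 1, 0)) p
        (EuclideanSpace.single j 1, 0)
      = fderiv ℝ w p (EuclideanSpace.single 0 1, 0) := by
  have hwp := hw.contDiffAt ((isOpen_Cyl4 ε H).mem_nhds hp)
  have hD : DifferentiableAt ℝ (fderiv ℝ w) p :=
    (hwp.fderiv_right (m := 1) (by norm_num)).differentiableAt one_ne_zero
  have hDv : ∀ v, DifferentiableAt ℝ (fun q => fderiv ℝ w q v) p := fun v =>
    hD.clm_apply (differentiableAt_const v)
  set Lc : Fin 3 → (EuclideanSpace ℝ (Fin 3) × ℝ →L[ℝ] ℝ) := fun k =>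
    (EuclideanSpace.proj k).comp (ContinuousLinearMap.fst ℝ _ _) with hLc
  have h1 := ((Lc 0).hasFDerivAt (x := p)).mul (hDv (EuclideanSpace.single j 1, 0)).hasFDerivAt
  have h2 := ((Lc j).hasFDerivAt (x := p)).mul (hDv (EuclideanSpace.single 0 1, 0)).hasFDerivAt
  have h3 := h1.sub h2
  have h4 := h3.unique ((hasFDerivAt_const (0 : ℝ) p).congr_of_eventuallyEq (by
    filter_upwards [(isOpen_Cyl4 ε H).mem_nhds hp] with q hq
    exact rot_deriv hw hW hj hq))
  have h5 := DFunLike.congr_fun h4 (EuclideanSpace.single j 1, 0)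
  have : (Lc 0) (EuclideanSpace.single j 1, 0) = 0 := by simp [hLc, hj]
  have h7 : (Lc j) (EuclideanSpace.single j 1, 0) = 1 := by simp [hLc]
  have h8 : (Lc j) p = 0 := by simp [hLc, hpj]
  have h9 : (Lc 0) p = p.1 0 := by simp [hLc]
  simp [this, h7, h8, h9] at h5
  linarith

/-- Embedding of the half-plane. -/
noncomputable def planeJ : ℂ →L[ℝ] EuclideanSpace ℝ (Fin 3) × ℝ :=
  (Complex.reCLM.smulRight (EuclideanSpace.single 0 1)).prod Complex.imCLM

lemma planeJ_apply (z : ℂ) : planeJ z = (z.re • EuclideanSpace.single 0 1, z.im) := by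
  simp [planeJ]

lemma planeJ_mem {ε H : ℝ} {z : ℂ} (h1 : |z.re| < ε) (h2 : |z.im| < H) : planeJ z ∈ Cyl4 ε H := by
  rw [planeJ_apply]
  refine ⟨?_, h2⟩
  simpa [norm_smul] using h1

noncomputable def planeV (w : EuclideanSpace ℝ (Fin 3) × ℝ → ℝ) (z : ℂ) : ℝ := z.re * w (planeJ z)

lemma planeV_hasFDerivAt {ε H : ℝ} {w : EuclideanSpace ℝ (Fin 3) × ℝ → ℝ}
    (hw : ContDiffOn ℝ 2 w (Cyl4 ε H)) {z : ℂ} (hz : planeJ z ∈ Cyl4 ε H) (h : ℂ) :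
    fderiv ℝ (planeV w) z h = z.re * fderiv ℝ w (planeJ z) (planeJ h) + w (planeJ z) * h.re := by
  have hwd : HasFDerivAt w (fderiv ℝ w (planeJ z)) (planeJ z) :=
    ((hw.contDiffAt ((isOpen_Cyl4 ε H).mem_nhds hz)).differentiableAt two_ne_zero).hasFDerivAt
  have h1 : HasFDerivAt (planeV w) _ z :=
    (Complex.reCLM.hasFDerivAt (x := z)).mul (hwd.comp z planeJ.hasFDerivAt)
  rw [h1.fderiv]
  simp

open InnerProductSpace in
lemma planeV_harmonic {ε H : ℝ} {w : EuclideanSpace ℝ (Fin 3) × ℝ → ℝ} {W : ℝ → ℝ → ℝ}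
    (hw : HarmonicOnP w (Cyl4 ε H)) (hW : ∀ p ∈ Cyl4 ε H, w p = W ‖p.1‖ p.2) {z : ℂ}
    (hz : planeJ z ∈ Cyl4 ε H) : HarmonicAt (planeV w) z := by
  have hop : IsOpen (planeJ ⁻¹' (Cyl4 ε H)) := (isOpen_Cyl4 ε H).preimage planeJ.continuous
  have hcd : ∀ z, planeJ z ∈ Cyl4 ε H → ContDiffAt ℝ 2 (planeV w) z := fun z hz =>
    (Complex.reCLM.contDiff.contDiffAt).mul
      ((hw.1.contDiffAt ((isOpen_Cyl4 ε H).mem_nhds hz)).comp z planeJ.contDiff.contDiffAt)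
  refine ⟨hcd z hz, ?_⟩
  filter_upwards [hop.mem_nhds hz] with y hy
  have hy : planeJ y ∈ Cyl4 ε H := hy
  have hwp := hw.1.contDiffAt ((isOpen_Cyl4 ε H).mem_nhds hy)
  have hD : DifferentiableAt ℝ (fderiv ℝ w) (planeJ y) :=
    (hwp.fderiv_right (m := 1) (by norm_num)).differentiableAt one_ne_zero
  have hDv : ∀ v, DifferentiableAt ℝ (fun q => fderiv ℝ w q v) (planeJ y) := fun v =>
    hD.clm_apply (differentiableAt_const v)
  have hDV : DifferentiableAt ℝ (fderiv ℝ (planeV w)) y :=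
    ((hcd y hy).fderiv_right (m := 1) (by norm_num)).differentiableAt one_ne_zero
  have hwd : HasFDerivAt w (fderiv ℝ w (planeJ y)) (planeJ y) :=
    (hwp.differentiableAt two_ne_zero).hasFDerivAt
  have hsec : ∀ h : ℂ, fderiv ℝ (fderiv ℝ (planeV w)) y h h =
      y.re * fderiv ℝ (fun q => fderiv ℝ w q (planeJ h)) (planeJ y) (planeJ h)
        + 2 * h.re * fderiv ℝ w (planeJ y) (planeJ h) := by
    intro h
    have e1 : fderiv ℝ (fderiv ℝ (planeV w)) y h h
        = fderiv ℝ (fun q => fderiv ℝ (planeV w) q h) y h := by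
      rw [fderiv_clm_apply hDV (differentiableAt_const h)]
      simp
    rw [e1]
    have h1 := ((Complex.reCLM.hasFDerivAt (x := y)).mul
      ((hDv (planeJ h)).hasFDerivAt.comp y planeJ.hasFDerivAt)).add
      ((hwd.comp y planeJ.hasFDerivAt).mul_const h.re)
    have h2 : HasFDerivAt (fun q => fderiv ℝ (planeV w) q h) _ y :=
      h1.congr_of_eventuallyEq (by
        filter_upwards [hop.mem_nhds hy] with q hq
        exact planeV_hasFDerivAt hw.1 hq h)
    rw [h2.fderiv]
    simp
    ring
  rw [laplacian_eq_iteratedFDeriv_complexPlane]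
  simp only [iteratedFDeriv_two_apply, Matrix.cons_val_zero, Matrix.cons_val_one,
    Matrix.cons_val_fin_one, hsec, Pi.zero_apply]
  have hJ1 : planeJ 1 = (EuclideanSpace.single 0 1, 0) := by simp [planeJ_apply]
  have hJI : planeJ Complex.I = (0, 1) := by simp [planeJ_apply]
  rw [hJ1, hJI]
  have hlap := hw.2 _ hy
  rw [Fin.sum_univ_three] at hlap
  have r1 := rot_deriv2 hw.1 hW (j := 1) (by decide) hy (by simp [planeJ_apply])
  have r2 := rot_deriv2 hw.1 hW (j := 2) (by decide) hy (by simp [planeJ_apply])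
  have h0 : (planeJ y).1 0 = y.re := by simp [planeJ_apply]
  rw [h0] at r1 r2
  simp only [Complex.one_re, Complex.I_re]
  linear_combination y.re * hlap - r1 - r2

open Complex InnerProductSpace Metric Set Topology in
lemma grad_bound {v : ℂ → ℝ} {c : ℂ} {r B : ℝ} (hr : 0 < r) (hB : 0 < B)
    (hv : HarmonicOnNhd v (ball c r)) (hb : ∀ z ∈ ball c r, |v z| ≤ B) :
    ‖(fderiv ℝ v c 1 : ℂ) - I * fderiv ℝ v c I‖ ≤ 2 * Real.exp 2 * B / r := by
  obtain ⟨F, hF, hre⟩ := hv.exists_analyticOnNhd_ball_re_eq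
  have hc : c ∈ ball c r := mem_ball_self hr
  have hFd : HasDerivAt F (deriv F c) c := (hF c hc).differentiableAt.hasDerivAt
  have hvd : HasFDerivAt v (reCLM.comp
      ((ContinuousLinearMap.toSpanSingleton ℂ (deriv F c)).restrictScalars ℝ)) c := by
    refine (reCLM.hasFDerivAt.comp c (hFd.hasFDerivAt.restrictScalars ℝ)).congr_of_eventuallyEq ?_
    filter_upwards [isOpen_ball.mem_nhds hc] with z hz
    exact (hre hz).symm
  have hpart : (fderiv ℝ v c 1 : ℂ) - I * fderiv ℝ v c I = deriv F c := by
    rw [hvd.fderiv]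
    apply Complex.ext <;> simp
  rw [hpart]
  set G : ℂ → ℂ := fun z => exp (F z / B) with hG
  have hGn : ∀ z ∈ ball c r, ‖G z‖ = Real.exp (v z / B) := by
    intro z hz
    rw [hG, norm_exp, div_ofReal_re]
    congr 2
    exact hre hz
  have hGd : DifferentiableOn ℂ G (ball c r) := by
    have := hF.differentiableOn
    exact (this.div_const _).cexp
  have hsub : closedBall c (r / 2) ⊆ ball c r := closedBall_subset_ball (by linarith)
  have hcau := norm_deriv_le_of_forall_mem_sphere_norm_le (f := G) (c := c) (R := r / 2)
    (C := Real.exp 1) (by positivity) (hGd.diffContOnCl_ball hsub) (by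
      intro z hz
      have hz' := hsub (sphere_subset_closedBall hz)
      rw [hGn z hz']
      apply Real.exp_le_exp.2
      rw [div_le_one hB]
      exact (le_abs_self _).trans (hb z hz'))
  have hGder : deriv G c = G c * (deriv F c / B) := (hFd.div_const (B : ℂ)).cexp.deriv
  rw [hGder, norm_mul, norm_div, hGn c hc, Complex.norm_real, Real.norm_of_nonneg hB.le] at hcau
  have hlow : Real.exp (-1) ≤ Real.exp (v c / B) := by
    apply Real.exp_le_exp.2
    rw [le_div_iff₀ hB]
    have := (abs_le.1 (hb c hc)).1
    linarith
  have h1 : Real.exp (-1) * (‖deriv F c‖ / B) ≤ Real.exp 1 / (r / 2) :=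
    le_trans (mul_le_mul_of_nonneg_right hlow (by positivity)) hcau
  have h2 : ‖deriv F c‖ = Real.exp 1 * B * (Real.exp (-1) * (‖deriv F c‖ / B)) := by
    have : Real.exp 1 * Real.exp (-1) = 1 := by rw [← Real.exp_add]; simp
    field_simp
    rw [mul_assoc, this, mul_one]
  rw [h2]
  calc Real.exp 1 * B * (Real.exp (-1) * (‖deriv F c‖ / B))
      ≤ Real.exp 1 * B * (Real.exp 1 / (r / 2)) := by gcongr
    _ = 2 * Real.exp 2 * B / r := by
      rw [show (2 : ℝ) = 1 + 1 by norm_num, Real.exp_add]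
      field_simp

open Complex Metric in
lemma domar_step {f : ℂ → ℂ} {z0 : ℂ} {s T : ℝ} (hs : 0 < s) (hT : 0 < T)
    (hd : DifferentiableOn ℂ f (closedBall z0 (8 * s)))
    (h0 : Real.exp T ≤ ‖f z0‖)
    (hlev : ∀ z ∈ closedBall z0 (8 * s), Real.exp (T / 2) < ‖f z‖ → |z.im| ≤ s) :
    ∃ z ∈ closedBall z0 (8 * s), Real.exp (5 / 4 * T) ≤ ‖f z‖ := by
  by_contra hcon
  push Not at hcon
  set P : ℂ → ℂ := fun z => (T / 2 + 3 / 4 * T * (9 / 16) : ℝ) +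
    ((3 / 4 * T / 2 / (8 * s) ^ 2 : ℝ) : ℂ) * (z - z0) ^ 2 with hP
  have hPd : Differentiable ℂ P := by fun_prop
  have hR : 0 < 8 * s := by positivity
  have hg : DiffContOnCl ℂ (fun z => f z * exp (-P z)) (ball z0 (8 * s)) := by
    apply DifferentiableOn.diffContOnCl
    rw [closure_ball _ hR.ne']
    exact hd.mul (by fun_prop)
  have him0 : |z0.im| ≤ s := hlev z0 (mem_closedBall_self hR.le)
    (lt_of_lt_of_le (Real.exp_lt_exp.2 (by linarith)) h0)
  have key := Complex.norm_le_of_forall_mem_frontier_norm_le isBounded_ball hg (C := 1) ?_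
    (subset_closure (mem_ball_self hR))
  · rw [norm_mul, norm_exp] at key
    have h1 : (-P z0).re = -(T / 2 + 3 / 4 * T * (9 / 16)) := by
      simp [hP, -ofReal_add, -ofReal_mul, -ofReal_div]
    rw [h1] at key
    have h2 : Real.exp T * Real.exp (-(T / 2 + 3 / 4 * T * (9 / 16))) ≤ 1 :=
      le_trans (mul_le_mul_of_nonneg_right h0 (Real.exp_pos _).le) key
    rw [← Real.exp_add, Real.exp_le_one_iff] at h2
    linarith
  · intro z hz
    rw [frontier_ball _ hR.ne'] at hz
    have hzc := sphere_subset_closedBall hz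
    rw [norm_mul, norm_exp]
    have hn : (z - z0).re ^ 2 + (z - z0).im ^ 2 = (8 * s) ^ 2 := by
      have : ‖z - z0‖ = 8 * s := by simpa [dist_eq_norm] using hz
      rw [← this, Complex.sq_norm, normSq_apply]; ring
    have h1 : (P z).re = T / 2 + 3 / 4 * T * (9 / 16) + 3 / 4 * T / 2 / (8 * s) ^ 2 *
        ((z - z0).re ^ 2 - (z - z0).im ^ 2) := by
      simp only [hP, add_re, ofReal_re, ofReal_im, sq, mul_re, zero_mul, sub_zero]
    set q := (z - z0).im ^ 2 / (8 * s) ^ 2 with hq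
    have h2 : (P z).re = T / 2 + 3 / 4 * T * (17 / 16 - q) := by
      rw [h1, hq, show (z - z0).re ^ 2 = (8 * s) ^ 2 - (z - z0).im ^ 2 by linarith]
      field_simp
      ring
    have hq1 : q ≤ 1 := by
      rw [hq, div_le_one (by positivity)]
      nlinarith [sq_nonneg (z - z0).re]
    rw [neg_re]
    have hfin : ‖f z‖ ≤ Real.exp ((P z).re) := by
      by_cases hbig : Real.exp (T / 2) < ‖f z‖
      · have him := hlev z hzc hbig
        have hq2 : q ≤ 1 / 16 := by
          rw [hq, div_le_iff₀ (by positivity)]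
          have : |(z - z0).im| ≤ 2 * s := by
            rw [sub_im]; exact (abs_sub _ _).trans (by linarith)
          nlinarith [sq_abs (z - z0).im, abs_nonneg (z - z0).im]
        refine (hcon z hzc).le.trans (Real.exp_le_exp.2 ?_)
        rw [h2]; nlinarith
      · push Not at hbig
        refine hbig.trans (Real.exp_le_exp.2 ?_)
        rw [h2]; nlinarith
    calc ‖f z‖ * Real.exp (-(P z).re) ≤ Real.exp ((P z).re) * Real.exp (-(P z).re) := by gcongr
      _ = 1 := by rw [← Real.exp_add]; simp

open Metric in
lemma domar_iter {f : ℂ → ℂ} {z0 : ℂ} {a T0 : ℝ} (hT : 0 < T0) (S : ℕ → ℝ) (hS : ∀ n, 0 < S n)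
    (hsum : ∀ n, ∑ k ∈ Finset.range n, 8 * S k ≤ a)
    (hd : DifferentiableOn ℂ f (closedBall z0 a))
    (hlev : ∀ n, ∀ z ∈ closedBall z0 a, Real.exp ((5 / 4) ^ n * T0 / 2) < ‖f z‖ → |z.im| ≤ S n) :
    ‖f z0‖ < Real.exp T0 := by
  by_contra hcon
  push Not at hcon
  have hind : ∀ n : ℕ, ∃ z, dist z z0 ≤ ∑ k ∈ Finset.range n, 8 * S k ∧
      Real.exp ((5 / 4) ^ n * T0) ≤ ‖f z‖ := by
    intro n
    induction n with
    | zero => exact ⟨z0, by simp, by simpa using hcon⟩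
    | succ n ih =>
      obtain ⟨z, hz, hfz⟩ := ih
      have hsub : closedBall z (8 * S n) ⊆ closedBall z0 a := by
        apply closedBall_subset_closedBall'
        have := hsum (n + 1)
        rw [Finset.sum_range_succ] at this
        linarith
      obtain ⟨z', hz', hfz'⟩ := domar_step (hS n) (by positivity) (hd.mono hsub) hfz
        (fun x hx => hlev n x (hsub hx))
      refine ⟨z', ?_, ?_⟩
      · rw [Finset.sum_range_succ]
        have := dist_triangle z' z z0
        rw [mem_closedBall] at hz'
        linarith
      · refine le_trans (le_of_eq ?_) hfz'
        congr 1; ring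
  obtain ⟨C, hC⟩ := (isCompact_closedBall z0 a).exists_bound_of_continuousOn hd.continuousOn
  obtain ⟨n, hn⟩ := pow_unbounded_of_one_lt (C / T0) (by norm_num : (1 : ℝ) < 5 / 4)
  obtain ⟨z, hz, hfz⟩ := hind n
  have h1 := hC z (mem_closedBall.2 (hz.trans (hsum n)))
  rw [div_lt_iff₀ hT] at hn
  have := Real.add_one_le_exp ((5 / 4) ^ n * T0)
  linarith
lemma count_le (g : ℕ → ℝ) (Y : ℝ) (hY : 0 ≤ Y) (hg1 : ∀ n, g n ≤ 1)
    (hg : ∀ n, g n ≤ 0 ∨ (n : ℝ) ≤ Y) (N : ℕ) : ∑ n ∈ Finset.range N, g n ≤ Y + 1 := by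
  induction N with
  | zero => simp; linarith
  | succ N ih =>
    rcases hg N with h | h
    · rw [Finset.sum_range_succ]; linarith
    · have : ∑ n ∈ Finset.range (N + 1), g n ≤ ∑ n ∈ Finset.range (N + 1), (1 : ℝ) :=
        Finset.sum_le_sum fun n _ => hg1 n
      simp at this
      linarith

lemma exists_levels (H : ℝ) (hH : 0 < H) (L : ℝ → ℝ) (hdec : AntitoneOn L (Set.Ioo 0 H))
    (hL : ∀ y ∈ Set.Ioo 0 H, 1 ≤ L y)
    (hint : IntegrableOn (fun y => Real.log (L y)) (Set.Ioo 0 H)) :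
    ∃ σ : ℕ → ℝ, (∀ n, 0 ≤ σ n) ∧ Summable σ ∧
      ∀ n, ∀ s ∈ Set.Ioo 0 H, (5 / 4 : ℝ) ^ n < L s → s ≤ σ n := by
  set A : ℕ → Set ℝ := fun n => {0} ∪ {s | s ∈ Set.Ioo 0 H ∧ (5 / 4 : ℝ) ^ n < L s} with hA
  have hbdd : ∀ n, ∀ s ∈ A n, s ≤ H := by
    rintro n s (hs | hs)
    · rw [Set.mem_singleton_iff.1 hs]; exact hH.le
    · exact hs.1.2.le
  have hbA : ∀ n, BddAbove (A n) := fun n => ⟨H, hbdd n⟩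
  have hne : ∀ n, (A n).Nonempty := fun n => ⟨0, Or.inl rfl⟩
  have h0 : ∀ n, 0 ≤ sSup (A n) := fun n => le_csSup (hbA n) (Or.inl rfl)
  have hH' : ∀ n, sSup (A n) ≤ H := fun n => csSup_le (hne n) (hbdd n)
  refine ⟨fun n => sSup (A n), h0, ?_, fun n s hs hl => le_csSup (hbA n) (Or.inr ⟨hs, hl⟩)⟩
  have hlog : 0 < Real.log (5 / 4) := Real.log_pos (by norm_num)
  apply summable_of_sum_range_le (c := ∫ y in Set.Ioo 0 H, (Real.log (L y) / Real.log (5 / 4) + 1)) h0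
  intro N
  have hI : ∀ n, ∫ y in Set.Ioo 0 H, (Set.Ioo 0 (sSup (A n))).indicator (1 : ℝ → ℝ) y = sSup (A n) := by
    intro n
    rw [integral_indicator_one measurableSet_Ioo, measureReal_restrict_apply measurableSet_Ioo,
      Set.inter_eq_left.2 (Set.Ioo_subset_Ioo le_rfl (hH' n)), Real.volume_real_Ioo_of_le (h0 n),
      sub_zero]
  have hIi : ∀ n, IntegrableOn ((Set.Ioo 0 (sSup (A n))).indicator (1 : ℝ → ℝ)) (Set.Ioo 0 H) := by
    intro n
    exact (integrable_const (1 : ℝ)).indicator measurableSet_Ioo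
  calc ∑ n ∈ Finset.range N, sSup (A n)
      = ∫ y in Set.Ioo 0 H, ∑ n ∈ Finset.range N, (Set.Ioo 0 (sSup (A n))).indicator (1 : ℝ → ℝ) y := by
        rw [integral_finsetSum _ (fun n _ => hIi n)]
        exact Finset.sum_congr rfl fun n _ => (hI n).symm
    _ ≤ _ := by
      apply setIntegral_mono_on (integrable_finsetSum _ fun n _ => hIi n) _ measurableSet_Ioo
      · intro y hy
        apply count_le
        · exact div_nonneg (Real.log_nonneg (hL y hy)) hlog.le
        · intro n
          exact Set.indicator_le_self' (by simp) y |>.trans (by simp)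
        · intro n
          by_cases hyn : y ∈ Set.Ioo 0 (sSup (A n))
          · right
            obtain ⟨s, hs, hys⟩ := exists_lt_of_lt_csSup (hne n) hyn.2
            rcases hs with hs | hs
            · rw [Set.mem_singleton_iff.1 hs] at hys
              exact absurd hys (not_lt.2 hyn.1.le)
            · have h1 := hdec hy hs.1 hys.le
              rw [le_div_iff₀ hlog, ← Real.log_pow]
              exact Real.log_le_log (by positivity) (hs.2.le.trans h1)
          · left; simp [hyn]
      · exact (hint.div_const _).add (by simp)

open InnerProductSpace Metric in
lemma plane_f_bound {H ε : ℝ} (hεH : ε < H)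
    {M : ℝ → ℝ} (hdec : AntitoneOn M (Set.Ioo 0 H))
    (hMe : ∀ y ∈ Set.Ioo 0 H, Real.exp 1 ≤ M y)
    {w : EuclideanSpace ℝ (Fin 3) × ℝ → ℝ} {W : ℝ → ℝ → ℝ}
    (hw : HarmonicOnP w (Cyl4 ε H)) (hW : ∀ p ∈ Cyl4 ε H, w p = W ‖p.1‖ p.2)
    (hb : ∀ p ∈ Cyl4 ε H, p.2 ≠ 0 → |w p| ≤ M |p.2|)
    {z : ℂ} (h1 : |z.re| < ε / 2) (h2 : |z.im| < ε / 2) (h3 : z.im ≠ 0) :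
    ‖(fderiv ℝ (planeV w) z 1 : ℂ) - Complex.I * fderiv ℝ (planeV w) z Complex.I‖ ≤
      Real.exp (Real.log (4 * Real.exp 2 * ε) + Real.log (M (|z.im| / 2)) + 1 / |z.im|) := by
  set s := |z.im| with hs
  have hs0 : 0 < s := abs_pos.2 h3
  have hε : 0 < ε := by linarith
  have hsm : s / 2 ∈ Set.Ioo 0 H := ⟨by linarith, by linarith⟩
  have hM0 : 0 < M (s / 2) := (Real.exp_pos 1).trans_le (hMe _ hsm)
  have hball : ∀ y ∈ ball z (s / 2), |y.re| < ε ∧ |y.im| < H ∧ s / 2 ≤ |y.im| := by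
    intro y hy
    rw [mem_ball, dist_eq_norm] at hy
    have hre := (Complex.abs_re_le_norm (y - z)).trans_lt hy
    have him := (Complex.abs_im_le_norm (y - z)).trans_lt hy
    rw [Complex.sub_re] at hre
    rw [Complex.sub_im] at him
    have e1 := abs_sub_abs_le_abs_sub y.re z.re
    have e2 := abs_sub_abs_le_abs_sub y.im z.im
    have e3 := abs_sub_abs_le_abs_sub z.im y.im
    rw [abs_sub_comm z.im] at e3
    refine ⟨by linarith, by linarith, by linarith⟩
  have hgb := grad_bound (v := planeV w) (c := z) (r := s / 2) (B := ε * M (s / 2))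
    (by positivity) (by positivity)
    (fun y hy => planeV_harmonic hw hW (planeJ_mem (hball y hy).1 (hball y hy).2.1))
    (by
      intro y hy
      obtain ⟨b1, b2, b3⟩ := hball y hy
      have hp2 : (planeJ y).2 = y.im := by simp [planeJ_apply]
      have hne : y.im ≠ 0 := by
        intro h0
        rw [h0, abs_zero] at b3
        linarith
      have hwb := hb _ (planeJ_mem b1 b2) (by rwa [hp2])
      rw [hp2] at hwb
      have hMM : M |y.im| ≤ M (s / 2) := hdec hsm ⟨abs_pos.2 hne, b2⟩ b3
      rw [planeV, abs_mul]
      exact mul_le_mul b1.le (hwb.trans hMM) (abs_nonneg _) hε.le)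
  refine hgb.trans ?_
  rw [Real.exp_add, Real.exp_add, Real.exp_log (by positivity), Real.exp_log hM0]
  have hexp : 1 / s ≤ Real.exp (1 / s) := by linarith [Real.add_one_le_exp (1 / s)]
  calc 2 * Real.exp 2 * (ε * M (s / 2)) / (s / 2) = 4 * Real.exp 2 * ε * M (s / 2) * (1 / s) := by
        field_simp; norm_num
    _ ≤ _ := by gcongr

/-- If `w = w(ρ,h)` is an axially-symmetric harmonic function on the truncated cylinder
`P_ε ⊆ ℝ⁴` with `|w(x,y)| ≤ M(|y|)` for a decreasing `M : (0,H) → [e,∞)` with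
`∫₀^H log⁺ log⁺ M < ∞`, then there is `C = C(M,H,ε)` with `|w(0,y)| ≤ C` for
`|y| < H - ε`. -/
theorem stmt9 (H ε : ℝ) (hε : 0 < ε) (hεH : ε < H)
    (M : ℝ → ℝ) (hdec : AntitoneOn M (Set.Ioo 0 H))
    (hMe : ∀ y ∈ Set.Ioo 0 H, Real.exp 1 ≤ M y)
    (hMint : IntegrableOn (fun y => logPlus (logPlus (M y))) (Set.Ioo 0 H)) :
    ∃ C : ℝ, ∀ (w : EuclideanSpace ℝ (Fin 3) × ℝ → ℝ) (W : ℝ → ℝ → ℝ),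
      HarmonicOnP w (Cyl4 ε H) →
      (∀ p ∈ Cyl4 ε H, w p = W ‖p.1‖ p.2) →
      (∀ p ∈ Cyl4 ε H, p.2 ≠ 0 → |w p| ≤ M |p.2|) →
      ∀ y : ℝ, |y| < H - ε → |w (0, y)| ≤ C := by
  have hH : 0 < H := hε.trans hεH
  have hMpos : ∀ y ∈ Set.Ioo 0 H, 0 < M y := fun y hy => (Real.exp_pos 1).trans_le (hMe y hy)
  have hL1 : ∀ y ∈ Set.Ioo 0 H, 1 ≤ Real.log (M y) := fun y hy =>
    (Real.le_log_iff_exp_le (hMpos y hy)).2 (hMe y hy)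
  obtain ⟨σ, hσ0, hσs, hσ⟩ := exists_levels H hH (fun y => Real.log (M y))
    (fun x hx y hy hxy => Real.log_le_log (hMpos y hy) (hdec hx hy hxy)) hL1 (by
      refine hMint.congr_fun ?_ measurableSet_Ioo
      intro y hy
      have h1 := hL1 y hy
      simp only [logPlus]
      rw [max_eq_left (by linarith : (0 : ℝ) ≤ Real.log (M y)), max_eq_left (Real.log_nonneg h1)])
  set S : ℕ → ℝ := fun n => 8 * (2 * σ n + (4 / 5) ^ n) with hS
  have hSs : Summable S := ((hσs.mul_left 2).add
    (summable_geometric_of_lt_one (by norm_num) (by norm_num))).mul_left 8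
  have hpow : Filter.Tendsto (fun k : ℕ => (5 / 4 : ℝ) ^ k) Filter.atTop Filter.atTop :=
    tendsto_pow_atTop_atTop_of_one_lt (by norm_num)
  obtain ⟨k, hk1, hk2⟩ := (((tendsto_sum_nat_add S).eventually
    (gt_mem_nhds (show (0 : ℝ) < ε / 4 by positivity))).and
    (hpow.eventually_ge_atTop (Real.log (4 * Real.exp 2 * ε)))).exists
  refine ⟨Real.exp (6 * (5 / 4) ^ k) + M (ε / 4), ?_⟩
  intro w W hw hW hb y hy
  have hε4 : ε / 4 ∈ Set.Ioo 0 H := ⟨by linarith, by linarith⟩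
  have hyH : |y| < H := by linarith
  have hyC : ((0, y) : EuclideanSpace ℝ (Fin 3) × ℝ) ∈ Cyl4 ε H := ⟨by simpa using hε, hyH⟩
  by_cases hysm : ε / 4 ≤ |y|
  · have hy0 : 0 < |y| := by linarith
    have h1 := hb _ hyC (abs_pos.1 hy0)
    have h2 : M |y| ≤ M (ε / 4) := hdec hε4 ⟨hy0, hyH⟩ hysm
    have := Real.exp_pos (6 * (5 / 4) ^ k)
    simp only at h1
    linarith
  push Not at hysm
  set f : ℂ → ℂ := fun z =>
    (fderiv ℝ (planeV w) z 1 : ℂ) - Complex.I * fderiv ℝ (planeV w) z Complex.I with hf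
  set z0 : ℂ := ⟨0, y⟩ with hz0
  have hcb : ∀ z ∈ Metric.closedBall z0 (ε / 4), |z.re| < ε / 2 ∧ |z.im| < ε / 2 := by
    intro z hz
    rw [Metric.mem_closedBall, dist_eq_norm] at hz
    have hre := (Complex.abs_re_le_norm (z - z0)).trans hz
    have him := (Complex.abs_im_le_norm (z - z0)).trans hz
    rw [Complex.sub_re] at hre
    rw [Complex.sub_im] at him
    have e2 := abs_sub_abs_le_abs_sub z.im z0.im
    simp only [hz0, sub_zero] at hre him e2
    constructor <;> linarith
  have hiter : ‖f z0‖ < Real.exp (6 * (5 / 4) ^ k) := by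
    refine domar_iter (a := ε / 4) (by positivity) (fun n => 2 * σ (n + k) + (4 / 5) ^ (n + k))
      (fun n => by have := hσ0 (n + k); positivity) ?_ ?_ ?_
    · intro n
      refine le_trans ?_ hk1.le
      exact ((summable_nat_add_iff k).2 hSs).sum_le_tsum _ (fun i _ => by
        have := hσ0 (i + k)
        positivity)
    · intro z hz
      obtain ⟨c1, c2⟩ := hcb z hz
      exact (HarmonicAt.differentiableAt_complex_partial (planeV_harmonic hw hW
        (planeJ_mem (by linarith) (by linarith)))).differentiableWithinAt
    · intro n z hz hlt
      obtain ⟨c1, c2⟩ := hcb z hz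
      have hσn := hσ0 (n + k)
      have h45 : (0 : ℝ) < (4 / 5) ^ (n + k) := by positivity
      by_cases hzi : z.im = 0
      · rw [hzi, abs_zero]; positivity
      have hzpos : 0 < |z.im| := abs_pos.2 hzi
      have hbd := hlt.trans_le (plane_f_bound hεH hdec hMe hw hW hb c1 c2 hzi)
      rw [Real.exp_lt_exp] at hbd
      have e1 : (5 / 4 : ℝ) ^ n * (6 * (5 / 4) ^ k) / 2 = 3 * (5 / 4) ^ (n + k) := by
        rw [pow_add]; ring
      rw [e1] at hbd
      have hmono : (5 / 4 : ℝ) ^ k ≤ (5 / 4) ^ (n + k) :=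
        pow_le_pow_right₀ (by norm_num) (by omega)
      by_cases hcase : (5 / 4 : ℝ) ^ (n + k) < Real.log (M (|z.im| / 2))
      · have := hσ (n + k) (|z.im| / 2) ⟨by linarith, by linarith⟩ hcase
        linarith
      · push Not at hcase
        have h1 : (5 / 4 : ℝ) ^ (n + k) ≤ 1 / |z.im| := by linarith
        have h2 : |z.im| ≤ (4 / 5) ^ (n + k) := by
          rw [le_div_iff₀ hzpos] at h1
          have e : (4 / 5 : ℝ) ^ (n + k) * (5 / 4) ^ (n + k) = 1 := by
            rw [← mul_pow]; norm_num
          calc |z.im| = (4 / 5) ^ (n + k) * ((5 / 4) ^ (n + k) * |z.im|) := by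
                rw [← mul_assoc, e, one_mul]
            _ ≤ (4 / 5) ^ (n + k) * 1 := by gcongr
            _ = _ := mul_one _
        linarith
  have hJ0 : planeJ z0 = (0, y) := by simp [planeJ_apply, hz0]
  have hre : (f z0).re = w (0, y) := by
    have h1 := planeV_hasFDerivAt hw.1 (z := z0) (by rw [hJ0]; exact hyC) 1
    rw [hJ0] at h1
    simp [hf, h1]
    simp [hz0]
  have h1 := Complex.abs_re_le_norm (f z0)
  rw [hre] at h1
  have h2 := hMpos _ hε4
  linarith
end

section
/- Let k ≥ 1 and let u = u(ρ, h) be a continuous function on [0, ε) × (−H, H) which on ρ > 0 satisfies the Euler–Darboux equation ∂²u/∂ρ² + ∂²u/∂h² + ((2k+1)/ρ) ∂u/∂ρ = 0, and let v(φ, ρ, h) = Re(ρ^k e^{ikφ} u(ρ, h)) be the associated harmonic function on the cylinder in ℝ³. Then (∂^k v / ∂ρ^k)(0, 0, h) = k! · u(0, h) for each h, where the derivative is taken along the ray φ = 0. -/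
/-- Partial derivative in the first coordinate of a function on `ℝ × ℝ`. -/
noncomputable def pd1 (u : ℝ × ℝ → ℝ) (p : ℝ × ℝ) : ℝ := fderiv ℝ u p (1, 0)

/-- Partial derivative in the second coordinate of a function on `ℝ × ℝ`. -/
noncomputable def pd2 (u : ℝ × ℝ → ℝ) (p : ℝ × ℝ) : ℝ := fderiv ℝ u p (0, 1)

open MeasureTheory Filter Topology Asymptotics in
/-- A polynomial of degree at most `k` which is `o(t^k)` at `0` vanishes. -/
lemma coeff_zero_of_isLittleO (k : ℕ) : ∀ a : ℕ → ℝ,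
    (fun t : ℝ => ∑ j ∈ Finset.range (k + 1), a j * t ^ j) =o[𝓝[>] 0] (fun t : ℝ => t ^ k) →
    ∀ j ≤ k, a j = 0 := by
  have key : ∀ (k : ℕ) (c : ℝ), (fun t : ℝ => c * t ^ k) =o[𝓝[>] 0] (fun t : ℝ => t ^ k) →
      c = 0 := by
    intro k c h
    have h1 : Tendsto (fun t : ℝ => c * t ^ k / t ^ k) (𝓝[>] 0) (𝓝 0) := h.tendsto_div_nhds_zero
    have h2 : Tendsto (fun t : ℝ => c * t ^ k / t ^ k) (𝓝[>] 0) (𝓝 c) := by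
      refine tendsto_const_nhds.congr' ?_
      filter_upwards [self_mem_nhdsWithin] with t ht
      have : t ^ k ≠ 0 := pow_ne_zero _ (ne_of_gt ht)
      field_simp
    exact tendsto_nhds_unique h2 h1
  induction k with
  | zero =>
    intro a h j hj
    obtain rfl : j = 0 := by omega
    apply key 0
    simpa using h
  | succ k ih =>
    intro a h
    have hlit : (fun t : ℝ => t ^ (k + 1)) =o[𝓝[>] 0] (fun t : ℝ => t ^ k) :=
      (isLittleO_pow_pow (𝕜 := ℝ) (Nat.lt_succ_self k)).mono nhdsWithin_le_nhds
    have h1 := ih a (by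
      have := (h.trans hlit).sub (hlit.const_mul_left (a (k + 1)))
      refine this.congr_left fun t => ?_
      rw [Finset.sum_range_succ _ (k + 1)]
      ring)
    intro j hj
    rcases Nat.lt_or_ge j (k + 1) with hlt | hge
    · exact h1 j (by omega)
    · obtain rfl : j = k + 1 := by omega
      apply key (k + 1)
      refine h.congr_left fun t => ?_
      rw [Finset.sum_range_succ, Finset.sum_eq_zero, zero_add]
      intro i hi
      rw [h1 i (by simpa [Nat.lt_succ_iff] using hi), zero_mul]

open MeasureTheory Filter Topology Asymptotics in
lemma iteratedDeriv_of_tendsto (k : ℕ) (g m : ℝ → ℝ) (c : ℝ) (hg : ContDiff ℝ k g)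
    (hm : Tendsto m (𝓝[>] 0) (𝓝 c)) (hgm : ∀ᶠ t in 𝓝[>] (0 : ℝ), g t = t ^ k * m t) :
    iteratedDeriv k g 0 = (k.factorial : ℝ) * c := by
  have h1 := (taylor_isLittleO_univ (x₀ := (0 : ℝ)) hg).mono
    (nhdsWithin_le_nhds : 𝓝[>] (0 : ℝ) ≤ 𝓝 0)
  have h2 : (fun t : ℝ => g t - c * t ^ k) =o[𝓝[>] 0] (fun t : ℝ => t ^ k) := by
    have h3 : (fun t : ℝ => m t - c) =o[𝓝[>] 0] (fun _ : ℝ => (1 : ℝ)) := by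
      rw [isLittleO_one_iff]
      simpa using hm.sub_const c
    have h4 := (isBigO_refl (fun t : ℝ => t ^ k) (𝓝[>] 0)).mul_isLittleO h3
    refine h4.congr' ?_ (by simp)
    filter_upwards [hgm] with t ht
    rw [ht]; ring
  have h5 := coeff_zero_of_isLittleO k
    (fun j => (j.factorial : ℝ)⁻¹ * iteratedDeriv j g 0 - if j = k then c else 0) (by
      have := h2.sub (h1.congr_right (fun t => by rw [sub_zero]))
      refine this.congr_left fun t => ?_
      rw [taylor_within_apply]
      simp only [sub_mul, Finset.sum_sub_distrib, ite_mul, zero_mul, Finset.sum_ite_eq',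
        Finset.mem_range, Nat.lt_succ_self, if_true, iteratedDerivWithin_univ, sub_zero, smul_eq_mul]
      have : ∀ j : ℕ, (j.factorial : ℝ)⁻¹ * t ^ j * iteratedDeriv j g 0 =
        (j.factorial : ℝ)⁻¹ * iteratedDeriv j g 0 * t ^ j := fun j => by ring
      simp only [this]
      ring) k le_rfl
  have h6 : (k.factorial : ℝ) ≠ 0 := by exact_mod_cast k.factorial_ne_zero
  simp only [if_true] at h5
  field_simp at h5
  linarith

abbrev E3 := EuclideanSpace ℝ (Fin 3)

noncomputable def bet (q : ℝ) : ℝ := Real.smoothTransition (1 - q)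
noncomputable def Bet (q : ℝ) : ℝ := ∫ s in (1 : ℝ)..q, bet s
noncomputable def phi (y : E3) : ℝ := bet (‖y‖ ^ 2)
noncomputable def psi (y : E3) : ℝ := Bet (‖y‖ ^ 2) / 2

lemma bet_contDiff {n : ℕ∞} : ContDiff ℝ n bet :=
  Real.smoothTransition.contDiff.comp (contDiff_const.sub contDiff_id)

lemma bet_zero {q : ℝ} (hq : 1 ≤ q) : bet q = 0 :=
  Real.smoothTransition.zero_of_nonpos (by linarith)

lemma Bet_hasDerivAt (q : ℝ) : HasDerivAt Bet (bet q) q := by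
  have hc : Continuous bet := (bet_contDiff (n := 0)).continuous
  exact intervalIntegral.integral_hasDerivAt_right (hc.intervalIntegrable _ _)
    (hc.stronglyMeasurableAtFilter _ _) hc.continuousAt

lemma Bet_zero {q : ℝ} (hq : 1 ≤ q) : Bet q = 0 := by
  unfold Bet
  rw [intervalIntegral.integral_congr (g := fun _ => (0 : ℝ))]
  · simp
  · intro s hs
    rw [Set.uIcc_of_le hq] at hs
    exact bet_zero hs.1

lemma phi_contDiff {n : ℕ∞} : ContDiff ℝ n phi :=
  bet_contDiff.comp (contDiff_norm_sq ℝ)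

lemma phi_zero {y : E3} (hy : 1 ≤ ‖y‖) : phi y = 0 := bet_zero (by nlinarith)
lemma psi_zero {y : E3} (hy : 1 ≤ ‖y‖) : psi y = 0 := by
  unfold psi; rw [Bet_zero (by nlinarith)]; simp

lemma phi_compact : HasCompactSupport phi :=
  HasCompactSupport.intro (isCompact_closedBall (0 : E3) 1) fun y hy => phi_zero (by
    simp at hy; exact hy.le)

lemma psi_compact : HasCompactSupport psi :=
  HasCompactSupport.intro (isCompact_closedBall (0 : E3) 1) fun y hy => psi_zero (by
    simp at hy; exact hy.le)

lemma phi_integral_pos : 0 < ∫ y, phi y := by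
  refine Continuous.integral_pos_of_hasCompactSupport_nonneg_nonzero (x := 0)
    (phi_contDiff (n := 0)).continuous phi_compact ?_ ?_
  · intro y; exact Real.smoothTransition.nonneg _
  · simp [phi, bet]

lemma psi_hasFDerivAt (y : E3) : HasFDerivAt psi (phi y • innerSL ℝ y) y := by
  have h1 := (Bet_hasDerivAt (‖y‖ ^ 2)).comp_hasFDerivAt y (hasStrictFDerivAt_norm_sq y).hasFDerivAt
  have h2 := h1.mul_const (1 / 2 : ℝ)
  refine (h2.congr_fderiv ?_).congr_of_eventuallyEq ?_
  · ext z; simp [phi]; ring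
  · exact Filter.Eventually.of_forall fun z => by simp [psi, div_eq_mul_inv]

lemma psi_fderiv_single (y : E3) (i : Fin 3) :
    fderiv ℝ psi y (EuclideanSpace.single i 1) = y i * phi y := by
  rw [(psi_hasFDerivAt y).fderiv]
  simp [mul_comm, EuclideanSpace.inner_single_right]

lemma psi_cont : Continuous psi :=
  continuous_iff_continuousAt.2 fun y => (psi_hasFDerivAt y).continuousAt

open MeasureTheory in
/-- Integration by parts. -/
lemma ibp (w : E3 → ℝ) (hw : ContDiff ℝ 2 w) (x : E3) (s : ℝ) (i : Fin 3) :
    Integrable (fun y : E3 => fderiv ℝ w (x - s • y) (EuclideanSpace.single i 1) * (y i * phi y)) ∧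
    Integrable (fun y : E3 => fderiv ℝ (fun z => fderiv ℝ w z (EuclideanSpace.single i 1))
        (x - s • y) (EuclideanSpace.single i 1) * psi y) ∧
    ∫ y : E3, fderiv ℝ w (x - s • y) (EuclideanSpace.single i 1) * (y i * phi y) =
     s * ∫ y : E3, fderiv ℝ (fun z => fderiv ℝ w z (EuclideanSpace.single i 1)) (x - s • y)
        (EuclideanSpace.single i 1) * psi y := by
  set e : E3 := EuclideanSpace.single i 1 with he
  set D : E3 → ℝ := fun z => fderiv ℝ w z e with hD
  have hDc : ContDiff ℝ 1 D := (hw.fderiv_right (m := 1) (by norm_num)).clm_apply contDiff_const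
  have hD2 : Continuous (fun z => fderiv ℝ D z e) :=
    (hDc.continuous_fderiv (by norm_num)).clm_apply continuous_const
  have hsub : Continuous (fun y : E3 => x - s • y) := by fun_prop
  have hphi : Continuous phi := (phi_contDiff (n := 0)).continuous
  have hphi' : Continuous (fun y : E3 => y i * phi y) := by fun_prop
  have i1 : Integrable (fun y : E3 => D (x - s • y) * (y i * phi y)) := by
    refine Continuous.integrable_of_hasCompactSupport
      ((hDc.continuous.comp hsub).mul hphi') ?_
    exact (phi_compact.mul_left (f := fun y : E3 => y i)).mul_left
  have i2 : Integrable (fun y : E3 => fderiv ℝ D (x - s • y) e * psi y) :=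
    Continuous.integrable_of_hasCompactSupport ((hD2.comp hsub).mul psi_cont) psi_compact.mul_left
  have i3 : Integrable (fun y : E3 => D (x - s • y) * psi y) :=
    Continuous.integrable_of_hasCompactSupport ((hDc.continuous.comp hsub).mul psi_cont)
      psi_compact.mul_left
  have hfd : ∀ y : E3, HasFDerivAt (fun y : E3 => D (x - s • y))
      ((fderiv ℝ D (x - s • y)).comp (-(s • ContinuousLinearMap.id ℝ E3))) y := by
    intro y
    refine HasFDerivAt.comp y (g := D)
      ((hDc.differentiable (by norm_num)) (x - s • y)).hasFDerivAt ?_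
    exact ((hasFDerivAt_id y).const_smul s).const_sub x
  have hfd' : ∀ y : E3, fderiv ℝ (fun y : E3 => D (x - s • y)) y e =
      - s * fderiv ℝ D (x - s • y) e := by
    intro y
    rw [(hfd y).fderiv]
    simp
  refine ⟨i1, i2, ?_⟩
  have := integral_mul_fderiv_eq_neg_fderiv_mul_of_integrable (μ := (volume : Measure E3))
    (f := fun y : E3 => D (x - s • y)) (g := psi) (v := e)
    (by
      simp only [hfd', mul_assoc]
      exact i2.const_mul (-s))
    (by
      simp only [he, psi_fderiv_single]
      exact i1)
    i3 (fun y _ => (hfd y).differentiableAt) (fun y _ => (psi_hasFDerivAt y).differentiableAt)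
  simp only [hfd'] at this
  simp only [he, psi_fderiv_single, mul_assoc] at this
  rw [integral_const_mul] at this
  rw [this]
  ring

open MeasureTheory in
lemma mean_value (w : E3 → ℝ) (hw : ContDiff ℝ 2 w) (hwc : HasCompactSupport w) (x : E3) (δ : ℝ)
    (hδ : 0 < δ)
    (hharm : ∀ z ∈ Metric.closedBall x δ,
      (∑ i : Fin 3, fderiv ℝ (fun y => fderiv ℝ w y (EuclideanSpace.single i 1)) z
      (EuclideanSpace.single i 1)) = 0) :
    ∫ y : E3, w (x - δ • y) * phi y = w x * ∫ y : E3, phi y := by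
  have hphi : Continuous phi := (phi_contDiff (n := 0)).continuous
  have hfc : Continuous (fderiv ℝ w) := hw.continuous_fderiv (by norm_num)
  obtain ⟨C, hC⟩ := (hwc.fderiv (𝕜 := ℝ)).exists_bound_of_continuous hfc
  have hder : ∀ s : ℝ, HasDerivAt (fun s : ℝ => ∫ y : E3, w (x - s • y) * phi y)
      (∫ y : E3, fderiv ℝ w (x - s • y) (-y) * phi y) s := by
    intro s
    refine (hasDerivAt_integral_of_dominated_loc_of_deriv_le (μ := (volume : Measure E3))
      (F := fun (s : ℝ) (y : E3) => w (x - s • y) * phi y)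
      (F' := fun (s : ℝ) (y : E3) => fderiv ℝ w (x - s • y) (-y) * phi y)
      (bound := fun y => C * ‖y‖ * ‖phi y‖) (s := Set.univ) Filter.univ_mem ?_ ?_ ?_ ?_ ?_ ?_).2
    · refine Filter.Eventually.of_forall fun s => Continuous.aestronglyMeasurable ?_
      have := hw.continuous
      fun_prop
    · refine Continuous.integrable_of_hasCompactSupport ?_ phi_compact.mul_left
      have := hw.continuous
      fun_prop
    · refine Continuous.aestronglyMeasurable ?_
      fun_prop
    · refine Filter.Eventually.of_forall fun y s _ => ?_
      rw [norm_mul]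
      refine mul_le_mul_of_nonneg_right ?_ (norm_nonneg _)
      refine (ContinuousLinearMap.le_opNorm _ _).trans ?_
      rw [norm_neg]
      exact mul_le_mul_of_nonneg_right (hC _) (norm_nonneg _)
    · refine Continuous.integrable_of_hasCompactSupport (by fun_prop) ?_
      exact (phi_compact.norm).mul_left
    · refine Filter.Eventually.of_forall fun y s _ => ?_
      refine HasDerivAt.mul_const ?_ _
      have h1 : HasDerivAt (fun s : ℝ => x - s • y) (-y) s := by
        have := ((hasDerivAt_id s).smul_const y).const_sub x
        simpa using this
      exact ((hw.differentiable (by norm_num)) (x - s • y)).hasFDerivAt.comp_hasDerivAt s h1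
  have hzero : ∀ s ∈ Set.Icc 0 δ, ∫ y : E3, fderiv ℝ w (x - s • y) (-y) * phi y = 0 := by
    intro s hs
    have e1 : ∀ y : E3, fderiv ℝ w (x - s • y) (-y) * phi y =
        - ∑ i : Fin 3, fderiv ℝ w (x - s • y) (EuclideanSpace.single i 1) * (y i * phi y) := by
      intro y
      have hy : y = ∑ i : Fin 3, y i • (EuclideanSpace.single i (1 : ℝ) : E3) := by
        have := (EuclideanSpace.basisFun (Fin 3) ℝ).sum_repr y
        simpa using this.symm
      have : fderiv ℝ w (x - s • y) y =
          ∑ i : Fin 3, y i * fderiv ℝ w (x - s • y) (EuclideanSpace.single i 1) := by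
        generalize fderiv ℝ w (x - s • y) = A
        conv_lhs => rw [hy]
        rw [map_sum]
        simp
      rw [map_neg, this, neg_mul, Finset.sum_mul]
      congr 1
      refine Finset.sum_congr rfl fun i _ => by ring
    simp only [e1]
    rw [integral_neg, integral_finsetSum _ fun i _ => (ibp w hw x s i).1]
    rw [Finset.sum_congr rfl fun i _ => (ibp w hw x s i).2.2, ← Finset.mul_sum,
      ← integral_finsetSum _ fun i _ => (ibp w hw x s i).2.1]
    have : ∀ y : E3, ∑ i : Fin 3, fderiv ℝ (fun z => fderiv ℝ w z (EuclideanSpace.single i 1))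
        (x - s • y) (EuclideanSpace.single i 1) * psi y = 0 := by
      intro y
      rw [← Finset.sum_mul]
      rcases le_or_gt 1 ‖y‖ with h | h
      · rw [psi_zero h, mul_zero]
      · rw [hharm, zero_mul]
        rw [mem_closedBall_iff_norm]
        have : ‖x - s • y - x‖ = s * ‖y‖ := by
          rw [show x - s • y - x = -(s • y) by abel, norm_neg, norm_smul, Real.norm_eq_abs,
            abs_of_nonneg hs.1]
        rw [this]
        nlinarith [hs.1, hs.2, norm_nonneg y]
    simp [this]
  have := constant_of_has_deriv_right_zero (a := 0) (b := δ)
    (f := fun s : ℝ => ∫ y : E3, w (x - s • y) * phi y)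
    (fun s _ => (hder s).continuousAt.continuousWithinAt)
    (fun s hs => by
      have := hder s
      rw [hzero s ⟨hs.1, hs.2.le⟩] at this
      exact this.hasDerivWithinAt) δ ⟨hδ.le, le_rfl⟩
  rw [this]
  simp [integral_const_mul]

open MeasureTheory Convolution in
lemma conv_smooth (w : E3 → ℝ) (hw : Continuous w) (δ : ℝ) (hδ : 0 < δ) (n : ℕ) :
    ContDiff ℝ n (fun x => ∫ y : E3, w (x - δ • y) * phi y) := by
  have hk : ContDiff ℝ n (fun y : E3 => phi (δ⁻¹ • y)) :=
    (phi_contDiff (n := n)).comp (contDiff_const_smul _)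
  have hkc : HasCompactSupport (fun y : E3 => phi (δ⁻¹ • y)) :=
    phi_compact.comp_smul (inv_ne_zero hδ.ne')
  have h1 := hkc.contDiff_convolution_left (n := n) (μ := (volume : Measure E3))
    (ContinuousLinearMap.mul ℝ ℝ) hk (hw.locallyIntegrable)
  have h2 : (fun x => ∫ y : E3, w (x - δ • y) * phi y) =
      fun x => |(δ ^ Module.finrank ℝ E3)⁻¹| *
        ((fun y : E3 => phi (δ⁻¹ • y)) ⋆[ContinuousLinearMap.mul ℝ ℝ, volume] w) x := by
    funext x
    have := Measure.integral_comp_smul (volume : Measure E3)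
      (fun z : E3 => w (x - z) * phi (δ⁻¹ • z)) δ
    simp only [smul_smul, inv_mul_cancel₀ hδ.ne', one_smul, smul_eq_mul] at this
    rw [this, convolution_def]
    simp [mul_comm]
  rw [h2]
  exact contDiff_const.mul h1

open MeasureTheory Filter Topology in
/-- Harmonic functions coincide locally with smooth functions. -/
lemma harmonic_smooth (v : E3 → ℝ) (S : Set E3) (hS : IsOpen S) (hv : HarmonicOnE v S)
    (p : E3) (hp : p ∈ S) (n : ℕ) : ∃ G : E3 → ℝ, ContDiff ℝ n G ∧ v =ᶠ[𝓝 p] G := by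
  obtain ⟨r, hr, hrS⟩ := Metric.nhds_basis_closedBall.mem_iff.1 (hS.mem_nhds hp)
  let χ : ContDiffBump p := ⟨r / 2, r, by positivity, by linarith⟩
  set w : E3 → ℝ := fun x => χ x * v x with hwdef
  have hw : ContDiff ℝ 2 w := by
    rw [contDiff_iff_contDiffAt]
    intro x
    by_cases hx : x ∈ S
    · exact χ.contDiff.contDiffAt.mul (hv.1.contDiffAt (hS.mem_nhds hx))
    · have : x ∉ tsupport χ := by
        rw [χ.tsupport_eq]
        exact fun h => hx (hrS h)
      refine (contDiffAt_const (c := (0 : ℝ))).congr_of_eventuallyEq ?_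
      filter_upwards [notMem_tsupport_iff_eventuallyEq.1 this] with y hy
      simp [hwdef, hy]
  have hwc : HasCompactSupport w := χ.hasCompactSupport.mul_right
  have hwv : ∀ z ∈ Metric.ball p (r / 2), w =ᶠ[𝓝 z] v := by
    intro z hz
    filter_upwards [Metric.isOpen_ball.mem_nhds hz] with y hy
    have : χ y = 1 := χ.one_of_mem_closedBall (Metric.ball_subset_closedBall hy)
    simp [hwdef, this]
  have hlap : ∀ z ∈ Metric.ball p (r / 2),
      (∑ i : Fin 3, fderiv ℝ (fun y => fderiv ℝ w y (EuclideanSpace.single i 1)) z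
      (EuclideanSpace.single i 1)) = 0 := by
    intro z hz
    have hzS : z ∈ S := hrS (Metric.closedBall_subset_closedBall (by linarith)
      (Metric.ball_subset_closedBall hz))
    rw [← hv.2 z hzS]
    refine Finset.sum_congr rfl fun i _ => ?_
    have : (fun y => fderiv ℝ w y (EuclideanSpace.single i 1)) =ᶠ[𝓝 z]
        (fun y => fderiv ℝ v y (EuclideanSpace.single i 1)) := by
      filter_upwards [(hwv z hz).fderiv (𝕜 := ℝ)] with y hy
      rw [hy]
    rw [this.fderiv_eq]
  refine ⟨fun x => (∫ y : E3, w (x - (r / 8) • y) * phi y) * (∫ y : E3, phi y)⁻¹,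
    (conv_smooth w hw.continuous (r / 8) (by positivity) n).mul contDiff_const, ?_⟩
  filter_upwards [Metric.ball_mem_nhds p (show 0 < r / 4 by positivity)] with x hx
  rw [mean_value w hw hwc x (r / 8) (by positivity), mul_assoc,
    mul_inv_cancel₀ phi_integral_pos.ne', mul_one]
  · exact ((hwv x (Metric.ball_subset_ball (by linarith) hx)).eq_of_nhds).symm
  · intro z hz
    apply hlap
    rw [Metric.mem_ball] at hx ⊢
    rw [Metric.mem_closedBall] at hz
    linarith [dist_triangle z x p]

/-- Recovering axis values: if `u(ρ,h)` is continuous on `[0,ε) × (-H,H)`, solves the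
Euler–Darboux equation `u_ρρ + u_hh + ((2k+1)/ρ) u_ρ = 0` for `ρ > 0`, and
`v = Re(ρ^k e^{ikφ} u(ρ,h))` is the associated harmonic function on the cylinder in `ℝ³`
(in Cartesian coordinates `v(x₁,x₂,h) = Re((x₁+ix₂)^k u(√(x₁²+x₂²),h))`), then the `k`-th
derivative of `v` at `(0,0,h)` along the ray `φ = 0` equals `k! ⬝ u(0,h)`. -/
theorem stmt13 (k : ℕ) (hk : 1 ≤ k) (ε H : ℝ) (hε : 0 < ε) (hH : 0 < H)
    (u : ℝ × ℝ → ℝ)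
    (hcont : ContinuousOn u (Set.Ico 0 ε ×ˢ Set.Ioo (-H) H))
    (hC2 : ContDiffOn ℝ 2 u (Set.Ioo 0 ε ×ˢ Set.Ioo (-H) H))
    (hED : ∀ p ∈ Set.Ioo 0 ε ×ˢ Set.Ioo (-H) H,
      pd1 (pd1 u) p + pd2 (pd2 u) p + (2 * k + 1) / p.1 * pd1 u p = 0)
    (v : EuclideanSpace ℝ (Fin 3) → ℝ)
    (hv : ∀ x, v x = ((↑(x 0) + ↑(x 1) * Complex.I) ^ k *
      ↑(u (Real.sqrt ((x 0) ^ 2 + (x 1) ^ 2), x 2))).re)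
    (hvharm : HarmonicOnE v
      {x : EuclideanSpace ℝ (Fin 3) | (x 0) ^ 2 + (x 1) ^ 2 < ε ^ 2 ∧ |x 2| < H}) :
    ∀ h : ℝ, |h| < H →
      iteratedDeriv k
          (fun t : ℝ => v (t • EuclideanSpace.single (0 : Fin 3) (1 : ℝ) +
            h • EuclideanSpace.single (2 : Fin 3) (1 : ℝ))) 0 =
        (k.factorial : ℝ) * u (0, h) := by
  intro h hh
  set S : Set E3 := {x : EuclideanSpace ℝ (Fin 3) | (x 0) ^ 2 + (x 1) ^ 2 < ε ^ 2 ∧ |x 2| < H}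
    with hSdef
  have hS : IsOpen S := by
    have h1 : Continuous (fun x : E3 => (x 0) ^ 2 + (x 1) ^ 2) := by fun_prop
    have h2 : Continuous (fun x : E3 => |x 2|) := by fun_prop
    exact (isOpen_lt h1 continuous_const).inter (isOpen_lt h2 continuous_const)
  set L : ℝ → E3 := fun t : ℝ => t • EuclideanSpace.single (0 : Fin 3) (1 : ℝ) +
            h • EuclideanSpace.single (2 : Fin 3) (1 : ℝ) with hL
  have hLc : ContDiff ℝ k L := by fun_prop
  have hp : L 0 ∈ S := by
    simp [hSdef, hL, hh, hε]
  obtain ⟨G, hG, hvG⟩ := harmonic_smooth v S hS hvharm (L 0) hp k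
  have hev : (fun t => v (L t)) =ᶠ[nhds 0] (fun t => G (L t)) :=
    hLc.continuous.continuousAt.eventually hvG
  change iteratedDeriv k (fun t => v (L t)) 0 = _
  rw [hev.iteratedDeriv_eq k]
  refine iteratedDeriv_of_tendsto k _ (fun t => u (t, h)) _ (hG.comp hLc) ?_ ?_
  · have hmem : ((0 : ℝ), h) ∈ Set.Ico 0 ε ×ˢ Set.Ioo (-H) H :=
      ⟨⟨le_rfl, hε⟩, abs_lt.1 hh⟩
    refine (hcont _ hmem).tendsto.comp ?_
    refine tendsto_nhdsWithin_iff.2 ⟨?_, ?_⟩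
    · have : Continuous (fun t : ℝ => (t, h)) := by fun_prop
      exact (this.tendsto 0).mono_left nhdsWithin_le_nhds
    · filter_upwards [Ioo_mem_nhdsGT hε] with t ht
      exact ⟨⟨ht.1.le, ht.2⟩, abs_lt.1 hh⟩
  · filter_upwards [self_mem_nhdsWithin, nhdsWithin_le_nhds hev] with t ht hvt
    rw [← hvt, hv]
    have ht' : (0 : ℝ) ≤ t := le_of_lt ht
    have e0 : (L t) 0 = t := by simp [hL]
    have e1 : (L t) 1 = 0 := by simp [hL]
    have e2 : (L t) 2 = h := by simp [hL]
    rw [e0, e1, e2]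
    have : Real.sqrt (t ^ 2 + 0 ^ 2) = t := by
      simp [Real.sqrt_sq ht']
    rw [this]
    simp only [Complex.ofReal_zero, zero_mul, add_zero]
    rw [← Complex.ofReal_pow, ← Complex.ofReal_mul, Complex.ofReal_re]
end
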